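/- Let T be any recursively enumerable extension of PA(K) such that T ⊬ □⊥. Then the following are pairwise equivalent: (1) T has ΔB-DP and (ΣB, Σ₁)-DP; (2) T has B-EP; (3) T has ΣB-EP; (4) T has ΣB-DP. -/

import Mathlib

namespace ModalArith

/-- Terms of the language of arithmetic L_A = {0, S, +, ×, ≤, =}. -/
inductive Term : Type
  | var : ℕ → Term
  | zero : Term
  | succ : Term → Term
  | add : Term → Term → Term
  | mul : Term → Term → Term
  deriving DecidableEq

namespace Term

/-- Free variables of a term. -/
def fv : Term → Finset ℕ
  | var x => {x}
  | zero => ∅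
  | succ t => fv t
  | add t u => fv t ∪ fv u
  | mul t u => fv t ∪ fv u

/-- Simultaneous substitution of terms for variables. -/
def substAll : Term → (ℕ → Term) → Term
  | var x, v => v x
  | zero, _ => zero
  | succ t, v => succ (substAll t v)
  | add t u, v => add (substAll t v) (substAll u v)
  | mul t u, v => mul (substAll t v) (substAll u v)

/-- Substitution of the term `s` for the variable `x`. -/
def subst (x : ℕ) (s : Term) (t : Term) : Term :=
  substAll t (Function.update Term.var x s)

/-- The numeral `n̄`. -/
def numeral : ℕ → Term
  | 0 => zero
  | n + 1 => succ (numeral n)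

/-- Value of a term in the standard model under a valuation. -/
def val : Term → (ℕ → ℕ) → ℕ
  | var x, v => v x
  | zero, _ => 0
  | succ t, v => val t v + 1
  | add t u, v => val t v + val u v
  | mul t u, v => val t v * val u v

/-- A Gödel numbering of terms. -/
def code : Term → ℕ
  | var x => Nat.pair 0 x
  | zero => Nat.pair 1 0
  | succ t => Nat.pair 2 (code t)
  | add t u => Nat.pair 3 (Nat.pair (code t) (code u))
  | mul t u => Nat.pair 4 (Nat.pair (code t) (code u))

end Term

/-- Formulas of the language L_□ of modal arithmetic. -/
inductive Formula : Type
  | falsum : Formula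
  | eq : Term → Term → Formula
  | le : Term → Term → Formula
  | and : Formula → Formula → Formula
  | or : Formula → Formula → Formula
  | imp : Formula → Formula → Formula
  | neg : Formula → Formula
  | all : ℕ → Formula → Formula
  | ex : ℕ → Formula → Formula
  | box : Formula → Formula
  deriving DecidableEq

namespace Formula

/-- Free variables of a formula. -/
def fv : Formula → Finset ℕ
  | falsum => ∅
  | eq t u => t.fv ∪ u.fv
  | le t u => t.fv ∪ u.fv
  | and φ ψ => fv φ ∪ fv ψ
  | or φ ψ => fv φ ∪ fv ψ
  | imp φ ψ => fv φ ∪ fv ψ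
  | neg φ => fv φ
  | all x φ => (fv φ).erase x
  | ex x φ => (fv φ).erase x
  | box φ => fv φ

/-- Simultaneous substitution of terms for the free variables of a formula. -/
def substAll : Formula → (ℕ → Term) → Formula
  | falsum, _ => falsum
  | eq t u, v => eq (t.substAll v) (u.substAll v)
  | le t u, v => le (t.substAll v) (u.substAll v)
  | and φ ψ, v => and (substAll φ v) (substAll ψ v)
  | or φ ψ, v => or (substAll φ v) (substAll ψ v)
  | imp φ ψ, v => imp (substAll φ v) (substAll ψ v)
  | neg φ, v => neg (substAll φ v)
  | all x φ, v => all x (substAll φ (Function.update v x (Term.var x)))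
  | ex x φ, v => ex x (substAll φ (Function.update v x (Term.var x)))
  | box φ, v => box (substAll φ v)

/-- Substitution of the term `s` for the free occurrences of the variable `x`. -/
def subst (x : ℕ) (s : Term) (φ : Formula) : Formula :=
  substAll φ (Function.update Term.var x s)

/-- The term `s` is substitutable (free) for the variable `x` in the formula. -/
def freeFor (s : Term) (x : ℕ) : Formula → Prop
  | falsum => True
  | eq _ _ => True
  | le _ _ => True
  | and φ ψ => freeFor s x φ ∧ freeFor s x ψ
  | or φ ψ => freeFor s x φ ∧ freeFor s x ψ
  | imp φ ψ => freeFor s x φ ∧ freeFor s x ψ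
  | neg φ => freeFor s x φ
  | all y φ => x = y ∨ x ∉ fv φ ∨ (y ∉ s.fv ∧ freeFor s x φ)
  | ex y φ => x = y ∨ x ∉ fv φ ∨ (y ∉ s.fv ∧ freeFor s x φ)
  | box φ => freeFor s x φ

/-- The formula is an L_A-formula (contains no □). -/
def noBox : Formula → Prop
  | falsum => True
  | eq _ _ => True
  | le _ _ => True
  | and φ ψ => noBox φ ∧ noBox ψ
  | or φ ψ => noBox φ ∧ noBox ψ
  | imp φ ψ => noBox φ ∧ noBox ψ
  | neg φ => noBox φ
  | all _ φ => noBox φ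
  | ex _ φ => noBox φ
  | box _ => False

/-- Truth in the standard model ℕ under a valuation (meaningful for L_A-formulas;
boxed formulas are given the dummy value `False`). -/
def val : Formula → (ℕ → ℕ) → Prop
  | falsum, _ => False
  | eq t u, v => t.val v = u.val v
  | le t u, v => t.val v ≤ u.val v
  | and φ ψ, v => val φ v ∧ val ψ v
  | or φ ψ, v => val φ v ∨ val ψ v
  | imp φ ψ, v => val φ v → val ψ v
  | neg φ, v => ¬ val φ v
  | all x φ, v => ∀ n : ℕ, val φ (Function.update v x n)
  | ex x φ, v => ∃ n : ℕ, val φ (Function.update v x n)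
  | box _, _ => False

/-- Biconditional, as an abbreviation. -/
def iff (φ ψ : Formula) : Formula := (φ.imp ψ).and (ψ.imp φ)

/-- `t < u` abbreviates `S t ≤ u`. -/
def lt (t u : Term) : Formula := le (Term.succ t) u

/-- Bounded universal quantification `∀ x < t, φ`. -/
def ball (x : ℕ) (t : Term) (φ : Formula) : Formula :=
  all x ((lt (Term.var x) t).imp φ)

/-- Bounded existential quantification `∃ x < t, φ`. -/
def bex (x : ℕ) (t : Term) (φ : Formula) : Formula :=
  ex x ((lt (Term.var x) t).and φ)

/-- A Gödel numbering of formulas. -/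
def code : Formula → ℕ
  | falsum => Nat.pair 0 0
  | eq t u => Nat.pair 1 (Nat.pair t.code u.code)
  | le t u => Nat.pair 2 (Nat.pair t.code u.code)
  | and φ ψ => Nat.pair 3 (Nat.pair (code φ) (code ψ))
  | or φ ψ => Nat.pair 4 (Nat.pair (code φ) (code ψ))
  | imp φ ψ => Nat.pair 5 (Nat.pair (code φ) (code ψ))
  | neg φ => Nat.pair 6 (code φ)
  | all x φ => Nat.pair 7 (Nat.pair x (code φ))
  | ex x φ => Nat.pair 8 (Nat.pair x (code φ))
  | box φ => Nat.pair 9 (code φ)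

end Formula

/-- A sentence is a formula with no free variables. -/
def Sentence (φ : Formula) : Prop := φ.fv = ∅

/-- Truth in the standard model ℕ (for sentences; any fixed valuation will do). -/
def StdTrue (φ : Formula) : Prop := φ.val fun _ => 0

/-- The logical axioms of classical first-order logic with equality for L_□,
with the identity axioms only for atomic formulas. -/
inductive LogicalAxiom : Formula → Prop
  | imp1 (φ ψ : Formula) : LogicalAxiom (φ.imp (ψ.imp φ))
  | imp2 (φ ψ χ : Formula) :
      LogicalAxiom ((φ.imp (ψ.imp χ)).imp ((φ.imp ψ).imp (φ.imp χ)))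
  | dne (φ : Formula) : LogicalAxiom (φ.neg.neg.imp φ)
  | negI (φ ψ : Formula) : LogicalAxiom ((φ.imp ψ).imp ((φ.imp ψ.neg).imp φ.neg))
  | negE (φ ψ : Formula) : LogicalAxiom (φ.neg.imp (φ.imp ψ))
  | falsumE (φ : Formula) : LogicalAxiom (Formula.falsum.imp φ)
  | negIntro (φ : Formula) : LogicalAxiom ((φ.imp Formula.falsum).imp φ.neg)
  | negElimFalsum (φ : Formula) : LogicalAxiom (φ.neg.imp (φ.imp Formula.falsum))
  | andI (φ ψ : Formula) : LogicalAxiom (φ.imp (ψ.imp (φ.and ψ)))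
  | andE1 (φ ψ : Formula) : LogicalAxiom ((φ.and ψ).imp φ)
  | andE2 (φ ψ : Formula) : LogicalAxiom ((φ.and ψ).imp ψ)
  | orI1 (φ ψ : Formula) : LogicalAxiom (φ.imp (φ.or ψ))
  | orI2 (φ ψ : Formula) : LogicalAxiom (ψ.imp (φ.or ψ))
  | orE (φ ψ χ : Formula) :
      LogicalAxiom ((φ.imp χ).imp ((ψ.imp χ).imp ((φ.or ψ).imp χ)))
  | allE (x : ℕ) (t : Term) (φ : Formula) :
      φ.freeFor t x → LogicalAxiom ((Formula.all x φ).imp (φ.subst x t))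
  | allImp (x : ℕ) (φ ψ : Formula) :
      x ∉ φ.fv → LogicalAxiom ((Formula.all x (φ.imp ψ)).imp (φ.imp (Formula.all x ψ)))
  | exI (x : ℕ) (t : Term) (φ : Formula) :
      φ.freeFor t x → LogicalAxiom ((φ.subst x t).imp (Formula.ex x φ))
  | exE (x : ℕ) (φ ψ : Formula) :
      x ∉ ψ.fv → LogicalAxiom ((Formula.all x (φ.imp ψ)).imp ((Formula.ex x φ).imp ψ))
  | eqRefl (t : Term) : LogicalAxiom (Formula.eq t t)
  | eqSymm (t u : Term) : LogicalAxiom ((Formula.eq t u).imp (Formula.eq u t))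
  | eqTrans (t u w : Term) :
      LogicalAxiom ((Formula.eq t u).imp ((Formula.eq u w).imp (Formula.eq t w)))
  | eqSucc (t u : Term) :
      LogicalAxiom ((Formula.eq t u).imp (Formula.eq t.succ u.succ))
  | eqAdd (t₁ t₂ u₁ u₂ : Term) :
      LogicalAxiom ((Formula.eq t₁ t₂).imp ((Formula.eq u₁ u₂).imp
        (Formula.eq (t₁.add u₁) (t₂.add u₂))))
  | eqMul (t₁ t₂ u₁ u₂ : Term) :
      LogicalAxiom ((Formula.eq t₁ t₂).imp ((Formula.eq u₁ u₂).imp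
        (Formula.eq (t₁.mul u₁) (t₂.mul u₂))))
  | eqLe (t₁ t₂ u₁ u₂ : Term) :
      LogicalAxiom ((Formula.eq t₁ t₂).imp ((Formula.eq u₁ u₂).imp
        ((Formula.le t₁ u₁).imp (Formula.le t₂ u₂))))

/-- Provability in an L_□-theory: logical axioms, the axioms of the theory, and the
rules modus ponens, generalization, and necessitation. -/
inductive Provable (T : Set Formula) : Formula → Prop
  | ax {φ : Formula} : φ ∈ T → Provable T φ
  | logic {φ : Formula} : LogicalAxiom φ → Provable T φ
  | mp {φ ψ : Formula} : Provable T (φ.imp ψ) → Provable T φ → Provable T ψ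
  | gen {φ : Formula} (x : ℕ) : Provable T φ → Provable T (Formula.all x φ)
  | nec {φ : Formula} : Provable T φ → Provable T (Formula.box φ)

/-- First-order provability (no necessitation rule); used for the non-modal theory PA. -/
inductive FOProvable (T : Set Formula) : Formula → Prop
  | ax {φ : Formula} : φ ∈ T → FOProvable T φ
  | logic {φ : Formula} : LogicalAxiom φ → FOProvable T φ
  | mp {φ ψ : Formula} : FOProvable T (φ.imp ψ) → FOProvable T φ → FOProvable T ψ
  | gen {φ : Formula} (x : ℕ) : FOProvable T φ → FOProvable T (Formula.all x φ)

/-- Basic (Robinson-style) axioms of arithmetic. -/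
def succNeZero : Formula := (Formula.eq (Term.succ (Term.var 0)) Term.zero).neg
def succInj : Formula :=
  (Formula.eq (Term.succ (Term.var 0)) (Term.succ (Term.var 1))).imp
    (Formula.eq (Term.var 0) (Term.var 1))
def addZero : Formula := Formula.eq (Term.add (Term.var 0) Term.zero) (Term.var 0)
def addSucc : Formula :=
  Formula.eq (Term.add (Term.var 0) (Term.succ (Term.var 1)))
    (Term.succ (Term.add (Term.var 0) (Term.var 1)))
def mulZero : Formula := Formula.eq (Term.mul (Term.var 0) Term.zero) Term.zero
def mulSucc : Formula :=
  Formula.eq (Term.mul (Term.var 0) (Term.succ (Term.var 1)))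
    (Term.add (Term.mul (Term.var 0) (Term.var 1)) (Term.var 0))
def leDef : Formula :=
  (Formula.le (Term.var 0) (Term.var 1)).iff
    (Formula.ex 2 (Formula.eq (Term.add (Term.var 0) (Term.var 2)) (Term.var 1)))

def baseAxioms : Set Formula :=
  {succNeZero, succInj, addZero, addSucc, mulZero, mulSucc, leDef}

/-- The induction axiom for the formula `φ` and the variable `x`. -/
def inductionAx (x : ℕ) (φ : Formula) : Formula :=
  ((φ.subst x Term.zero).and
    (Formula.all x (φ.imp (φ.subst x (Term.succ (Term.var x)))))).imp
      (Formula.all x φ)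

/-- Peano arithmetic PA: basic axioms plus induction for L_A-formulas. -/
def PA : Set Formula :=
  baseAxioms ∪ {χ | ∃ (x : ℕ) (φ : Formula), φ.noBox ∧ χ = inductionAx x φ}

/-- PA_□ : basic axioms plus induction for all L_□-formulas. -/
def PABox : Set Formula :=
  baseAxioms ∪ {χ | ∃ (x : ℕ) (φ : Formula), χ = inductionAx x φ}

/-- The distribution axiom K. -/
def axK (φ ψ : Formula) : Formula :=
  (Formula.box (φ.imp ψ)).imp ((Formula.box φ).imp (Formula.box ψ))

/-- PA(K). -/
def PAK : Set Formula := PABox ∪ {χ | ∃ φ ψ : Formula, χ = axK φ ψ}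

/-- The axiom 4. -/
def ax4 (φ : Formula) : Formula := (Formula.box φ).imp (Formula.box (Formula.box φ))

/-- PA(K4). -/
def PAK4 : Set Formula := PAK ∪ {χ | ∃ φ : Formula, χ = ax4 φ}

/-- The axiom of Triv. -/
def axTriv (φ : Formula) : Formula := (Formula.box φ).iff φ

/-- PA(Triv). -/
def PATriv : Set Formula := PAK ∪ {χ | ∃ φ : Formula, χ = axTriv φ}

/-- PA(Ver). -/
def PAVer : Set Formula := PAK ∪ {Formula.box Formula.falsum}

/-- `T` extends `U`: every axiom of `U` is provable in `T`. -/
def Extends (T U : Set Formula) : Prop := ∀ φ ∈ U, Provable T φ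

/-- Consistency. -/
def Consistent (T : Set Formula) : Prop := ¬ Provable T Formula.falsum

/-- The class Δ₀ of bounded L_A-formulas. -/
inductive IsDelta0 : Formula → Prop
  | falsum : IsDelta0 Formula.falsum
  | eq (t u : Term) : IsDelta0 (Formula.eq t u)
  | le (t u : Term) : IsDelta0 (Formula.le t u)
  | and {φ ψ : Formula} : IsDelta0 φ → IsDelta0 ψ → IsDelta0 (φ.and ψ)
  | or {φ ψ : Formula} : IsDelta0 φ → IsDelta0 ψ → IsDelta0 (φ.or ψ)
  | imp {φ ψ : Formula} : IsDelta0 φ → IsDelta0 ψ → IsDelta0 (φ.imp ψ)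
  | neg {φ : Formula} : IsDelta0 φ → IsDelta0 φ.neg
  | ball {x : ℕ} {t : Term} {φ : Formula} :
      x ∉ t.fv → IsDelta0 φ → IsDelta0 (Formula.ball x t φ)
  | bex {x : ℕ} {t : Term} {φ : Formula} :
      x ∉ t.fv → IsDelta0 φ → IsDelta0 (Formula.bex x t φ)

/-- The class Σ₁ of L_A-formulas. -/
inductive IsSigma1 : Formula → Prop
  | delta0 {φ : Formula} : IsDelta0 φ → IsSigma1 φ
  | and {φ ψ : Formula} : IsSigma1 φ → IsSigma1 ψ → IsSigma1 (φ.and ψ)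
  | or {φ ψ : Formula} : IsSigma1 φ → IsSigma1 ψ → IsSigma1 (φ.or ψ)
  | ex {x : ℕ} {φ : Formula} : IsSigma1 φ → IsSigma1 (Formula.ex x φ)
  | ball {x : ℕ} {t : Term} {φ : Formula} :
      x ∉ t.fv → IsSigma1 φ → IsSigma1 (Formula.ball x t φ)

/-- The class B of boxed formulas. -/
def IsB (φ : Formula) : Prop := ∃ ψ : Formula, φ = Formula.box ψ

/-- The class ΔB. -/
inductive IsDeltaB : Formula → Prop
  | delta0 {φ : Formula} : IsDelta0 φ → IsDeltaB φ
  | b (ψ : Formula) : IsDeltaB (Formula.box ψ)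
  | and {φ ψ : Formula} : IsDeltaB φ → IsDeltaB ψ → IsDeltaB (φ.and ψ)
  | or {φ ψ : Formula} : IsDeltaB φ → IsDeltaB ψ → IsDeltaB (φ.or ψ)
  | ball {x : ℕ} {t : Term} {φ : Formula} :
      x ∉ t.fv → IsDeltaB φ → IsDeltaB (Formula.ball x t φ)
  | bex {x : ℕ} {t : Term} {φ : Formula} :
      x ∉ t.fv → IsDeltaB φ → IsDeltaB (Formula.bex x t φ)

/-- The class ΣB. -/
inductive IsSigmaB : Formula → Prop
  | sigma1 {φ : Formula} : IsSigma1 φ → IsSigmaB φ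
  | b (ψ : Formula) : IsSigmaB (Formula.box ψ)
  | and {φ ψ : Formula} : IsSigmaB φ → IsSigmaB ψ → IsSigmaB (φ.and ψ)
  | or {φ ψ : Formula} : IsSigmaB φ → IsSigmaB ψ → IsSigmaB (φ.or ψ)
  | ex {x : ℕ} {φ : Formula} : IsSigmaB φ → IsSigmaB (Formula.ex x φ)
  | ball {x : ℕ} {t : Term} {φ : Formula} :
      x ∉ t.fv → IsSigmaB φ → IsSigmaB (Formula.ball x t φ)

/-- Iterated disjunction (the empty disjunction is ⊥). -/
def disj : List Formula → Formula
  | [] => Formula.falsum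
  | [φ] => φ
  | φ :: ψ :: l => φ.or (disj (ψ :: l))

/-- Iterated conjunction (the empty conjunction is ⊤). -/
def conj : List Formula → Formula
  | [] => Formula.falsum.neg
  | [φ] => φ
  | φ :: ψ :: l => φ.and (conj (ψ :: l))

/-- Γ-disjunction property. -/
def HasDP (T : Set Formula) (Γ : Formula → Prop) : Prop :=
  ∀ φ ψ : Formula, Γ φ → Γ ψ → Sentence φ → Sentence ψ →
    Provable T (φ.or ψ) → Provable T φ ∨ Provable T ψ

/-- (Γ, Θ)-disjunction property. -/
def HasDP2 (T : Set Formula) (Γ Θ : Formula → Prop) : Prop :=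
  ∀ φ ψ : Formula, Γ φ → Θ ψ → Sentence φ → Sentence ψ →
    Provable T (φ.or ψ) → Provable T φ ∨ Provable T ψ

/-- Γ-existence property. -/
def HasEP (T : Set Formula) (Γ : Formula → Prop) : Prop :=
  ∀ (x : ℕ) (φ : Formula), Γ φ → φ.fv ⊆ {x} →
    Provable T (Formula.ex x φ) → ∃ n : ℕ, Provable T (φ.subst x (Term.numeral n))

/-- Modal disjunction property. -/
def HasMDP (T : Set Formula) : Prop :=
  ∀ φ ψ : Formula, Sentence φ → Sentence ψ →
    Provable T ((Formula.box φ).or (Formula.box ψ)) → Provable T φ ∨ Provable T ψ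

/-- Modal existence property. -/
def HasMEP (T : Set Formula) : Prop :=
  ∀ (x : ℕ) (φ : Formula), φ.fv ⊆ {x} →
    Provable T (Formula.ex x (Formula.box φ)) →
      ∃ n : ℕ, Provable T (φ.subst x (Term.numeral n))

/-- n-fold B-disjunction property. -/
def HasBnDP (T : Set Formula) (n : ℕ) : Prop :=
  ∀ φ : Fin n → Formula, (∀ i, Sentence (φ i)) →
    Provable T (disj (List.ofFn fun i => Formula.box (φ i))) →
    ∃ i, Provable T (Formula.box (φ i))

/-- Σ₁-soundness. -/
def Sigma1Sound (T : Set Formula) : Prop :=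
  ∀ φ : Formula, IsSigma1 φ → Sentence φ → Provable T φ → StdTrue φ

/-- L_A-soundness. -/
def LASound (T : Set Formula) : Prop :=
  ∀ φ : Formula, φ.noBox → Sentence φ → Provable T φ → StdTrue φ

/-- `T` is recursively enumerable (via the Gödel numbering of formulas). -/
def RE (T : Set Formula) : Prop :=
  Nat.Partrec fun n => Part.assert (∃ φ ∈ T, Formula.code φ = n) fun _ => Part.some 0

/-- A fixed natural Σ₁ provability predicate `Pr_T(x)` for the theory `T`:
a Σ₁ L_A-formula with only the free variable `0` which numerates provability in `T`
in the standard model and satisfies the standard derivability conditions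
(provably in PA). -/
structure ProvPred (T : Set Formula) where
  pr : Formula
  noBox : pr.noBox
  sigma1 : IsSigma1 pr
  fvSub : pr.fv ⊆ {0}
  numerates : ∀ φ : Formula,
    StdTrue (pr.subst 0 (Term.numeral φ.code)) ↔ Provable T φ
  d1 : ∀ φ : Formula, Provable T φ → FOProvable PA (pr.subst 0 (Term.numeral φ.code))
  d2 : ∀ φ ψ : Formula,
    FOProvable PA ((pr.subst 0 (Term.numeral (φ.imp ψ).code)).imp
      ((pr.subst 0 (Term.numeral φ.code)).imp (pr.subst 0 (Term.numeral ψ.code))))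
  necClosed : ∀ φ : Formula,
    FOProvable PA ((pr.subst 0 (Term.numeral φ.code)).imp
      (pr.subst 0 (Term.numeral (Formula.box φ).code)))

/-- `Pr_T(⌜φ⌝)`. -/
def ProvPred.app {T : Set Formula} (P : ProvPred T) (φ : Formula) : Formula :=
  P.pr.subst 0 (Term.numeral φ.code)

/-- Γ-disjunctive correctness (Γ-DC). -/
def DC (T : Set Formula) (P : ProvPred T) (Γ : Formula → Prop) : Prop :=
  ∀ φ : Formula, Γ φ → Sentence φ → Provable T (φ.or (P.app φ)) → Provable T φ

/-- The substitution replacing each variable by the numeral of its value. -/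
def numeralSubst (v : ℕ → ℕ) : ℕ → Term := fun x => Term.numeral (v x)

/-- Standard-model satisfaction of the ρ_T-translation: `ρ_T` is the identity on
L_A-formulas, commutes with connectives and quantifiers, and sends `□φ(x⃗)` to
`Pr_T(⌜□φ(ẋ⃗)⌝)`, whose truth in ℕ (for a natural provability predicate) amounts to
provability in `T` of `□φ(n̄⃗)`. -/
def RhoSat (T : Set Formula) : Formula → (ℕ → ℕ) → Prop
  | .falsum, _ => False
  | .eq t u, v => t.val v = u.val v
  | .le t u, v => t.val v ≤ u.val v
  | .and φ ψ, v => RhoSat T φ v ∧ RhoSat T ψ v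
  | .or φ ψ, v => RhoSat T φ v ∨ RhoSat T ψ v
  | .imp φ ψ, v => RhoSat T φ v → RhoSat T ψ v
  | .neg φ, v => ¬ RhoSat T φ v
  | .all x φ, v => ∀ n : ℕ, RhoSat T φ (Function.update v x n)
  | .ex x φ, v => ∃ n : ℕ, RhoSat T φ (Function.update v x n)
  | .box φ, v => Provable T (Formula.box (φ.substAll (numeralSubst v)))

/-- Standard-model satisfaction of the π_T-translation: `π_T` is the identity on
L_A-formulas, commutes with connectives and quantifiers, and sends `□φ(x⃗)` to
`Pr_T(⌜φ(ẋ⃗)⌝)`, whose truth in ℕ (for a natural provability predicate) amounts to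
provability in `T` of `φ(n̄⃗)`. -/
def PiSat (T : Set Formula) : Formula → (ℕ → ℕ) → Prop
  | .falsum, _ => False
  | .eq t u, v => t.val v = u.val v
  | .le t u, v => t.val v ≤ u.val v
  | .and φ ψ, v => PiSat T φ v ∧ PiSat T ψ v
  | .or φ ψ, v => PiSat T φ v ∨ PiSat T ψ v
  | .imp φ ψ, v => PiSat T φ v → PiSat T ψ v
  | .neg φ, v => ¬ PiSat T φ v
  | .all x φ, v => ∀ n : ℕ, PiSat T φ (Function.update v x n)
  | .ex x φ, v => ∃ n : ℕ, PiSat T φ (Function.update v x n)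
  | .box φ, v => Provable T (φ.substAll (numeralSubst v))

/-- Weak ΣB-soundness: every provable ΣB sentence is true in ℕ under ρ_T. -/
def WeaklySigmaBSound (T : Set Formula) : Prop :=
  ∀ φ : Formula, IsSigmaB φ → Sentence φ → Provable T φ → RhoSat T φ fun _ => 0

/-- ΣB-soundness: every provable ΣB sentence is true in ℕ under π_T. -/
def SigmaBSound (T : Set Formula) : Prop :=
  ∀ φ : Formula, IsSigmaB φ → Sentence φ → Provable T φ → PiSat T φ fun _ => 0

end ModalArith

namespace ModalArith

open Formula

/-- Propositional and equality axioms. -/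
inductive PropAx : Formula → Prop
  | imp1 (φ ψ : Formula) : PropAx (φ.imp (ψ.imp φ))
  | imp2 (φ ψ χ : Formula) :
      PropAx ((φ.imp (ψ.imp χ)).imp ((φ.imp ψ).imp (φ.imp χ)))
  | dne (φ : Formula) : PropAx (φ.neg.neg.imp φ)
  | negI (φ ψ : Formula) : PropAx ((φ.imp ψ).imp ((φ.imp ψ.neg).imp φ.neg))
  | negE (φ ψ : Formula) : PropAx (φ.neg.imp (φ.imp ψ))
  | falsumE (φ : Formula) : PropAx (Formula.falsum.imp φ)
  | andI (φ ψ : Formula) : PropAx (φ.imp (ψ.imp (φ.and ψ)))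
  | andE1 (φ ψ : Formula) : PropAx ((φ.and ψ).imp φ)
  | andE2 (φ ψ : Formula) : PropAx ((φ.and ψ).imp ψ)
  | orI1 (φ ψ : Formula) : PropAx (φ.imp (φ.or ψ))
  | orI2 (φ ψ : Formula) : PropAx (ψ.imp (φ.or ψ))
  | orE (φ ψ χ : Formula) :
      PropAx ((φ.imp χ).imp ((ψ.imp χ).imp ((φ.or ψ).imp χ)))

structure PL (P : Formula → Prop) : Prop where
  prop : ∀ φ, PropAx φ → P φ
  mp : ∀ φ ψ, P (φ.imp ψ) → P φ → P ψ

/-- Propositional valuations making all of `P` true. -/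
structure PV (P : Formula → Prop) (w : Formula → Prop) : Prop where
  th : ∀ φ, P φ → w φ
  falsum : w falsum ↔ False
  neg : ∀ φ, w φ.neg ↔ ¬ w φ
  imp : ∀ φ ψ, w (φ.imp ψ) ↔ (w φ → w ψ)
  and : ∀ φ ψ, w (φ.and ψ) ↔ (w φ ∧ w ψ)
  or : ∀ φ ψ, w (φ.or ψ) ↔ (w φ ∨ w ψ)

theorem PV.iff {P w : Formula → Prop} (h : PV P w) (φ ψ : Formula) : w (φ.iff ψ) ↔ (w φ ↔ w ψ) := by
  unfold Formula.iff
  rw [h.and, h.imp, h.imp]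
  tauto

namespace PL
variable {P : Formula → Prop}

theorem i1 (h : PL P) {φ : Formula} (ψ : Formula) (a : P φ) : P (ψ.imp φ) := h.mp _ _ (h.prop _ (.imp1 _ _)) a

theorem i2 (h : PL P) {φ ψ χ : Formula} (a : P (φ.imp (ψ.imp χ))) (b : P (φ.imp ψ)) : P (φ.imp χ) :=
  h.mp _ _ (h.mp _ _ (h.prop _ (.imp2 _ _ _)) a) b

theorem refl (h : PL P) (φ : Formula) : P (φ.imp φ) :=
  h.i2 (h.prop _ (.imp1 φ (φ.imp φ))) (h.prop _ (.imp1 φ φ))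

theorem trans (h : PL P) {φ ψ χ : Formula} (a : P (φ.imp ψ)) (b : P (ψ.imp χ)) : P (φ.imp χ) :=
  h.i2 (h.i1 _ b) a

theorem contra (h : PL P) {φ ψ : Formula} (a : P (φ.imp ψ)) : P (ψ.neg.imp φ.neg) :=
  h.trans (h.prop _ (.imp1 ψ.neg φ)) (h.mp _ _ (h.prop _ (.negI φ ψ)) a)

theorem cases (h : PL P) {φ χ : Formula} (a : P (φ.imp χ)) (b : P (φ.neg.imp χ)) : P χ := by
  have := h.mp _ _ (h.mp _ _ (h.prop _ (.negI χ.neg φ.neg)) (h.contra a)) (h.contra b)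
  exact h.mp _ _ (h.prop _ (.dne _)) this

theorem ext (h : PL P) (φ : Formula) : PL (fun ψ => P (φ.imp ψ)) where
  prop _ hψ := h.i1 _ (h.prop _ hψ)
  mp _ _ a b := h.i2 a b

theorem exists_max (h : PL P) {χ : Formula} (hχ : ¬ P χ) :
    ∃ Q : Formula → Prop, PL Q ∧ (∀ φ, P φ → Q φ) ∧ ¬ Q χ ∧ ∀ φ, ¬ Q φ → Q (φ.imp χ) := by
  let S : Set (Set Formula) := {Q | PL (· ∈ Q) ∧ (∀ φ, P φ → φ ∈ Q) ∧ χ ∉ Q}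
  have hz : ∃ m, Maximal (· ∈ S) m := by
    obtain ⟨m, -, hm⟩ := zorn_subset_nonempty S (fun c hc hchain hne => by
      refine ⟨⋃₀ c, ⟨⟨?_, ?_⟩, ?_, ?_⟩, fun s hs => Set.subset_sUnion_of_mem hs⟩
      · intro φ hφ
        obtain ⟨s, hs⟩ := hne
        exact ⟨s, hs, (hc hs).1.prop _ hφ⟩
      · rintro φ ψ ⟨s, hs, h1⟩ ⟨t, ht, h2⟩
        rcases hchain.total hs ht with h3 | h3
        · exact ⟨t, ht, (hc ht).1.mp _ _ (h3 h1) h2⟩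
        · exact ⟨s, hs, (hc hs).1.mp _ _ h1 (h3 h2)⟩
      · intro φ hφ
        obtain ⟨s, hs⟩ := hne
        exact ⟨s, hs, (hc hs).2.1 _ hφ⟩
      · rintro ⟨s, hs, h1⟩
        exact (hc hs).2.2 h1) {φ | P φ} ⟨⟨h.prop, h.mp⟩, fun _ a => a, hχ⟩
    exact ⟨m, hm⟩
  obtain ⟨m, ⟨hm1, hm2, hm3⟩, hmax⟩ := hz
  refine ⟨(· ∈ m), hm1, hm2, hm3, fun φ hφ => ?_⟩
  by_contra hc
  have hm' : {ψ | φ.imp ψ ∈ m} ∈ S :=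
    ⟨hm1.ext φ, fun ψ hψ => hm1.i1 _ (hm2 _ hψ), hc⟩
  have := hmax hm' (fun ψ hψ => hm1.i1 _ hψ)
  exact hφ (this (hm1.refl φ))

theorem exists_pv (h : PL P) {χ : Formula} (hχ : ¬ P χ) : ∃ w, PV P w ∧ ¬ w χ := by
  obtain ⟨Q, hQ, hPQ, hn, hm⟩ := h.exists_max hχ
  have hneg : ∀ φ, Q φ.neg ↔ ¬ Q φ := by
    intro φ
    constructor
    · intro a b
      exact hn (hQ.mp _ _ (hQ.mp _ _ (hQ.prop _ (.negE φ χ)) a) b)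
    · intro a
      by_contra b
      exact hn (hQ.cases (hm _ a) (hm _ b))
  refine ⟨Q, ⟨hPQ, ?_, hneg, ?_, ?_, ?_⟩, hn⟩
  · exact ⟨fun a => hn (hQ.mp _ _ (hQ.prop _ (.falsumE χ)) a), False.elim⟩
  · intro φ ψ
    refine ⟨hQ.mp _ _, fun a => ?_⟩
    by_cases b : Q φ
    · exact hQ.i1 _ (a b)
    · exact hQ.mp _ _ (hQ.prop _ (.negE _ _)) ((hneg _).2 b)
  · intro φ ψ
    refine ⟨fun a => ⟨hQ.mp _ _ (hQ.prop _ (.andE1 _ _)) a, hQ.mp _ _ (hQ.prop _ (.andE2 _ _)) a⟩,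
      fun a => hQ.mp _ _ (hQ.mp _ _ (hQ.prop _ (.andI _ _)) a.1) a.2⟩
  · intro φ ψ
    constructor
    · intro a
      by_contra b
      push Not at b
      exact hn (hQ.mp _ _ (hQ.mp _ _ (hQ.mp _ _ (hQ.prop _ (.orE _ _ χ)) (hm _ b.1)) (hm _ b.2)) a)
    · rintro (a | a)
      · exact hQ.mp _ _ (hQ.prop _ (.orI1 _ _)) a
      · exact hQ.mp _ _ (hQ.prop _ (.orI2 _ _)) a

theorem taut (h : PL P) {χ : Formula} (H : ∀ w, PV P w → w χ) : P χ := by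
  by_contra hχ
  obtain ⟨w, hw, hn⟩ := h.exists_pv hχ
  exact hn (H w hw)

end PL

/-! ## Instances -/

theorem Term.substAll_congr {t : Term} {σ τ : ℕ → Term} (h : ∀ z ∈ t.fv, σ z = τ z) :
    t.substAll σ = t.substAll τ := by
  induction t <;> simp_all [Term.substAll, Term.fv]

theorem Term.substAll_var (t : Term) : t.substAll Term.var = t := by
  induction t <;> simp_all [Term.substAll]

theorem Term.substAll_id {t : Term} {σ : ℕ → Term} (h : ∀ z ∈ t.fv, σ z = Term.var z) :
    t.substAll σ = t := by
  rw [Term.substAll_congr h, Term.substAll_var]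

theorem Term.substAll_substAll (t : Term) (σ τ : ℕ → Term) :
    (t.substAll σ).substAll τ = t.substAll (fun z => (σ z).substAll τ) := by
  induction t <;> simp_all [Term.substAll]

theorem Term.mem_fv_substAll {t : Term} {σ : ℕ → Term} {x : ℕ} :
    x ∈ (t.substAll σ).fv ↔ ∃ z ∈ t.fv, x ∈ (σ z).fv := by
  induction t <;> simp_all [Term.substAll, Term.fv, or_and_right, exists_or]

namespace Formula

/-- Substitution instance with bound variables renamed by `b`. -/
def inst (b : ℕ → ℕ) : Formula → (ℕ → Term) → Formula
  | falsum, _ => falsum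
  | eq t u, v => eq (t.substAll v) (u.substAll v)
  | le t u, v => le (t.substAll v) (u.substAll v)
  | and φ ψ, v => and (inst b φ v) (inst b ψ v)
  | or φ ψ, v => or (inst b φ v) (inst b ψ v)
  | imp φ ψ, v => imp (inst b φ v) (inst b ψ v)
  | neg φ, v => neg (inst b φ v)
  | all x φ, v => all (b x) (inst b φ (Function.update v x (Term.var (b x))))
  | ex x φ, v => ex (b x) (inst b φ (Function.update v x (Term.var (b x))))
  | box φ, v => box (inst b φ v)

/-- The instance does not capture variables. -/
def ok (b : ℕ → ℕ) : Formula → (ℕ → Term) → Prop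
  | falsum, _ => True
  | eq _ _, _ => True
  | le _ _, _ => True
  | and φ ψ, v => ok b φ v ∧ ok b ψ v
  | or φ ψ, v => ok b φ v ∧ ok b ψ v
  | imp φ ψ, v => ok b φ v ∧ ok b ψ v
  | neg φ, v => ok b φ v
  | all x φ, v => (∀ z ∈ φ.fv, z ≠ x → b x ∉ (v z).fv) ∧ ok b φ (Function.update v x (Term.var (b x)))
  | ex x φ, v => (∀ z ∈ φ.fv, z ≠ x → b x ∉ (v z).fv) ∧ ok b φ (Function.update v x (Term.var (b x)))
  | box φ, v => ok b φ v

/-- All variables, free or bound. -/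
def vars : Formula → Finset ℕ
  | falsum => ∅
  | eq t u => t.fv ∪ u.fv
  | le t u => t.fv ∪ u.fv
  | and φ ψ => vars φ ∪ vars ψ
  | or φ ψ => vars φ ∪ vars ψ
  | imp φ ψ => vars φ ∪ vars ψ
  | neg φ => vars φ
  | all x φ => insert x (vars φ)
  | ex x φ => insert x (vars φ)
  | box φ => vars φ

theorem fv_subset_vars (φ : Formula) : φ.fv ⊆ φ.vars := by
  induction φ with
  | falsum | eq | le => simp [fv, vars]
  | and _ _ h1 h2 | or _ _ h1 h2 | imp _ _ h1 h2 => exact Finset.union_subset_union h1 h2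
  | neg _ h | box _ h => exact h
  | all x φ h | ex x φ h =>
    intro y hy
    simp only [fv, Finset.mem_erase] at hy
    exact Finset.mem_insert_of_mem (h hy.2)

theorem inst_id (φ : Formula) (σ : ℕ → Term) : φ.inst id σ = φ.substAll σ := by
  induction φ generalizing σ <;> simp_all [inst, substAll]

theorem inst_congr {b : ℕ → ℕ} {φ : Formula} {σ τ : ℕ → Term} (h : ∀ z ∈ φ.fv, σ z = τ z) :
    φ.inst b σ = φ.inst b τ := by
  induction φ generalizing σ τ with
  | falsum => rfl
  | eq t u | le t u =>
    simp only [fv, Finset.mem_union] at h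
    simp only [inst]
    rw [Term.substAll_congr (fun z hz => h z (Or.inl hz)),
      Term.substAll_congr (fun z hz => h z (Or.inr hz))]
  | and φ ψ h1 h2 | or φ ψ h1 h2 | imp φ ψ h1 h2 =>
    simp only [fv, Finset.mem_union] at h
    simp only [inst]
    rw [h1 (fun z hz => h z (Or.inl hz)), h2 (fun z hz => h z (Or.inr hz))]
  | neg φ h1 | box φ h1 =>
    simp only [fv] at h
    simp only [inst]
    rw [h1 h]
  | all x φ h1 | ex x φ h1 =>
    simp only [fv, Finset.mem_erase] at h
    simp only [inst]
    rw [h1 (τ := Function.update τ x (Term.var (b x)))]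
    intro z hz
    by_cases e : z = x
    · subst e; simp
    · simp [e, h z ⟨e, hz⟩]

theorem ok_congr {b : ℕ → ℕ} {φ : Formula} {σ τ : ℕ → Term} (h : ∀ z ∈ φ.fv, σ z = τ z)
    (hk : φ.ok b σ) : φ.ok b τ := by
  induction φ generalizing σ τ with
  | falsum | eq t u | le t u => trivial
  | and φ ψ h1 h2 | or φ ψ h1 h2 | imp φ ψ h1 h2 =>
    simp only [fv, Finset.mem_union] at h
    exact ⟨h1 (fun z hz => h z (Or.inl hz)) hk.1, h2 (fun z hz => h z (Or.inr hz)) hk.2⟩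
  | neg φ h1 | box φ h1 => exact h1 h hk
  | all x φ h1 | ex x φ h1 =>
    simp only [fv, Finset.mem_erase] at h
    refine ⟨fun z hz hx => ?_, h1 ?_ hk.2⟩
    · rw [← h z ⟨hx, hz⟩]; exact hk.1 z hz hx
    · intro z hz
      by_cases e : z = x
      · subst e; simp
      · simp [e, h z ⟨e, hz⟩]

theorem fv_inst {b : ℕ → ℕ} {φ : Formula} {σ : ℕ → Term} {x : ℕ} (h : x ∈ (φ.inst b σ).fv) :
    ∃ z ∈ φ.fv, x ∈ (σ z).fv := by
  induction φ generalizing σ with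
  | falsum => simp [inst, fv] at h
  | eq t u | le t u =>
    simp only [inst, fv, Finset.mem_union, Term.mem_fv_substAll] at h ⊢
    rcases h with ⟨z, hz, h⟩ | ⟨z, hz, h⟩
    · exact ⟨z, Or.inl hz, h⟩
    · exact ⟨z, Or.inr hz, h⟩
  | and φ ψ h1 h2 | or φ ψ h1 h2 | imp φ ψ h1 h2 =>
    simp only [inst, fv, Finset.mem_union] at h ⊢
    rcases h with h | h
    · obtain ⟨z, hz, h⟩ := h1 h
      exact ⟨z, Or.inl hz, h⟩
    · obtain ⟨z, hz, h⟩ := h2 h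
      exact ⟨z, Or.inr hz, h⟩
  | neg φ h1 | box φ h1 => exact h1 h
  | all y φ h1 | ex y φ h1 =>
    simp only [inst, fv, Finset.mem_erase] at h ⊢
    obtain ⟨z, hz, h'⟩ := h1 h.2
    by_cases e : z = y
    · subst e
      simp [Term.fv] at h'
      exact absurd h' h.1
    · simp [e] at h'
      exact ⟨z, ⟨e, hz⟩, h'⟩

theorem ok_id_var (φ : Formula) : φ.ok id Term.var := by
  induction φ with
  | falsum | eq t u | le t u => trivial
  | and φ ψ h1 h2 | or φ ψ h1 h2 | imp φ ψ h1 h2 => exact ⟨h1, h2⟩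
  | neg φ h1 | box φ h1 => exact h1
  | all x φ h1 | ex x φ h1 =>
    refine ⟨fun z _ hx => by simpa [Term.fv] using Ne.symm hx, ?_⟩
    simpa using h1

theorem substAll_var (φ : Formula) : φ.substAll Term.var = φ := by
  induction φ <;> simp_all [substAll, Term.substAll_var]

theorem ok_of_freeFor {t : Term} {x : ℕ} {φ : Formula} (h : φ.freeFor t x) :
    φ.ok id (Function.update Term.var x t) := by
  induction φ with
  | falsum | eq | le => trivial
  | and φ ψ h1 h2 | or φ ψ h1 h2 | imp φ ψ h1 h2 => exact ⟨h1 h.1, h2 h.2⟩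
  | neg φ h1 | box φ h1 => exact h1 h
  | all y φ h1 | ex y φ h1 =>
    by_cases hx : x = y
    · subst hx
      refine ⟨fun z _ hz => ?_, ?_⟩
      · simp [hz, Term.fv, Ne.symm hz]
      · simpa using ok_id_var φ
    by_cases hf : x ∈ φ.fv
    · obtain ⟨h2, h3⟩ : y ∉ t.fv ∧ φ.freeFor t x := by
        rcases h with h | h | h
        · exact absurd h hx
        · exact absurd hf h
        · exact h
      refine ⟨fun z _ hz => ?_, ok_congr (fun z _ => ?_) (h1 h3)⟩
      · by_cases e : z = x
        · subst e; simpa using h2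
        · simp [e, Term.fv, Ne.symm hz]
      · by_cases e : z = y
        · subst e; simp [Ne.symm hx]
        · simp [e]
    · refine ok_congr (σ := Term.var) (fun z hz => ?_) (ok_id_var (all y φ))
      have : z ≠ x := by
        rintro rfl
        simp [fv] at hz
        exact hf hz.2
      simp [this]

theorem freeFor_self (x : ℕ) (φ : Formula) {s : Term} (hs : s.fv ⊆ {x}) : φ.freeFor s x := by
  induction φ with
  | falsum | eq | le => trivial
  | and φ ψ h1 h2 | or φ ψ h1 h2 | imp φ ψ h1 h2 => exact ⟨h1, h2⟩
  | neg φ h1 | box φ h1 => exact h1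
  | all y φ h1 | ex y φ h1 =>
    by_cases h : x = y
    · exact Or.inl h
    · exact Or.inr (Or.inr ⟨fun hy => h (Finset.mem_singleton.1 (hs hy)).symm, h1⟩)

theorem subst_self (x : ℕ) (φ : Formula) : φ.subst x (Term.var x) = φ := by
  simp [subst, substAll_var]

theorem inst_substAll {b : ℕ → ℕ} {φ : Formula} {σ τ : ℕ → Term} (h : φ.ok id τ) :
    (φ.substAll τ).inst b σ = φ.inst b (fun z => (τ z).substAll σ) := by
  induction φ generalizing σ τ with
  | falsum => rfl
  | eq | le => simp [substAll, inst, Term.substAll_substAll]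
  | and φ ψ h1 h2 | or φ ψ h1 h2 | imp φ ψ h1 h2 => simp [substAll, inst, h1 h.1, h2 h.2]
  | neg φ h1 | box φ h1 =>
    simp only [substAll, inst]; rw [h1 h]
  | all y φ h1 | ex y φ h1 =>
    simp only [substAll, inst]
    have h2 := h.2
    simp only [id] at h2
    rw [h1 h2]
    congr 1
    apply inst_congr
    intro z hz
    by_cases e : z = y
    · subst e; simp [Term.substAll]
    · simp only [Function.update_of_ne e]
      apply Term.substAll_congr
      intro u hu
      have : u ≠ y := by
        rintro rfl
        exact h.1 z hz e hu
      simp [this]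

end Formula

end ModalArith

namespace ModalArith

open Formula

/-- Abstract closure conditions on a set of theorems. -/
structure Lg (P : Formula → Prop) : Prop extends PL P where
  gen : ∀ (x : ℕ) (φ : Formula), P φ → P (all x φ)
  nec : ∀ φ, P φ → P (box φ)
  K : ∀ φ ψ, P (axK φ ψ)
  allSelf : ∀ x φ, P ((all x φ).imp φ)
  allImp : ∀ (x : ℕ) (φ ψ : Formula), x ∉ φ.fv → P ((all x (φ.imp ψ)).imp (φ.imp (all x ψ)))
  exSelf : ∀ (x : ℕ) (φ : Formula), P (φ.imp (ex x φ))
  exE : ∀ (x : ℕ) (φ ψ : Formula), x ∉ ψ.fv → P ((all x (φ.imp ψ)).imp ((ex x φ).imp ψ))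
  exEq : ∀ (x : ℕ) (t : Term), x ∉ t.fv → P (ex x (eq (Term.var x) t))
  eqRefl : ∀ t, P (eq t t)
  eqSymm : ∀ t u, P ((eq t u).imp (eq u t))
  eqTrans : ∀ t u w, P ((eq t u).imp ((eq u w).imp (eq t w)))
  eqSucc : ∀ t u : Term, P ((eq t u).imp (eq t.succ u.succ))
  eqAdd : ∀ t₁ t₂ u₁ u₂ : Term, P ((eq t₁ t₂).imp ((eq u₁ u₂).imp (eq (t₁.add u₁) (t₂.add u₂))))
  eqMul : ∀ t₁ t₂ u₁ u₂ : Term, P ((eq t₁ t₂).imp ((eq u₁ u₂).imp (eq (t₁.mul u₁) (t₂.mul u₂))))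
  eqLe : ∀ t₁ t₂ u₁ u₂ : Term, P ((eq t₁ t₂).imp ((eq u₁ u₂).imp ((le t₁ u₁).imp (le t₂ u₂))))
  eqBox : ∀ t u, P ((eq t u).imp (box (eq t u)))

/-- List conjunction of equations. -/
def eqs : List ℕ → (ℕ → Term) → (ℕ → Term) → Formula
  | [], _, _ => falsum.neg
  | z :: L, σ, τ => (eq (σ z) (τ z)).and (eqs L σ τ)

theorem fv_eqs {L : List ℕ} {σ τ : ℕ → Term} {x : ℕ} (h : x ∈ (eqs L σ τ).fv) :
    ∃ z ∈ L, x ∈ (σ z).fv ∨ x ∈ (τ z).fv := by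
  induction L with
  | nil => simp [eqs, fv] at h
  | cons z L ih =>
    simp only [eqs, fv, Finset.mem_union] at h
    rcases h with h | h
    · exact ⟨z, by simp, h⟩
    · obtain ⟨y, hy, h⟩ := ih h
      exact ⟨y, by simp [hy], h⟩

namespace PV
variable {P w : Formula → Prop}

theorem mp' (h : PV P w) {φ ψ : Formula} (a : P (φ.imp ψ)) (b : w φ) : w ψ :=
  (h.imp _ _).1 (h.th _ a) b

theorem eqs (h : PV P w) (L : List ℕ) (σ τ : ℕ → Term) :
    w (eqs L σ τ) ↔ ∀ z ∈ L, w (eq (σ z) (τ z)) := by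
  induction L with
  | nil => simp [ModalArith.eqs, h.neg, h.falsum]
  | cons z L ih => simp [ModalArith.eqs, h.and, ih]

variable (hP : Lg P) (h : PV P w)
include hP h

theorem eqRefl (t : Term) : w (eq t t) := h.th _ (hP.eqRefl t)
theorem eqSymm {t u : Term} (a : w (eq t u)) : w (eq u t) := h.mp' (hP.eqSymm t u) a
theorem eqTrans {t u s : Term} (a : w (eq t u)) (b : w (eq u s)) : w (eq t s) :=
  (h.imp _ _).1 (h.mp' (hP.eqTrans t u s) a) b
theorem eqSucc {t u : Term} (a : w (eq t u)) : w (eq t.succ u.succ) := h.mp' (hP.eqSucc t u) a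
theorem eqAdd {t u t' u' : Term} (a : w (eq t u)) (b : w (eq t' u')) :
    w (eq (t.add t') (u.add u')) :=
  (h.imp _ _).1 (h.mp' (hP.eqAdd _ _ _ _) a) b
theorem eqMul {t u t' u' : Term} (a : w (eq t u)) (b : w (eq t' u')) :
    w (eq (t.mul t') (u.mul u')) :=
  (h.imp _ _).1 (h.mp' (hP.eqMul _ _ _ _) a) b
theorem eqLe {t u t' u' : Term} (a : w (eq t u)) (b : w (eq t' u')) :
    w (le t t') ↔ w (le u u') :=
  ⟨fun c => (h.imp _ _).1 ((h.imp _ _).1 (h.mp' (hP.eqLe _ _ _ _) a) b) c,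
   fun c => (h.imp _ _).1 ((h.imp _ _).1 (h.mp' (hP.eqLe _ _ _ _) (h.eqSymm hP a)) (h.eqSymm hP b)) c⟩

theorem eqTerm (t : Term) {σ τ : ℕ → Term} (a : ∀ z ∈ t.fv, w (eq (σ z) (τ z))) :
    w (eq (t.substAll σ) (t.substAll τ)) := by
  induction t with
  | var x => exact a x (by simp [Term.fv])
  | zero => exact h.eqRefl hP _
  | succ t ih => exact h.eqSucc hP (ih a)
  | add t u h1 h2 =>
    exact h.eqAdd hP (h1 fun z hz => a z (by simp [Term.fv, hz])) (h2 fun z hz => a z (by simp [Term.fv, hz]))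
  | mul t u h1 h2 =>
    exact h.eqMul hP (h1 fun z hz => a z (by simp [Term.fv, hz])) (h2 fun z hz => a z (by simp [Term.fv, hz]))

end PV

namespace Lg
variable {P : Formula → Prop} (hP : Lg P)
include hP

theorem genImp {x : ℕ} {φ ψ : Formula} (hx : x ∉ φ.fv) (h : P (φ.imp ψ)) : P (φ.imp (all x ψ)) :=
  hP.mp _ _ (hP.allImp x φ ψ hx) (hP.gen _ _ h)

theorem exImp {x : ℕ} {φ ψ : Formula} (hx : x ∉ ψ.fv) (h : P (φ.imp ψ)) : P ((ex x φ).imp ψ) :=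
  hP.mp _ _ (hP.exE x φ ψ hx) (hP.gen _ _ h)

theorem elimEq {x : ℕ} {t : Term} {B : Formula} (hx : x ∉ t.fv) (hB : x ∉ B.fv)
    (h : P ((eq (Term.var x) t).imp B)) : P B :=
  hP.mp _ _ (hP.exImp hB h) (hP.exEq x t hx)

theorem boxMono {φ ψ : Formula} (h : P (φ.imp ψ)) : P ((box φ).imp (box ψ)) :=
  hP.mp _ _ (hP.K _ _) (hP.nec _ h)

theorem boxMono2 {φ ψ χ : Formula} (h : P (φ.imp (ψ.imp χ))) :
    P ((box φ).imp ((box ψ).imp (box χ))) :=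
  hP.trans (hP.boxMono h) (hP.K _ _)

theorem boxEqs (L : List ℕ) (σ τ : ℕ → Term) : P ((eqs L σ τ).imp (box (eqs L σ τ))) := by
  induction L with
  | nil =>
    apply hP.i1
    apply hP.nec
    refine hP.taut fun w h => ?_
    simp [eqs, h.neg, h.falsum]
  | cons z L ih =>
    have h1 := hP.boxMono2 (hP.prop _ (.andI (eq (σ z) (τ z)) (eqs L σ τ)))
    have h2 := hP.eqBox (σ z) (τ z)
    refine hP.taut fun w h => ?_
    have := h.th _ h1
    have := h.th _ h2
    have := h.th _ ih
    simp only [eqs, h.imp, h.and] at *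
    tauto

theorem elimEqs {L : List ℕ} {s : ℕ → ℕ} {t : ℕ → Term} {B : Formula} (hL : L.Nodup)
    (hs : ∀ z ∈ L, ∀ z' ∈ L, s z = s z' → z = z')
    (ht : ∀ z ∈ L, ∀ z' ∈ L, s z ∉ (t z').fv) (hB : ∀ z ∈ L, s z ∉ B.fv)
    (h : P ((eqs L (fun z => Term.var (s z)) t).imp B)) : P B := by
  induction L with
  | nil =>
    refine hP.mp _ _ h (hP.taut fun w h => ?_)
    simp [eqs, h.neg, h.falsum]
  | cons z L ih =>
    have hn := List.nodup_cons.1 hL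
    apply ih hn.2 (fun a ha b hb => hs a (by simp [ha]) b (by simp [hb]))
      (fun a ha b hb => ht a (by simp [ha]) b (by simp [hb])) (fun a ha => hB a (by simp [ha]))
    apply hP.elimEq (x := s z) (t := t z) (ht z (by simp) z (by simp))
    · simp only [fv, Finset.mem_union, not_or]
      refine ⟨fun hc => ?_, hB z (by simp)⟩
      obtain ⟨y, hy, hc⟩ := fv_eqs hc
      rcases hc with hc | hc
      · simp only [Term.fv, Finset.mem_singleton] at hc
        have := hs z (by simp) y (by simp [hy]) hc
        exact hn.1 (this ▸ hy)
      · exact ht z (by simp) y (by simp [hy]) hc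
    · refine hP.taut fun w hw => ?_
      have := hw.th _ h
      simp only [eqs, hw.imp, hw.and] at *
      tauto

theorem eqs_symm {L : List ℕ} {σ τ : ℕ → Term} {B : Formula} (h : P ((eqs L σ τ).imp B)) :
    P ((eqs L τ σ).imp B) := by
  refine hP.taut fun w hw => ?_
  have := hw.th _ h
  simp only [hw.imp, hw.eqs] at *
  exact fun a => this fun z hz => hw.eqSymm hP (a z hz)

theorem quant1 {p q : ℕ} {E A B : Formula} (hpq : p ≠ q) (hpE : p ∉ E.fv) (hqE : q ∉ E.fv)
    (hpB : p ∉ B.fv) (hqA : q ∉ A.fv)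
    (h : P ((eq (Term.var p) (Term.var q)).imp (E.imp (A.iff B)))) :
    P ((E.and (all p A)).imp (all q B)) ∧ P (E.imp ((ex p A).imp (ex q B))) := by
  constructor
  · apply hP.genImp
    · simp [fv, hqE, hqA]
    apply hP.elimEq (x := p) (t := Term.var q)
    · simpa [Term.fv] using hpq
    · simp [fv, hpE, hpB]
    have h2 := hP.allSelf p A
    refine hP.taut fun w hw => ?_
    have h3 := hw.th _ h
    have h4 := hw.th _ h2
    simp only [hw.imp, hw.and, hw.iff] at *
    tauto
  · have h1 : P (E.imp (A.imp (ex q B))) := by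
      apply hP.elimEq (x := q) (t := Term.var p)
      · simpa [Term.fv] using hpq.symm
      · simp [fv, hqE, hqA]
      have h2 := hP.exSelf q B
      have h5 := hP.eqSymm (Term.var q) (Term.var p)
      refine hP.taut fun w hw => ?_
      have h3 := hw.th _ h
      have h4 := hw.th _ h2
      have h5 := hw.th _ h5
      simp only [hw.imp, hw.iff] at *
      tauto
    have h2 : P ((ex p A).imp (E.imp (ex q B))) := by
      apply hP.exImp
      · simp [fv, hpE, hpB]
      refine hP.taut fun w hw => ?_
      have h3 := hw.th _ h1
      simp only [hw.imp] at *
      tauto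
    refine hP.taut fun w hw => ?_
    have h3 := hw.th _ h2
    simp only [hw.imp] at *
    tauto

theorem quant {p q : ℕ} {E A B : Formula} (hpq : p ≠ q) (hpE : p ∉ E.fv) (hqE : q ∉ E.fv)
    (hpB : p ∉ B.fv) (hqA : q ∉ A.fv)
    (h : P ((eq (Term.var p) (Term.var q)).imp (E.imp (A.iff B)))) :
    P (E.imp ((all p A).iff (all q B))) ∧ P (E.imp ((ex p A).iff (ex q B))) := by
  have h' : P ((eq (Term.var q) (Term.var p)).imp (E.imp (B.iff A))) := by
    have h5 := hP.eqSymm (Term.var q) (Term.var p)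
    refine hP.taut fun w hw => ?_
    have h3 := hw.th _ h
    have h5 := hw.th _ h5
    simp only [hw.imp, hw.iff] at *
    tauto
  obtain ⟨a1, a2⟩ := hP.quant1 hpq hpE hqE hpB hqA h
  obtain ⟨a3, a4⟩ := hP.quant1 hpq.symm hqE hpE hqA hpB h'
  constructor
  all_goals
    refine hP.taut fun w hw => ?_
    have a1 := hw.th _ a1
    have a2 := hw.th _ a2
    have a3 := hw.th _ a3
    have a4 := hw.th _ a4
    simp only [hw.imp, hw.iff, hw.and] at *
    tauto

/-- Key congruence lemma. -/
theorem H {N : ℕ} {b : ℕ → ℕ} {φ : Formula} {σ : ℕ → Term} (hk : φ.ok b σ)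
    (hN : ∀ z ∈ φ.fv, ∀ y ∈ (σ z).fv, y < N) (hb : ∀ x ∈ φ.vars, b x < N)
    {L : List ℕ} (hL : ∀ z ∈ φ.fv, z ∈ L) :
    P ((eqs L (fun z => Term.var (z + N)) σ).imp
      ((φ.inst (· + N) (fun z => Term.var (z + N))).iff (φ.inst b σ))) := by
  induction φ generalizing σ L with
  | falsum =>
    refine hP.taut fun w hw => ?_
    simp [hw.imp, hw.iff, inst]
  | eq t u =>
    refine hP.taut fun w hw => ?_
    simp only [hw.imp, hw.iff, inst, hw.eqs]
    intro h
    have h1 := hw.eqTerm hP t (fun z hz => h z (hL z (by simp [fv, hz])))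
    have h2 := hw.eqTerm hP u (fun z hz => h z (hL z (by simp [fv, hz])))
    exact ⟨fun a => hw.eqTrans hP (hw.eqSymm hP h1) (hw.eqTrans hP a h2),
      fun a => hw.eqTrans hP h1 (hw.eqTrans hP a (hw.eqSymm hP h2))⟩
  | le t u =>
    refine hP.taut fun w hw => ?_
    simp only [hw.imp, hw.iff, inst, hw.eqs]
    intro h
    have h1 := hw.eqTerm hP t (fun z hz => h z (hL z (by simp [fv, hz])))
    have h2 := hw.eqTerm hP u (fun z hz => h z (hL z (by simp [fv, hz])))
    exact hw.eqLe hP h1 h2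
  | and φ ψ h1 h2 | or φ ψ h1 h2 | imp φ ψ h1 h2 =>
    simp only [fv, vars, Finset.mem_union] at hN hb hL
    have h1 := h1 hk.1 (fun z hz => hN z (.inl hz)) (fun z hz => hb z (.inl hz)) (fun z hz => hL z (.inl hz))
    have h2 := h2 hk.2 (fun z hz => hN z (.inr hz)) (fun z hz => hb z (.inr hz)) (fun z hz => hL z (.inr hz))
    refine hP.taut fun w hw => ?_
    have h1 := hw.th _ h1
    have h2 := hw.th _ h2
    simp only [hw.imp, hw.iff, inst, hw.and, hw.or] at *
    intro h
    simp only [h1 h, h2 h]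
  | neg φ h1 =>
    have h1 := h1 hk hN hb hL
    refine hP.taut fun w hw => ?_
    have h1 := hw.th _ h1
    simp only [hw.imp, hw.iff, inst, hw.neg] at *
    intro h
    simp only [h1 h]
  | box φ h1 =>
    have h1 := hP.trans (hP.boxEqs _ _ _) (hP.boxMono (h1 hk hN hb hL))
    have h2 := hP.boxMono (hP.prop _ (.andE1 ((inst (· + N) φ (fun z => Term.var (z + N))).imp (inst b φ σ))
      ((inst b φ σ).imp (inst (· + N) φ (fun z => Term.var (z + N))))))
    have h3 := hP.boxMono (hP.prop _ (.andE2 ((inst (· + N) φ (fun z => Term.var (z + N))).imp (inst b φ σ))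
      ((inst b φ σ).imp (inst (· + N) φ (fun z => Term.var (z + N))))))
    have h4 := hP.K (inst (· + N) φ (fun z => Term.var (z + N))) (inst b φ σ)
    have h5 := hP.K (inst b φ σ) (inst (· + N) φ (fun z => Term.var (z + N)))
    refine hP.taut fun w hw => ?_
    have h1 := hw.th _ h1
    have h2 := hw.th _ h2
    have h3 := hw.th _ h3
    have h4 := hw.th _ h4
    have h5 := hw.th _ h5
    simp only [axK, hw.imp, inst, hw.iff] at *
    change _ → w (((inst (· + N) φ (fun z => Term.var (z + N))).imp (inst b φ σ)).and
      ((inst b φ σ).imp (inst (· + N) φ (fun z => Term.var (z + N))))).box at h1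
    tauto
  | all x φ h1 | ex x φ h1 =>
    simp only [fv, vars, Finset.mem_erase, Finset.mem_insert] at hN hb hL
    have hup : Function.update (fun z => Term.var (z + N)) x (Term.var (x + N)) = fun z => Term.var (z + N) := by
      funext z
      by_cases e : z = x
      · subst e; simp
      · simp [e]
    have hbx := hb x (.inl rfl)
    let L0 := (φ.fv.erase x).toList
    have h1 := h1 (L := x :: L0) hk.2 (by
      intro z hz y hy
      by_cases e : z = x
      · subst e
        simp [Term.fv] at hy
        omega
      · simp only [Function.update_of_ne e] at hy
        exact hN z ⟨e, hz⟩ y hy) (fun z hz => hb z (.inr hz)) (by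
      intro z hz
      by_cases e : z = x <;> simp [L0, e, hz])
    have hm : ∀ z, z ∈ L0 ↔ z ≠ x ∧ z ∈ φ.fv := by intro z; simp [L0]
    have h2 : P ((eq (Term.var (x + N)) (Term.var (b x))).imp
        ((eqs L0 (fun z => Term.var (z + N)) σ).imp
        ((inst (· + N) φ (fun z => Term.var (z + N))).iff
          (inst b φ (Function.update σ x (Term.var (b x))))))) := by
      refine hP.taut fun w hw => ?_
      have h1 := hw.th _ h1
      simp only [hw.imp, hw.iff, hw.eqs] at *
      intro a c
      apply h1
      intro z hz
      by_cases e : z = x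
      · subst e
        simpa using a
      · simp only [Function.update_of_ne e]
        simp only [List.mem_cons, e, false_or] at hz
        exact c z hz
    have h3 := hP.quant (p := x + N) (q := b x) (by omega) (by
        intro hc
        obtain ⟨y, hy, hc⟩ := fv_eqs hc
        simp only [hm] at hy
        rcases hc with hc | hc
        · simp only [Term.fv, Finset.mem_singleton] at hc
          omega
        · have := hN _ hy _ hc
          omega) (by
        intro hc
        obtain ⟨y, hy, hc⟩ := fv_eqs hc
        simp only [hm] at hy
        rcases hc with hc | hc
        · simp only [Term.fv, Finset.mem_singleton] at hc
          omega
        · exact hk.1 y hy.2 hy.1 hc) (by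
        intro hc
        obtain ⟨z, hz, hc⟩ := fv_inst hc
        by_cases e : z = x
        · subst e
          simp only [Function.update_self, Term.fv, Finset.mem_singleton] at hc
          omega
        · simp only [Function.update_of_ne e] at hc
          have := hN z ⟨e, hz⟩ _ hc
          omega) (by
        intro hc
        obtain ⟨z, hz, hc⟩ := fv_inst hc
        simp only [Term.fv, Finset.mem_singleton] at hc
        omega) h2
    have h4 : P ((eqs L (fun z => Term.var (z + N)) σ).imp (eqs L0 (fun z => Term.var (z + N)) σ)) := by
      refine hP.taut fun w hw => ?_
      simp only [hw.imp, hw.eqs]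
      exact fun a z hz => a z (hL z ((hm z).1 hz))
    simp only [inst, hup]
    first
      | exact hP.trans h4 h3.1
      | exact hP.trans h4 h3.2

theorem exists_N (b : ℕ → ℕ) (φ : Formula) (σ : ℕ → Term) : ∃ N0, ∀ N ≥ N0,
    (∀ z ∈ φ.fv, ∀ y ∈ (σ z).fv, y < N) ∧ (∀ x ∈ φ.vars, b x < N) ∧ (∀ x ∈ φ.vars, x < N) := by
  refine ⟨(φ.fv.biUnion fun z => (σ z).fv).sup id + φ.vars.sup b + φ.vars.sup id + 1, fun N hN =>
    ⟨fun z hz y hy => ?_, fun x hx => ?_, fun x hx => ?_⟩⟩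
  · have : y ≤ (φ.fv.biUnion fun z => (σ z).fv).sup id :=
      Finset.le_sup (f := id) (Finset.mem_biUnion.2 ⟨z, hz, hy⟩)
    omega
  · have : b x ≤ φ.vars.sup b := Finset.le_sup hx
    omega
  · have : x ≤ φ.vars.sup id := Finset.le_sup (f := id) hx
    omega

theorem cong {b c : ℕ → ℕ} {φ : Formula} {σ τ : ℕ → Term} (h1 : φ.ok b σ) (h2 : φ.ok c τ) :
    P ((eqs φ.fv.toList σ τ).imp ((φ.inst b σ).iff (φ.inst c τ))) := by
  obtain ⟨N1, hN1⟩ := exists_N hP b φ σ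
  obtain ⟨N2, hN2⟩ := exists_N hP c φ τ
  obtain ⟨a1, a2, a3⟩ := hN1 (max N1 N2) (le_max_left _ _)
  obtain ⟨b1, b2, b3⟩ := hN2 (max N1 N2) (le_max_right _ _)
  generalize max N1 N2 = N at *
  have e1 := hP.H h1 a1 a2 (L := φ.fv.toList) (by simp)
  have e2 := hP.H h2 b1 b2 (L := φ.fv.toList) (by simp)
  apply hP.elimEqs (L := φ.fv.toList) (s := (· + N)) (t := σ) (Finset.nodup_toList _)
    (fun z _ z' _ h => by simpa using h)
  · intro z _ z' hz' hc
    have := a1 z' (by simpa using hz') _ hc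
    omega
  · intro z hz hc
    simp only [Formula.iff, fv, Finset.mem_union] at hc
    have : (∃ z' ∈ φ.fv, z + N ∈ (σ z').fv) ∨ ∃ z' ∈ φ.fv, z + N ∈ (τ z').fv := by
      rcases hc with hc | hc | hc
      · obtain ⟨y, hy, hc⟩ := fv_eqs hc
        simp only [Finset.mem_toList] at hy
        rcases hc with hc | hc
        · exact .inl ⟨y, hy, hc⟩
        · exact .inr ⟨y, hy, hc⟩
      all_goals
        rcases hc with hc | hc
        · first
            | exact .inl (fv_inst hc)
            | exact .inr (fv_inst hc)
        · first
            | exact .inl (fv_inst hc)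
            | exact .inr (fv_inst hc)
    rcases this with ⟨y, hy, hc⟩ | ⟨y, hy, hc⟩
    · have := a1 y hy _ hc
      omega
    · have := b1 y hy _ hc
      omega
  · refine hP.taut fun w hw => ?_
    have e1 := hw.th _ e1
    have e2 := hw.th _ e2
    simp only [hw.imp, hw.iff, hw.eqs] at *
    intro h h'
    exact (e1 h).symm.trans (e2 fun z hz => hw.eqTrans hP (h z hz) (h' z hz))

theorem instN {b : ℕ → ℕ} {φ : Formula} {σ : ℕ → Term} (h1 : φ.ok b σ) :
    ∃ N0, ∀ N ≥ N0, P (φ.inst (· + N) (fun z => Term.var (z + N))) → P (φ.inst b σ) := by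
  obtain ⟨N1, hN1⟩ := exists_N hP b φ σ
  refine ⟨N1, fun N hN h => ?_⟩
  obtain ⟨a1, a2, a3⟩ := hN1 N hN
  have e1 := hP.H h1 a1 a2 (L := φ.fv.toList) (by simp)
  apply hP.elimEqs (L := φ.fv.toList) (s := (· + N)) (t := σ) (Finset.nodup_toList _)
    (fun z _ z' _ h => by simpa using h)
  · intro z _ z' hz' hc
    have := a1 z' (by simpa using hz') _ hc
    omega
  · intro z hz hc
    obtain ⟨y, hy, hc⟩ := fv_inst hc
    have := a1 y hy _ hc
    omega
  · refine hP.taut fun w hw => ?_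
    have e1 := hw.th _ e1
    have h := hw.th _ h
    simp only [hw.imp, hw.iff] at *
    tauto

theorem instN' {b : ℕ → ℕ} {φ : Formula} {s : ℕ → ℕ} (h1 : φ.ok b (fun z => Term.var (s z)))
    (hs : Function.Injective s) :
    ∃ N0, ∀ N ≥ N0, P (φ.inst b (fun z => Term.var (s z))) →
      P (φ.inst (· + N) (fun z => Term.var (z + N))) := by
  obtain ⟨N1, hN1⟩ := exists_N hP b φ (fun z => Term.var (s z))
  refine ⟨N1, fun N hN h => ?_⟩
  obtain ⟨a1, a2, a3⟩ := hN1 N hN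
  have e1 := hP.eqs_symm (hP.H h1 a1 a2 (L := φ.fv.toList) (by simp))
  apply hP.elimEqs (L := φ.fv.toList) (s := s) (t := fun z => Term.var (z + N)) (Finset.nodup_toList _)
    (fun z _ z' _ h => hs h)
  · intro z hz z' hz' hc
    have := a1 z (by simpa using hz) (s z) (by simp [Term.fv])
    simp only [Term.fv, Finset.mem_singleton] at hc
    omega
  · intro z hz hc
    obtain ⟨y, hy, hc⟩ := fv_inst hc
    have := a1 z (by simpa using hz) (s z) (by simp [Term.fv])
    simp only [Term.fv, Finset.mem_singleton] at hc
    omega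
  · refine hP.taut fun w hw => ?_
    have e1 := hw.th _ e1
    have h := hw.th _ h
    simp only [hw.imp, hw.iff] at *
    tauto

theorem instance_of {b : ℕ → ℕ} {φ : Formula} {σ : ℕ → Term} (h1 : φ.ok b σ) (h : P φ) :
    P (φ.inst b σ) := by
  obtain ⟨N1, hN1⟩ := hP.instN h1
  obtain ⟨N2, hN2⟩ := hP.instN' (b := id) (s := id) φ.ok_id_var (fun _ _ h => h)
  refine hN1 (max N1 N2) (le_max_left _ _) (hN2 _ (le_max_right _ _) ?_)
  rw [inst_id]
  simpa [substAll_var] using h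

theorem of_instance {b : ℕ → ℕ} {φ : Formula} {s : ℕ → ℕ} (h1 : φ.ok b (fun z => Term.var (s z)))
    (hs : Function.Injective s) (h : P (φ.inst b (fun z => Term.var (s z)))) : P φ := by
  obtain ⟨N1, hN1⟩ := hP.instN φ.ok_id_var
  obtain ⟨N2, hN2⟩ := hP.instN' h1 hs
  have := hN1 (max N1 N2) (le_max_left _ _) (hN2 _ (le_max_right _ _) h)
  rw [inst_id] at this
  simpa [substAll_var] using this

theorem inst1 {x : ℕ} {t : Term} {φ : Formula} (h : φ.freeFor t x) :
    P ((eq (Term.var x) t).imp (φ.iff (φ.subst x t))) := by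
  have := hP.cong (φ := φ) φ.ok_id_var (ok_of_freeFor h)
  rw [inst_id, inst_id, substAll_var] at this
  refine hP.taut fun w hw => ?_
  have := hw.th _ this
  simp only [hw.imp, hw.iff, hw.eqs] at *
  intro a
  apply this
  intro z hz
  by_cases e : z = x
  · subst e; simpa using a
  · simpa [e] using hw.eqRefl hP _

theorem allE {x : ℕ} {t : Term} {φ : Formula} (h : φ.freeFor t x) :
    P ((all x φ).imp (φ.subst x t)) := by
  have h1 : ((all x φ).imp φ).ok id (Function.update Term.var x t) := by
    refine ⟨⟨fun z _ hz => ?_, ?_⟩, ok_of_freeFor h⟩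
    · simp [hz, Term.fv, Ne.symm hz]
    · simpa using φ.ok_id_var
  have := hP.instance_of h1 (hP.allSelf x φ)
  simpa [inst_id, substAll, substAll_var, subst] using this

theorem exI {x : ℕ} {t : Term} {φ : Formula} (h : φ.freeFor t x) :
    P ((φ.subst x t).imp (ex x φ)) := by
  have h1 : (φ.imp (ex x φ)).ok id (Function.update Term.var x t) := by
    refine ⟨ok_of_freeFor h, ⟨fun z _ hz => ?_, ?_⟩⟩
    · simp [hz, Term.fv, Ne.symm hz]
    · simpa using φ.ok_id_var
  have := hP.instance_of h1 (hP.exSelf x φ)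
  simpa [inst_id, substAll, substAll_var, subst] using this

end Lg

end ModalArith

namespace ModalArith

open Formula

theorem Provable.pl (T : Set Formula) : PL (Provable T) where
  prop φ h := by
    apply Provable.logic
    cases h
    · exact .imp1 _ _
    · exact .imp2 _ _ _
    · exact .dne _
    · exact .negI _ _
    · exact .negE _ _
    · exact .falsumE _
    · exact .andI _ _
    · exact .andE1 _ _
    · exact .andE2 _ _
    · exact .orI1 _ _
    · exact .orI2 _ _
    · exact .orE _ _ _
  mp _ _ a b := .mp a b

section
variable {T : Set Formula}

theorem Provable.allE' {x : ℕ} {t : Term} {φ ψ : Formula} (h : Provable T φ)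
    (hf : φ.freeFor t x) (e : φ.subst x t = ψ) : Provable T ψ :=
  e ▸ .mp (.logic (.allE x t φ hf)) (.gen x h)

theorem Provable.ind {x : ℕ} {φ A B : Formula} (hT : Extends T PAK)
    (h0 : φ.subst x Term.zero = A) (h1 : φ.subst x (Term.succ (Term.var x)) = B) :
    Provable T ((A.and (all x (φ.imp B))).imp (all x φ)) := by
  subst h0 h1
  exact hT _ (.inl (.inr ⟨x, φ, rfl⟩))

theorem Provable.base {φ : Formula} (hT : Extends T PAK) (h : φ ∈ baseAxioms) : Provable T φ :=
  hT _ (.inl (.inl h))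

theorem Provable.eqBox (hT : Extends T PAK) (t u : Term) :
    Provable T ((eq t u).imp (box (eq t u))) := by
  let F : Term → Term → Formula := fun t u => (eq t u).imp (box (eq t u))
  have hp := Provable.pl T
  obtain ⟨y, hy⟩ := Infinite.exists_notMem_finset (t.fv ∪ {0, 1, 2})
  simp only [Finset.mem_union, Finset.mem_insert, Finset.mem_singleton, not_or] at hy
  obtain ⟨hyt, hy0, hy1, hy2⟩ := hy
  have sne : ∀ s : Term, Provable T ((eq s.succ Term.zero).neg) := fun s =>
    (Provable.base hT (φ := succNeZero) (by simp [baseAxioms])).allE' (x := 0) (t := s) trivial rfl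
  have sinj : Provable T ((eq (Term.var 2).succ (Term.var y).succ).imp (eq (Term.var 2) (Term.var y))) := by
    have h1 := (Provable.base hT (φ := succInj) (by simp [baseAxioms])).allE' (x := 0) (t := Term.var 2)
      (ψ := (eq (Term.var 2).succ (Term.var 1).succ).imp (eq (Term.var 2) (Term.var 1)))
      ⟨trivial, trivial⟩ rfl
    exact h1.allE' (x := 1) (t := Term.var y) ⟨trivial, trivial⟩ rfl
  have zs : ∀ s : Term, Provable T (F s.succ Term.zero) := by
    intro s
    have h1 := sne s
    refine hp.taut fun w hw => ?_
    have h1 := hw.th _ h1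
    simp only [F, hw.imp, hw.neg] at *
    tauto
  have zs' : ∀ s : Term, Provable T (F Term.zero s.succ) := by
    intro s
    have h1 := sne s
    have h2 := Provable.logic (T := T) (.eqSymm Term.zero s.succ)
    refine hp.taut fun w hw => ?_
    have h1 := hw.th _ h1
    have h2 := hw.th _ h2
    simp only [F, hw.imp, hw.neg] at *
    tauto
  have base : Provable T (all y (F Term.zero (Term.var y))) := by
    refine .mp (Provable.ind hT (A := F Term.zero Term.zero) (B := F Term.zero (Term.var y).succ)
      (by simp [F, subst, substAll, Term.substAll]) (by simp [F, subst, substAll, Term.substAll])) ?_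
    have h1 : Provable T (F Term.zero Term.zero) := hp.i1 _ (.nec (.logic (.eqRefl _)))
    have h2 : Provable T (all y ((F Term.zero (Term.var y)).imp (F Term.zero (Term.var y).succ))) :=
      .gen _ (hp.i1 _ (zs' _))
    exact .mp (.mp (.logic (.andI _ _)) h1) h2
  have step : Provable T ((all y (F (Term.var 2) (Term.var y))).imp (all y (F (Term.var 2).succ (Term.var y)))) := by
    have h1 : Provable T ((all y (F (Term.var 2) (Term.var y))).imp (F (Term.var 2).succ (Term.var y).succ)) := by
      have h1 : Provable T ((all y (F (Term.var 2) (Term.var y))).imp (F (Term.var 2) (Term.var y))) := by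
        have := Provable.logic (T := T) (.allE y (Term.var y) (F (Term.var 2) (Term.var y)) ⟨trivial, trivial⟩)
        rwa [subst_self] at this
      have h2 := Provable.mp (hT _ (.inr ⟨_, _, rfl⟩)) (Provable.nec (Provable.logic (T := T) (.eqSucc (Term.var 2) (Term.var y))))
      refine hp.taut fun w hw => ?_
      have h1 := hw.th _ h1
      have h2 := hw.th _ h2
      have h3 := hw.th _ sinj
      simp only [F, hw.imp] at *
      tauto
    have h2 := Provable.ind hT (x := y) (φ := F (Term.var 2).succ (Term.var y)) (A := F (Term.var 2).succ Term.zero)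
      (B := F (Term.var 2).succ (Term.var y).succ)
      (by simp [F, subst, substAll, Term.substAll, Ne.symm hy2]) (by simp [F, subst, substAll, Term.substAll, Ne.symm hy2])
    have h3 : Provable T ((all y (F (Term.var 2) (Term.var y))).imp
        (all y ((F (Term.var 2).succ (Term.var y)).imp (F (Term.var 2).succ (Term.var y).succ)))) := by
      refine .mp (.logic (.allImp _ _ _ (by simp [fv]))) (.gen y ?_)
      exact hp.trans h1 (hp.prop _ (.imp1 _ _))
    have h4 := zs (Term.var 2)
    refine hp.taut fun w hw => ?_
    have h2 := hw.th _ h2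
    have h3 := hw.th _ h3
    have h4 := hw.th _ h4
    simp only [hw.and, hw.imp] at *
    tauto
  have main : Provable T (all 2 (all y (F (Term.var 2) (Term.var y)))) := by
    refine .mp (Provable.ind hT (A := all y (F Term.zero (Term.var y))) (B := all y (F (Term.var 2).succ (Term.var y)))
      (by simp [F, subst, substAll, Term.substAll, hy2, Ne.symm hy2]) (by simp [F, subst, substAll, Term.substAll, hy2, Ne.symm hy2])) ?_
    exact .mp (.mp (.logic (.andI _ _)) base) (.gen 2 step)
  have m1 : Provable T (all y (F t (Term.var y))) := by
    have := Provable.mp (.logic (.allE 2 t (all y (F (Term.var 2) (Term.var y))) (Or.inr (Or.inr ⟨hyt, ⟨trivial, trivial⟩⟩)))) main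
    simpa [F, subst, substAll, Term.substAll, hy2, Ne.symm hy2] using this
  have := Provable.mp (.logic (.allE y u (F t (Term.var y)) ⟨trivial, trivial⟩)) m1
  have e : Term.substAll t (Function.update Term.var y u) = t := by
    apply Term.substAll_id
    intro z hz
    have : z ≠ y := by rintro rfl; exact hyt hz
    simp [this]
  simpa [F, subst, substAll, Term.substAll, e] using this

theorem Provable.lg (hT : Extends T PAK) : Lg (Provable T) where
  toPL := Provable.pl T
  gen _ _ h := .gen _ h
  nec _ h := .nec h
  K _ _ := hT _ (.inr ⟨_, _, rfl⟩)
  allSelf x φ := by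
    have := Provable.logic (T := T) (.allE x (Term.var x) φ (freeFor_self x φ (by simp [Term.fv])))
    rwa [subst_self] at this
  allImp _ _ _ h := .logic (.allImp _ _ _ h)
  exSelf x φ := by
    have := Provable.logic (T := T) (.exI x (Term.var x) φ (freeFor_self x φ (by simp [Term.fv])))
    rwa [subst_self] at this
  exE _ _ _ h := .logic (.exE _ _ _ h)
  exEq x t h := by
    refine .mp (.logic (.exI x t _ trivial)) ?_
    have e : Term.substAll t (Function.update Term.var x t) = t := by
      apply Term.substAll_id
      intro z hz
      have : z ≠ x := by rintro rfl; exact h hz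
      simp [this]
    simp only [subst, substAll, Term.substAll, e, Function.update_self]
    exact .logic (.eqRefl _)
  eqRefl _ := .logic (.eqRefl _)
  eqSymm _ _ := .logic (.eqSymm _ _)
  eqTrans _ _ _ := .logic (.eqTrans _ _ _)
  eqSucc _ _ := .logic (.eqSucc _ _)
  eqAdd _ _ _ _ := .logic (.eqAdd _ _ _ _)
  eqMul _ _ _ _ := .logic (.eqMul _ _ _ _)
  eqLe _ _ _ _ := .logic (.eqLe _ _ _ _)
  eqBox t u := Provable.eqBox hT t u

end

/-- Values of terms. -/
def Term.evl {M : Type} (z : M) (s : M → M) (a m : M → M → M) : Term → (ℕ → M) → M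
  | .var x, v => v x
  | .zero, _ => z
  | .succ t, v => s (t.evl z s a m v)
  | .add t u, v => a (t.evl z s a m v) (u.evl z s a m v)
  | .mul t u, v => m (t.evl z s a m v) (u.evl z s a m v)

/-- Structures for the modal language; the interpretation of boxed formulas is arbitrary. -/
structure Str where
  M : Type
  zero : M
  succ : M → M
  add : M → M → M
  mul : M → M → M
  le : M → M → Prop
  bx : Formula → (ℕ → M) → Prop

def Str.ev (A : Str) (t : Term) (v : ℕ → A.M) : A.M := t.evl A.zero A.succ A.add A.mul v

def Str.Sat (A : Str) : Formula → (ℕ → A.M) → Prop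
  | .falsum, _ => False
  | .eq t u, v => A.ev t v = A.ev u v
  | .le t u, v => A.le (A.ev t v) (A.ev u v)
  | .and φ ψ, v => A.Sat φ v ∧ A.Sat ψ v
  | .or φ ψ, v => A.Sat φ v ∨ A.Sat ψ v
  | .imp φ ψ, v => A.Sat φ v → A.Sat ψ v
  | .neg φ, v => ¬ A.Sat φ v
  | .all x φ, v => ∀ a : A.M, A.Sat φ (Function.update v x a)
  | .ex x φ, v => ∃ a : A.M, A.Sat φ (Function.update v x a)
  | .box φ, v => A.bx φ v

/-- Models of a theory. -/
structure Mdl (T : Set Formula) extends Str where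
  sound : ∀ χ, Provable T χ → ∀ v, toStr.Sat χ v
  bx_subst : ∀ (φ : Formula) (τ : ℕ → Term), φ.ok id τ → ∀ v,
    bx (φ.substAll τ) v ↔ bx φ (fun z => toStr.ev (τ z) v)
  bx_congr : ∀ (φ : Formula) v v', (∀ z ∈ φ.fv, v z = v' z) → (bx φ v → bx φ v')

section Henkin

theorem Term.code_inj : Function.Injective Term.code := by
  intro t
  induction t with
  | var x => intro u h; cases u <;> simp [Term.code] at h ⊢; exact h
  | zero => intro u h; cases u <;> simp [Term.code] at h ⊢
  | succ t ih => intro u h; cases u <;> simp [Term.code] at h ⊢; exact ih h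
  | add t t' ih ih' => intro u h; cases u <;> simp [Term.code] at h ⊢; exact ⟨ih h.1, ih' h.2⟩
  | mul t t' ih ih' => intro u h; cases u <;> simp [Term.code] at h ⊢; exact ⟨ih h.1, ih' h.2⟩

theorem Formula.code_inj : Function.Injective Formula.code := by
  intro t
  induction t with
  | falsum => intro u h; cases u <;> simp [Formula.code] at h ⊢
  | eq t t' | le t t' =>
    intro u h; cases u <;> simp [Formula.code] at h ⊢
    exact ⟨Term.code_inj h.1, Term.code_inj h.2⟩
  | neg t ih | box t ih => intro u h; cases u <;> simp [Formula.code] at h ⊢; exact ih h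
  | and t t' ih ih' | or t t' ih ih' | imp t t' ih ih' =>
    intro u h; cases u <;> simp [Formula.code] at h ⊢; exact ⟨ih h.1, ih' h.2⟩
  | all x t ih | ex x t ih => intro u h; cases u <;> simp [Formula.code] at h ⊢; exact ⟨h.1, ih h.2⟩

instance : Countable Formula := Formula.code_inj.countable

variable {P : Formula → Prop} (hP : Lg P)

theorem exists_fresh_odd (s : Finset ℕ) : ∃ y, 2 * y + 1 ∉ s := by
  by_contra h
  push Not at h
  obtain ⟨y, hy⟩ := Infinite.exists_notMem_finset (s.image fun n => (n - 1) / 2)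
  apply hy
  rw [Finset.mem_image]
  exact ⟨2 * y + 1, h y, by omega⟩

noncomputable def fresh (s : Finset ℕ) : ℕ := 2 * (exists_fresh_odd s).choose + 1

theorem fresh_notMem (s : Finset ℕ) : fresh s ∉ s := (exists_fresh_odd s).choose_spec
theorem fresh_odd (s : Finset ℕ) : fresh s % 2 = 1 := by unfold fresh; omega

/-- Henkin axiom. -/
def hax (y z : ℕ) (θ : Formula) : Formula :=
  (ex z θ).imp (ex z ((eq (Term.var y) (Term.var z)).and θ))

noncomputable def gam (χ : Formula) (e : ℕ → ℕ × Formula) : ℕ → Formula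
  | 0 => χ.neg
  | n + 1 => (gam χ e n).and (hax (fresh ((gam χ e n).fv ∪ (e n).2.fv ∪ {(e n).1})) (e n).1 (e n).2)

include hP in
theorem hax_cons {y z : ℕ} {γ θ : Formula} (h1 : y ∉ γ.fv) (h2 : y ∉ θ.fv) (h3 : y ≠ z)
    (h : P (γ.and (hax y z θ)).neg) : P γ.neg := by
  let A := ex z ((eq (Term.var y) (Term.var z)).and θ)
  have e1 : P (γ.imp (ex z θ)) := by
    refine hP.taut fun w hw => ?_
    have := hw.th _ h
    simp only [hax, hw.neg, hw.and, hw.imp] at *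
    tauto
  have e2 : P (γ.imp A.neg) := by
    refine hP.taut fun w hw => ?_
    have := hw.th _ h
    simp only [A, hax, hw.neg, hw.and, hw.imp] at *
    tauto
  have e3 := hP.genImp h1 e2
  have e4 : P ((all y A.neg).imp θ.neg) := by
    apply hP.elimEq (x := y) (t := Term.var z)
    · simpa [Term.fv] using h3
    · simp [fv, h2]
    have a1 := hP.allSelf y A.neg
    have a2 := hP.exSelf z ((eq (Term.var y) (Term.var z)).and θ)
    refine hP.taut fun w hw => ?_
    have a1 := hw.th _ a1
    have a2 := hw.th _ a2
    simp only [A, hw.neg, hw.and, hw.imp] at *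
    tauto
  have e5 : P (θ.imp (all y A.neg).neg) := by
    refine hP.taut fun w hw => ?_
    have := hw.th _ e4
    simp only [hw.neg, hw.imp] at *
    tauto
  have e6 := hP.exImp (x := z) (by simp [A, fv]) e5
  refine hP.taut fun w hw => ?_
  have e1 := hw.th _ e1
  have e3 := hw.th _ e3
  have e6 := hw.th _ e6
  simp only [hw.neg, hw.imp] at *
  tauto

include hP in
theorem gam_cons {χ : Formula} (e : ℕ → ℕ × Formula) (h : ¬ P χ) (n : ℕ) :
    ¬ P (gam χ e n).neg := by
  induction n with
  | zero => exact fun h' => h (hP.mp _ _ (hP.prop _ (.dne _)) h')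
  | succ n ih =>
    intro h'
    have := fresh_notMem ((gam χ e n).fv ∪ (e n).2.fv ∪ {(e n).1})
    simp only [Finset.mem_union, Finset.mem_singleton, not_or] at this
    exact ih (hax_cons hP this.1.1 this.1.2 this.2 h')

include hP in
/-- Existence of a Henkin valuation. -/
theorem exists_henkin {χ : Formula} (h : ¬ P χ) : ∃ w, PV P w ∧ ¬ w χ ∧
    ∀ z θ, w (ex z θ) → ∃ y, y % 2 = 1 ∧ w (ex z ((eq (Term.var y) (Term.var z)).and θ)) := by
  haveI : Nonempty (ℕ × Formula) := ⟨(0, falsum)⟩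
  obtain ⟨e, he⟩ := exists_surjective_nat (ℕ × Formula)
  have mono : ∀ n k, P ((gam χ e (n + k)).imp (gam χ e n)) := by
    intro n k
    induction k with
    | zero => exact hP.refl _
    | succ k ih => exact hP.trans (hP.prop _ (.andE1 _ _)) ih
  have mono' : ∀ n m, n ≤ m → P ((gam χ e m).imp (gam χ e n)) := by
    intro n m h
    obtain ⟨k, rfl⟩ := Nat.exists_eq_add_of_le h
    exact mono n k
  let Q : Formula → Prop := fun ψ => ∃ n, P ((gam χ e n).imp ψ)
  have hQ : PL Q := by
    constructor
    · exact fun φ h => ⟨0, hP.i1 _ (hP.prop _ h)⟩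
    · rintro φ ψ ⟨n, hn⟩ ⟨m, hm⟩
      exact ⟨max n m, hP.i2 (hP.trans (mono' _ _ (le_max_left _ _)) hn) (hP.trans (mono' _ _ (le_max_right _ _)) hm)⟩
  have hf : ¬ Q falsum := by
    rintro ⟨n, hn⟩
    apply gam_cons hP e h n
    refine hP.taut fun w hw => ?_
    have := hw.th _ hn
    simp only [hw.neg, hw.imp, hw.falsum] at *
    tauto
  obtain ⟨w, hw, -⟩ := hQ.exists_pv hf
  refine ⟨w, ⟨fun φ h => hw.th _ ⟨0, hP.i1 _ h⟩, hw.falsum, hw.neg, hw.imp, hw.and, hw.or⟩, ?_, ?_⟩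
  · rw [← hw.neg]
    exact hw.th _ ⟨0, hP.refl _⟩
  · intro z θ hzθ
    obtain ⟨n, hn⟩ := he (z, θ)
    refine ⟨fresh ((gam χ e n).fv ∪ (e n).2.fv ∪ {(e n).1}), fresh_odd _, ?_⟩
    have : w (gam χ e (n + 1)) := hw.th _ ⟨n + 1, hP.refl _⟩
    simp only [gam, hw.and, hax, hw.imp] at this
    rw [hn] at this ⊢
    exact this.2 hzθ

theorem ok_even {φ : Formula} {σ : ℕ → Term} (h : ∀ z, ∀ y ∈ (σ z).fv, y % 2 = 1 ∨ y = 2 * z) :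
    φ.ok (2 * ·) σ := by
  induction φ generalizing σ with
  | falsum | eq t u | le t u => trivial
  | and φ ψ h1 h2 | or φ ψ h1 h2 | imp φ ψ h1 h2 => exact ⟨h1 h, h2 h⟩
  | neg φ h1 | box φ h1 => exact h1 h
  | all x φ h1 | ex x φ h1 =>
    refine ⟨fun z hz hx hc => ?_, h1 fun z y hy => ?_⟩
    · have := h z _ hc
      simp only at this
      omega
    · by_cases e : z = x
      · subst e; simp [Term.fv] at hy; exact .inr hy
      · simp only [Function.update_of_ne e] at hy; exact h z y hy

/-- Terms with odd variables only. -/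
def OT : Type := {t : Term // ∀ y ∈ t.fv, y % 2 = 1}

theorem ok_OT {φ : Formula} (σ : ℕ → OT) : φ.ok (2 * ·) (fun z => (σ z).1) :=
  ok_even fun z y hy => .inl ((σ z).2 y hy)

variable {w : Formula → Prop}

def hSetoid (hP : Lg P) (hw : PV P w) : Setoid OT where
  r a b := w (eq a.1 b.1)
  iseqv := ⟨fun a => hw.eqRefl hP _, fun h => hw.eqSymm hP h, fun h h' => hw.eqTrans hP h h'⟩

def OT.subst (t : Term) (σ : ℕ → OT) : OT :=
  ⟨t.substAll fun z => (σ z).1, fun y hy => by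
    obtain ⟨z, _, hy⟩ := Term.mem_fv_substAll.1 hy
    exact (σ z).2 y hy⟩

noncomputable def hStr (hP : Lg P) (hw : PV P w) : Str where
  M := Quotient (hSetoid hP hw)
  zero := Quotient.mk _ ⟨.zero, by simp [Term.fv]⟩
  succ a := Quotient.mk _ ⟨.succ a.out.1, by simpa [Term.fv] using a.out.2⟩
  add a b := Quotient.mk _ ⟨.add a.out.1 b.out.1, by
    intro y hy
    simp only [Term.fv, Finset.mem_union] at hy
    exact hy.elim (a.out.2 y) (b.out.2 y)⟩
  mul a b := Quotient.mk _ ⟨.mul a.out.1 b.out.1, by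
    intro y hy
    simp only [Term.fv, Finset.mem_union] at hy
    exact hy.elim (a.out.2 y) (b.out.2 y)⟩
  le a b := w (le a.out.1 b.out.1)
  bx φ v := w (box (φ.inst (2 * ·) fun z => (v z).out.1))

variable (hw : PV P w)

def hmk (a : OT) : (hStr hP hw).M := Quotient.mk _ a

theorem hmk_eq {a b : OT} : hmk hP hw a = hmk hP hw b ↔ w (eq a.1 b.1) := by
  exact Quotient.eq (r := hSetoid hP hw)

theorem hmk_out (a : OT) : w (eq (Quotient.out (s := hSetoid hP hw) (hmk hP hw a)).1 a.1) := by
  rw [← hmk_eq hP hw]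
  exact Quotient.out_eq _

theorem h_ev (t : Term) (σ : ℕ → OT) :
    (hStr hP hw).ev t (fun z => hmk hP hw (σ z)) = hmk hP hw (OT.subst t σ) := by
  induction t with
  | var x => rfl
  | zero => rfl
  | succ t ih =>
    unfold Str.ev at *
    rw [Term.evl, ih]
    exact (hmk_eq hP hw).2 (hw.eqSucc hP (hmk_out hP hw _))
  | add t u h1 h2 =>
    unfold Str.ev at *
    rw [Term.evl, h1, h2]
    exact (hmk_eq hP hw).2 (hw.eqAdd hP (hmk_out hP hw _) (hmk_out hP hw _))
  | mul t u h1 h2 =>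
    unfold Str.ev at *
    rw [Term.evl, h1, h2]
    exact (hmk_eq hP hw).2 (hw.eqMul hP (hmk_out hP hw _) (hmk_out hP hw _))

include hP hw in
theorem h_congr {b c : ℕ → ℕ} {φ : Formula} {σ τ : ℕ → Term} (h1 : φ.ok b σ) (h2 : φ.ok c τ)
    (h : ∀ z ∈ φ.fv, w (eq (σ z) (τ z))) : w (φ.inst b σ) ↔ w (φ.inst c τ) := by
  have := hw.th _ (hP.cong h1 h2)
  simp only [hw.imp, hw.iff, hw.eqs] at this
  exact this fun z hz => h z (by simpa using hz)

theorem h_bx (φ : Formula) (σ : ℕ → OT) :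
    (hStr hP hw).bx φ (fun z => hmk hP hw (σ z)) ↔ w ((box φ).inst (2 * ·) fun z => (σ z).1) := by
  change w ((box φ).inst (2 * ·) _) ↔ _
  exact h_congr hP hw (ok_OT (φ := box φ) fun z => Quotient.out (s := hSetoid hP hw) (hmk hP hw (σ z)))
    (ok_OT (φ := box φ) σ) fun z _ => hmk_out hP hw _

include hP hw in
theorem h_inst1 (φ : Formula) (σ : ℕ → OT) (x : ℕ) (t : OT) :
    P ((eq (Term.var (2 * x)) t.1).imp ((φ.inst (2 * ·) (Function.update (fun z => (σ z).1) x (Term.var (2 * x)))).iff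
      (φ.inst (2 * ·) (Function.update (fun z => (σ z).1) x t.1)))) := by
  have h1 : φ.ok (2 * ·) (Function.update (fun z => (σ z).1) x (Term.var (2 * x))) := by
    apply ok_even
    intro z y hy
    by_cases e : z = x
    · subst e; simp [Term.fv] at hy; exact .inr hy
    · simp only [Function.update_of_ne e] at hy; exact .inl ((σ z).2 y hy)
  have h2 : φ.ok (2 * ·) (Function.update (fun z => (σ z).1) x t.1) := by
    apply ok_even
    intro z y hy
    by_cases e : z = x
    · subst e; simp at hy; exact .inl (t.2 y hy)
    · simp only [Function.update_of_ne e] at hy; exact .inl ((σ z).2 y hy)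
  have h3 := hP.cong h1 h2
  refine hP.taut fun w hw => ?_
  have h3 := hw.th _ h3
  simp only [hw.imp, hw.iff, hw.eqs] at *
  intro a
  apply h3
  intro z _
  by_cases e : z = x
  · subst e; simpa using a
  · simpa [e] using hw.eqRefl hP _

theorem upd_OT (σ : ℕ → OT) (x : ℕ) (t : OT) :
    (fun z => (Function.update σ x t z).1) = Function.update (fun z => (σ z).1) x t.1 := by
  funext z
  by_cases e : z = x
  · subst e; simp
  · simp [e]

theorem upd_mk (σ : ℕ → OT) (x : ℕ) (t : OT) :
    Function.update (fun z => hmk hP hw (σ z)) x (hmk hP hw t) = fun z => hmk hP hw (Function.update σ x t z) := by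
  funext z
  by_cases e : z = x
  · subst e; simp
  · simp [e]

include hP in
theorem notall (x : ℕ) (A : Formula) : P ((all x A).neg.imp (ex x A.neg)) := by
  have h1 : P ((ex x A.neg).neg.imp (all x A)) := by
    apply hP.genImp
    · simp [fv]
    have := hP.exSelf x A.neg
    refine hP.taut fun w hw => ?_
    have := hw.th _ this
    simp only [hw.imp, hw.neg] at *
    tauto
  refine hP.taut fun w hw => ?_
  have := hw.th _ h1
  simp only [hw.imp, hw.neg] at *
  tauto

theorem truth (hH : ∀ z θ, w (ex z θ) → ∃ y, y % 2 = 1 ∧ w (ex z ((eq (Term.var y) (Term.var z)).and θ)))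
    (φ : Formula) (σ : ℕ → OT) :
    (hStr hP hw).Sat φ (fun z => hmk hP hw (σ z)) ↔ w (φ.inst (2 * ·) fun z => (σ z).1) := by
  -- existence in the valuation
  have key : ∀ (φ : Formula) (σ : ℕ → OT) (x : ℕ),
      w ((ex x φ).inst (2 * ·) fun z => (σ z).1) →
        ∃ t : OT, w (φ.inst (2 * ·) (Function.update (fun z => (σ z).1) x t.1)) := by
    intro φ σ x h
    obtain ⟨y, hy, h⟩ := hH _ _ h
    refine ⟨⟨Term.var y, by simpa [Term.fv] using hy⟩, ?_⟩
    refine hw.mp' ?_ h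
    apply hP.exImp
    · intro hc
      obtain ⟨z, hz, hc⟩ := fv_inst hc
      by_cases e : z = x
      · subst e; simp [Term.fv] at hc; omega
      · simp only [Function.update_of_ne e] at hc
        have := (σ z).2 _ hc
        omega
    have h1 := h_inst1 hP hw φ σ x ⟨Term.var y, by simpa [Term.fv] using hy⟩
    have h2 := hP.eqSymm (Term.var y) (Term.var (2 * x))
    refine hP.taut fun w hw => ?_
    have h1 := hw.th _ h1
    have h2 := hw.th _ h2
    simp only [hw.imp, hw.iff, hw.and] at *
    tauto
  have nb : ∀ (φ : Formula) (σ : ℕ → OT) (x : ℕ) (t : OT),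
      2 * x ∉ (φ.inst (2 * ·) (Function.update (fun z => (σ z).1) x t.1)).fv := by
    intro φ σ x t hc
    obtain ⟨z, hz, hc⟩ := fv_inst hc
    by_cases e : z = x
    · subst e
      simp only [Function.update_self] at hc
      have := t.2 _ hc
      omega
    · simp only [Function.update_of_ne e] at hc
      have := (σ z).2 _ hc
      omega
  induction φ generalizing σ with
  | falsum => simp [Str.Sat, inst, hw.falsum]
  | eq t u =>
    simp only [Str.Sat, h_ev, hmk_eq]
    rfl
  | le t u =>
    simp only [Str.Sat, h_ev]
    exact hw.eqLe hP (hmk_out hP hw _) (hmk_out hP hw _)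
  | and φ ψ h1 h2 => simp only [Str.Sat, h1, h2, inst, hw.and]
  | or φ ψ h1 h2 => simp only [Str.Sat, h1, h2, inst, hw.or]
  | imp φ ψ h1 h2 => simp only [Str.Sat, h1, h2, inst, hw.imp]
  | neg φ h1 => simp only [Str.Sat, h1, inst, hw.neg]
  | box φ h1 => exact h_bx hP hw φ σ
  | ex x φ h1 =>
    constructor
    · rintro ⟨a, ha⟩
      obtain ⟨t, rfl⟩ : ∃ t, hmk hP hw t = a := Quotient.exists_rep a
      rw [upd_mk] at ha
      replace ha := (h1 _).1 ha
      rw [upd_OT] at ha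
      refine hw.mp' ?_ ha
      apply hP.elimEq (x := 2 * x) (t := t.1)
      · intro hc
        have := t.2 _ hc
        omega
      · simp only [fv, Finset.mem_union, not_or]
        exact ⟨nb φ σ x t, by simp [inst, fv]⟩
      have h1 := h_inst1 hP hw φ σ x t
      have h2 := hP.exSelf (2 * x) (φ.inst (2 * ·) (Function.update (fun z => (σ z).1) x (Term.var (2 * x))))
      refine hP.taut fun w hw => ?_
      have h1 := hw.th _ h1
      have h2 := hw.th _ h2
      simp only [hw.imp, hw.iff, inst] at *
      tauto
    · intro h
      obtain ⟨t, ht⟩ := key φ σ x h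
      refine ⟨hmk hP hw t, ?_⟩
      rw [upd_mk]
      refine (h1 _).2 ?_
      rw [upd_OT]
      exact ht
  | all x φ h1 =>
    constructor
    · intro h
      by_contra hc
      rw [← hw.neg] at hc
      have h2 := hw.mp' (notall hP _ _) hc
      obtain ⟨t, ht⟩ := key φ.neg σ x h2
      simp only [inst, hw.neg] at ht
      apply ht
      have := h (hmk hP hw t)
      rw [upd_mk] at this
      replace this := (h1 _).1 this
      rwa [upd_OT] at this
    · intro h a
      obtain ⟨t, rfl⟩ : ∃ t, hmk hP hw t = a := Quotient.exists_rep a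
      rw [upd_mk]
      refine (h1 _).2 ?_
      rw [upd_OT]
      refine hw.mp' ?_ h
      apply hP.elimEq (x := 2 * x) (t := t.1)
      · intro hc
        have := t.2 _ hc
        omega
      · simp only [fv, Finset.mem_union, not_or]
        exact ⟨by simp [inst, fv], nb φ σ x t⟩
      have h1 := h_inst1 hP hw φ σ x t
      have h2 := hP.allSelf (2 * x) (φ.inst (2 * ·) (Function.update (fun z => (σ z).1) x (Term.var (2 * x))))
      refine hP.taut fun w hw => ?_
      have h1 := hw.th _ h1
      have h2 := hw.th _ h2
      simp only [hw.imp, hw.iff, inst] at *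
      tauto

end Henkin

/-- Completeness. -/
theorem completeness {T : Set Formula} (hT : Extends T PAK) {χ : Formula}
    (h : ∀ (A : Mdl T) v, A.Sat χ v) : Provable T χ := by
  have hP := Provable.lg hT
  have hok : χ.ok (2 * ·) (fun z => Term.var (2 * z + 1)) := by
    apply ok_even
    intro z y hy
    simp [Term.fv] at hy
    omega
  apply hP.of_instance hok (fun a b h => by simpa using h)
  by_contra hc
  obtain ⟨w, hw, hn, hH⟩ := exists_henkin hP hc
  have ht := truth hP hw hH
  have rep : ∀ v : ℕ → (hStr hP hw).M, ∃ σ : ℕ → OT, v = fun z => hmk hP hw (σ z) := by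
    intro v
    have : ∀ z, ∃ t, v z = hmk hP hw t := fun z => by
      obtain ⟨t, ht⟩ := Quotient.exists_rep (v z)
      exact ⟨t, ht.symm⟩
    choose σ hσ using this
    exact ⟨σ, funext hσ⟩
  let A : Mdl T :=
    { toStr := hStr hP hw
      sound := by
        intro χ hχ v
        obtain ⟨σ, rfl⟩ := rep v
        rw [ht]
        exact hw.th _ (hP.instance_of (ok_OT σ) hχ)
      bx_subst := by
        intro φ τ hk v
        obtain ⟨σ, rfl⟩ := rep v
        simp only [h_ev]
        rw [h_bx, h_bx]
        simp only [inst]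
        rw [inst_substAll hk]
        rfl
      bx_congr := by
        intro φ v v' h
        change w (box _) → w (box _)
        rw [inst_congr (τ := fun z => (v' z).out.1)]
        · exact id
        · intro z hz
          rw [h z hz] }
  apply hn
  have := h A (fun z => hmk hP hw ⟨Term.var (2 * z + 1), by simp [Term.fv]⟩)
  exact (ht χ (fun z => ⟨Term.var (2 * z + 1), by simp [Term.fv]⟩)).1 this

end ModalArith

namespace ModalArith

open Formula

theorem Str.ev_congr (A : Str) {t : Term} {v v' : ℕ → A.M} (h : ∀ z ∈ t.fv, v z = v' z) :
    A.ev t v = A.ev t v' := by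
  unfold Str.ev
  induction t with
  | var x => exact h x (by simp [Term.fv])
  | zero => rfl
  | succ t ih => simp only [Term.evl]; rw [ih h]
  | add t u h1 h2 | mul t u h1 h2 =>
    simp only [Term.evl]
    rw [h1 fun z hz => h z (by simp [Term.fv, hz]), h2 fun z hz => h z (by simp [Term.fv, hz])]

theorem Str.ev_substAll (A : Str) (t : Term) (τ : ℕ → Term) (v : ℕ → A.M) :
    A.ev (t.substAll τ) v = A.ev t (fun z => A.ev (τ z) v) := by
  unfold Str.ev
  induction t with
  | var x => rfl
  | zero => rfl
  | succ t ih => simp only [Term.evl, Term.substAll]; rw [ih]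
  | add t u h1 h2 | mul t u h1 h2 => simp only [Term.evl, Term.substAll]; rw [h1, h2]

namespace Mdl
variable {T : Set Formula} (A : Mdl T)

theorem Sat_congr {φ : Formula} {v v' : ℕ → A.M} (h : ∀ z ∈ φ.fv, v z = v' z) :
    A.Sat φ v ↔ A.Sat φ v' := by
  induction φ generalizing v v' with
  | falsum => rfl
  | eq t u | le t u =>
    simp only [Str.Sat]
    rw [A.ev_congr fun z hz => h z (by simp [fv, hz]), A.ev_congr (t := u) fun z hz => h z (by simp [fv, hz])]
  | and φ ψ h1 h2 | or φ ψ h1 h2 | imp φ ψ h1 h2 =>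
    simp only [Str.Sat]
    rw [h1 fun z hz => h z (by simp [fv, hz]), h2 fun z hz => h z (by simp [fv, hz])]
  | neg φ h1 => simp only [Str.Sat]; rw [h1 h]
  | box φ h1 => exact ⟨A.bx_congr φ _ _ h, A.bx_congr φ _ _ fun z hz => (h z hz).symm⟩
  | all x φ h1 | ex x φ h1 =>
    simp only [Str.Sat]
    have : ∀ a, A.Sat φ (Function.update v x a) ↔ A.Sat φ (Function.update v' x a) := by
      intro a
      apply h1
      intro z hz
      by_cases e : z = x
      · subst e; simp
      · simp only [Function.update_of_ne e]
        exact h z (by simp [fv, e, hz])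
    simp only [this]

theorem Sat_update {φ : Formula} {v : ℕ → A.M} {x : ℕ} (h : x ∉ φ.fv) (a : A.M) :
    A.Sat φ (Function.update v x a) ↔ A.Sat φ v := by
  apply A.Sat_congr
  intro z hz
  have : z ≠ x := by rintro rfl; exact h hz
  simp [this]

theorem Sat_substAll {φ : Formula} {τ : ℕ → Term} (h : φ.ok id τ) (v : ℕ → A.M) :
    A.Sat (φ.substAll τ) v ↔ A.Sat φ (fun z => A.ev (τ z) v) := by
  induction φ generalizing τ v with
  | falsum => rfl
  | eq t u | le t u => simp only [substAll, Str.Sat, Str.ev_substAll]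
  | and φ ψ h1 h2 | or φ ψ h1 h2 | imp φ ψ h1 h2 =>
    simp only [substAll, Str.Sat]
    rw [h1 h.1, h2 h.2]
  | neg φ h1 => simp only [substAll, Str.Sat]; rw [h1 h]
  | box φ h1 => exact A.bx_subst φ τ h v
  | all x φ h1 | ex x φ h1 =>
    simp only [substAll, Str.Sat]
    have : ∀ a, A.Sat (φ.substAll (Function.update τ x (Term.var x))) (Function.update v x a) ↔
        A.Sat φ (Function.update (fun z => A.ev (τ z) v) x a) := by
      intro a
      have h2 := h.2
      simp only [id] at h2
      rw [h1 h2]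
      apply A.Sat_congr
      intro z hz
      by_cases e : z = x
      · subst e; simp [Str.ev, Term.evl]
      · simp only [Function.update_of_ne e]
        apply A.ev_congr
        intro y hy
        have : y ≠ x := by rintro rfl; exact h.1 z hz e hy
        simp [this]
    simp only [this]

theorem Sat_subst {φ : Formula} {x : ℕ} {t : Term} (h : φ.freeFor t x) (v : ℕ → A.M) :
    A.Sat (φ.subst x t) v ↔ A.Sat φ (Function.update v x (A.ev t v)) := by
  unfold Formula.subst
  rw [A.Sat_substAll (ok_of_freeFor h)]
  apply iff_of_eq
  congr 1
  funext z
  by_cases e : z = x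
  · subst e; simp
  · simp [e, Str.ev, Term.evl]

variable [hT : Fact (Extends T PAK)]

theorem base {φ : Formula} (h : φ ∈ baseAxioms) (v : ℕ → A.M) : A.Sat φ v :=
  A.sound _ (Provable.base hT.out h) v

theorem ind (φ : Formula) (x : ℕ) (v : ℕ → A.M) (h0 : A.Sat φ (Function.update v x A.zero))
    (h1 : ∀ a, A.Sat φ (Function.update v x a) → A.Sat φ (Function.update v x (A.succ a))) (a : A.M) :
    A.Sat φ (Function.update v x a) := by
  have := A.sound _ (Provable.ind hT.out (φ := φ) (x := x) rfl rfl) v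
  refine this ⟨?_, ?_⟩ a
  · rw [A.Sat_subst (freeFor_self x φ (by simp [Term.fv]))]
    exact h0
  · intro a ha
    rw [A.Sat_subst (freeFor_self x φ (by simp [Term.fv]))]
    simp only [Str.ev, Term.evl, Function.update_self, Function.update_idem]
    exact h1 a ha

def vv (A : Mdl T) (a b c : A.M) : ℕ → A.M
  | 0 => a
  | 1 => b
  | 2 => c
  | _ => A.zero

theorem ax_sz (a : A.M) : A.succ a ≠ A.zero := A.base (φ := succNeZero) (by simp [baseAxioms]) (A.vv a a a)
theorem ax_si {a b : A.M} (h : A.succ a = A.succ b) : a = b :=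
  A.base (φ := succInj) (by simp [baseAxioms]) (A.vv a b a) h
theorem ax_a0 (a : A.M) : A.add a A.zero = a := A.base (φ := addZero) (by simp [baseAxioms]) (A.vv a a a)
theorem ax_as (a b : A.M) : A.add a (A.succ b) = A.succ (A.add a b) :=
  A.base (φ := addSucc) (by simp [baseAxioms]) (A.vv a b a)
theorem ax_m0 (a : A.M) : A.mul a A.zero = A.zero := A.base (φ := mulZero) (by simp [baseAxioms]) (A.vv a a a)
theorem ax_ms (a b : A.M) : A.mul a (A.succ b) = A.add (A.mul a b) a :=
  A.base (φ := mulSucc) (by simp [baseAxioms]) (A.vv a b a)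
theorem ax_le (a b : A.M) : A.le a b ↔ ∃ c, A.add a c = b := by
  have := A.base (φ := leDef) (by simp [baseAxioms]) (A.vv a b a)
  simp only [leDef, Formula.iff, Str.Sat, Str.ev, Term.evl] at this
  exact ⟨this.1, this.2⟩

/-- Induction for equations in three variables, on variable 0. -/
theorem indEq (s t : Term) (b c : A.M) (h0 : A.ev s (A.vv A.zero b c) = A.ev t (A.vv A.zero b c))
    (h1 : ∀ a, A.ev s (A.vv a b c) = A.ev t (A.vv a b c) →
      A.ev s (A.vv (A.succ a) b c) = A.ev t (A.vv (A.succ a) b c)) (a : A.M) :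
    A.ev s (A.vv a b c) = A.ev t (A.vv a b c) := by
  have e : ∀ a', Function.update (A.vv a b c) 0 a' = A.vv a' b c := by
    intro a'
    funext z
    match z with
    | 0 => simp [vv]
    | 1 => simp [vv]
    | 2 => simp [vv]
    | n + 3 => simp [vv]
  have := A.ind (eq s t) 0 (A.vv a b c) (by rw [e]; exact h0) (by
    intro a'
    rw [e, e]; exact h1 a') a
  rwa [e] at this

open Term in
theorem p_zero_add (a : A.M) : A.add A.zero a = a :=
  A.indEq (add zero (var 0)) (var 0) a a (by simp [Str.ev, evl, vv, ax_a0])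
    (by intro a h; simp_all [Str.ev, evl, vv, ax_as]) a

open Term in
theorem p_succ_add (a b : A.M) : A.add (A.succ a) b = A.succ (A.add a b) :=
  A.indEq (add (succ (var 1)) (var 0)) (succ (add (var 1) (var 0))) a a (by simp [Str.ev, evl, vv, ax_a0])
    (by intro a h; simp_all [Str.ev, evl, vv, ax_as]) b

open Term in
theorem p_add_comm (a b : A.M) : A.add a b = A.add b a :=
  A.indEq (add (var 0) (var 1)) (add (var 1) (var 0)) b b (by simp [Str.ev, evl, vv, ax_a0, p_zero_add])
    (by intro a h; simp_all [Str.ev, evl, vv, ax_as, p_succ_add]) a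

open Term in
theorem p_add_assoc (a b c : A.M) : A.add (A.add a b) c = A.add a (A.add b c) :=
  A.indEq (add (add (var 1) (var 2)) (var 0)) (add (var 1) (add (var 2) (var 0))) a b (by simp [Str.ev, evl, vv, ax_a0])
    (by intro a h; simp_all [Str.ev, evl, vv, ax_as]) c

instance : Zero A.M := ⟨A.zero⟩
instance : Add A.M := ⟨A.add⟩
instance : AddCommMonoid A.M where
  add_assoc := A.p_add_assoc
  zero_add := A.p_zero_add
  add_zero := A.ax_a0
  add_comm := A.p_add_comm
  nsmul := nsmulRec

instance : Mul A.M := ⟨A.mul⟩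
instance : One A.M := ⟨A.succ A.zero⟩

theorem succ_eq (a : A.M) : A.succ a = a + 1 := by
  change _ = A.add a (A.succ A.zero)
  rw [ax_as, ax_a0]
theorem add_eq (a b : A.M) : A.add a b = a + b := rfl
theorem mul_eq (a b : A.M) : A.mul a b = a * b := rfl
theorem zero_eq : A.zero = 0 := rfl
theorem p_mul_zero (a : A.M) : a * 0 = 0 := A.ax_m0 a
theorem p_mul_succ (a b : A.M) : a * (b + 1) = a * b + a := by
  rw [← succ_eq]; exact A.ax_ms a b

open Term in
theorem p_zero_mul (a : A.M) : 0 * a = 0 :=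
  A.indEq (mul zero (var 0)) zero a a (A.ax_m0 _) (by
    intro a h
    simp only [Str.ev, evl, vv, succ_eq, mul_eq, zero_eq] at *
    rw [p_mul_succ, h, add_zero]) a

open Term in
theorem p_succ_mul (a b : A.M) : (a + 1) * b = a * b + b := by
  rw [← succ_eq]
  refine A.indEq (mul (succ (var 1)) (var 0)) (add (mul (var 1) (var 0)) (var 0)) a a ?_ ?_ b
  · simp only [Str.ev, evl, vv, succ_eq, mul_eq, zero_eq, add_eq]
    simp only [p_mul_zero, add_zero]
  · intro b h
    simp only [Str.ev, evl, vv, succ_eq, mul_eq, add_eq] at *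
    rw [p_mul_succ, h, p_mul_succ]
    abel

open Term in
theorem p_mul_comm (a b : A.M) : a * b = b * a := by
  refine A.indEq (mul (var 0) (var 1)) (mul (var 1) (var 0)) b b ?_ ?_ a
  · simp only [Str.ev, evl, vv, mul_eq, zero_eq]
    rw [p_mul_zero, p_zero_mul]
  · intro b h
    simp only [Str.ev, evl, vv, succ_eq, mul_eq] at *
    rw [p_mul_succ, p_succ_mul, h]

open Term in
theorem p_mul_add (a b c : A.M) : a * (b + c) = a * b + a * c := by
  refine A.indEq (mul (var 1) (add (var 2) (var 0))) (add (mul (var 1) (var 2)) (mul (var 1) (var 0))) a b ?_ ?_ c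
  · simp only [Str.ev, evl, vv, mul_eq, zero_eq, add_eq]
    rw [p_mul_zero, add_zero, add_zero]
  · intro c h
    simp only [Str.ev, evl, vv, succ_eq, mul_eq, add_eq] at *
    rw [← add_assoc, p_mul_succ, p_mul_succ, h, add_assoc]

open Term in
theorem p_mul_assoc (a b c : A.M) : a * b * c = a * (b * c) := by
  refine A.indEq (mul (mul (var 1) (var 2)) (var 0)) (mul (var 1) (mul (var 2) (var 0))) a b ?_ ?_ c
  · simp only [Str.ev, evl, vv, mul_eq, zero_eq]
    rw [p_mul_zero, p_mul_zero, p_mul_zero]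
  · intro c h
    simp only [Str.ev, evl, vv, succ_eq, mul_eq] at *
    rw [p_mul_succ, p_mul_succ, p_mul_add, h]

instance : CommSemiring A.M where
  mul_assoc := A.p_mul_assoc
  one_mul a := by
    have := A.p_succ_mul 0 a
    rwa [zero_add, p_zero_mul, zero_add] at this
  mul_one a := by
    have := A.p_mul_succ a 0
    rwa [zero_add, p_mul_zero, zero_add] at this
  zero_mul := A.p_zero_mul
  mul_zero := A.p_mul_zero
  mul_comm := A.p_mul_comm
  left_distrib := A.p_mul_add
  right_distrib a b c := by rw [A.p_mul_comm, A.p_mul_add, A.p_mul_comm a, A.p_mul_comm b]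

@[simp] theorem ev_var (x : ℕ) (v : ℕ → A.M) : A.ev (.var x) v = v x := rfl
@[simp] theorem ev_zero (v : ℕ → A.M) : A.ev .zero v = 0 := rfl
@[simp] theorem ev_succ (t : Term) (v : ℕ → A.M) : A.ev (.succ t) v = A.ev t v + 1 := A.succ_eq _
@[simp] theorem ev_add (t u : Term) (v : ℕ → A.M) : A.ev (.add t u) v = A.ev t v + A.ev u v := rfl
@[simp] theorem ev_mul (t u : Term) (v : ℕ → A.M) : A.ev (.mul t u) v = A.ev t v * A.ev u v := rfl

@[simp] theorem ev_numeral (n : ℕ) (v : ℕ → A.M) : A.ev (.numeral n) v = (n : A.M) := by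
  induction n with
  | zero => simp [Term.numeral]
  | succ n ih => simp [Term.numeral, ih]

/-- Induction in the model. -/
theorem induct (φ : Formula) (x : ℕ) (v : ℕ → A.M) (h0 : A.Sat φ (Function.update v x 0))
    (h1 : ∀ a, A.Sat φ (Function.update v x a) → A.Sat φ (Function.update v x (a + 1))) (a : A.M) :
    A.Sat φ (Function.update v x a) :=
  A.ind φ x v h0 (fun a h => by rw [succ_eq]; exact h1 a h) a

theorem p_add_cancel {a b : A.M} (c : A.M) (h : a + c = b + c) : a = b := by
  have := A.induct ((eq (.add (.var 1) (.var 0)) (.add (.var 2) (.var 0))).imp (eq (.var 1) (.var 2))) 0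
    (A.vv 0 a b) (by simp [Str.Sat, vv]) (by
      intro c h
      intro h'
      simp only [Str.Sat, ev_add, ev_var, Function.update_self, ne_eq, one_ne_zero, not_false_eq_true,
        Function.update_of_ne, OfNat.ofNat_ne_zero] at h h' ⊢
      rw [← add_assoc, ← add_assoc] at h'
      exact h (A.ax_si ((A.succ_eq _).trans (h'.trans (A.succ_eq _).symm)))) c
  simp only [Str.Sat, ev_add, ev_var, Function.update_self] at this
  exact this h

theorem zero_or_succ (a : A.M) : a = 0 ∨ ∃ b, a = b + 1 := by
  have := A.induct ((eq (.var 0) .zero).or (ex 1 (eq (.var 0) (.succ (.var 1))))) 0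
    (A.vv 0 0 0) (by simp [Str.Sat]) (by
      intro c _
      right
      exact ⟨c, by simp [Str.Sat]⟩) a
  simpa [Str.Sat] using this

theorem succ_ne (a : A.M) : a + 1 ≠ 0 := by rw [← succ_eq]; exact A.ax_sz a

theorem p_add_eq_zero {a b : A.M} (h : a + b = 0) : a = 0 := by
  rcases A.zero_or_succ b with rfl | ⟨c, rfl⟩
  · simpa using h
  · rw [← add_assoc] at h
    exact absurd h (A.succ_ne _)

theorem p_total (a b : A.M) : (∃ c, a + c = b) ∨ ∃ c, b + c = a := by
  have := A.induct ((ex 2 (eq (.add (.var 0) (.var 2)) (.var 1))).or (ex 2 (eq (.add (.var 1) (.var 2)) (.var 0)))) 0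
    (A.vv 0 b 0) (by simp [Str.Sat]) (by
      intro c h
      simp [Str.Sat] at h ⊢
      rcases h with ⟨d, h⟩ | ⟨d, h⟩
      · rcases A.zero_or_succ d with rfl | ⟨d, rfl⟩
        · right
          refine ⟨1, ?_⟩
          rw [← h]; simp
        · left
          refine ⟨d, ?_⟩
          rw [← h]; ring
      · right
        refine ⟨d + 1, ?_⟩
        rw [← h]; ring) a
  simpa [Str.Sat, vv] using this

noncomputable instance : LinearOrder A.M where
  le a b := A.le a b
  lt a b := A.le a b ∧ ¬ A.le b a
  le_refl a := (A.ax_le _ _).2 ⟨0, A.ax_a0 a⟩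
  le_trans a b c h1 h2 := by
    rw [A.ax_le] at *
    obtain ⟨d, rfl⟩ := h1
    obtain ⟨e, rfl⟩ := h2
    exact ⟨d + e, (A.p_add_assoc _ _ _).symm⟩
  lt_iff_le_not_ge a b := Iff.rfl
  le_antisymm a b h1 h2 := by
    rw [A.ax_le] at *
    obtain ⟨d, rfl⟩ := h1
    obtain ⟨e, h⟩ := h2
    simp only [add_eq] at *
    have h3 : (d + e) + a = 0 + a := by
      calc (d + e) + a = a + d + e := by abel
        _ = a := h
        _ = 0 + a := (zero_add a).symm
    have := A.p_add_eq_zero (A.p_add_cancel _ h3)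
    rw [this, add_zero]
  le_total a b := by
    rw [A.ax_le, A.ax_le]
    exact A.p_total a b
  toDecidableLE := Classical.decRel _

theorem le_def (a b : A.M) : a ≤ b ↔ ∃ c, a + c = b := A.ax_le a b
@[simp] theorem le_eq (a b : A.M) : A.le a b ↔ a ≤ b := Iff.rfl

instance : CanonicallyOrderedAdd A.M where
  exists_add_of_le {a b} h := by
    obtain ⟨c, rfl⟩ := (A.le_def _ _).1 h
    exact ⟨c, rfl⟩
  le_add_self a b := (A.le_def _ _).2 ⟨b, add_comm _ _⟩
  le_self_add a b := (A.le_def _ _).2 ⟨b, rfl⟩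

theorem p_mul_ne {a b : A.M} (ha : a ≠ 0) (hb : b ≠ 0) : a * b ≠ 0 := by
  rcases A.zero_or_succ a with rfl | ⟨c, rfl⟩
  · exact absurd rfl ha
  rcases A.zero_or_succ b with rfl | ⟨d, rfl⟩
  · exact absurd rfl hb
  intro h
  apply A.succ_ne (c * d + c + d)
  rw [← h]; ring

instance : IsOrderedCancelAddMonoid A.M where
  add_le_add_left a b h c := by
    obtain ⟨d, rfl⟩ := (A.le_def _ _).1 h
    exact (A.le_def _ _).2 ⟨d, by ring⟩
  le_of_add_le_add_left a b c h := by
    obtain ⟨d, h⟩ := (A.le_def _ _).1 h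
    refine (A.le_def _ _).2 ⟨d, A.p_add_cancel a ?_⟩
    rw [add_comm c a, ← h]; ring

instance : Nontrivial A.M := ⟨⟨0, 1, fun h => A.succ_ne 0 (by rw [zero_add, ← h])⟩⟩

theorem p_mul_lt {a b c : A.M} (hc : 0 < c) (h : a < b) : c * a < c * b := by
  obtain ⟨d, rfl⟩ := (A.le_def _ _).1 h.le
  have hd : d ≠ 0 := by rintro rfl; simp at h
  rw [mul_add]
  exact lt_add_of_pos_right _ (pos_iff_ne_zero.2 (A.p_mul_ne hc.ne' hd))

instance : IsStrictOrderedRing A.M where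
  zero_le_one := zero_le
  mul_lt_mul_of_pos_left a h b c hbc := A.p_mul_lt h hbc
  mul_lt_mul_of_pos_right a h b c hbc := by
    rw [mul_comm b, mul_comm c]; exact A.p_mul_lt h hbc

theorem lt_iff (a b : A.M) : a < b ↔ a + 1 ≤ b := by
  constructor
  · intro h
    obtain ⟨d, rfl⟩ := (A.le_def _ _).1 h.le
    rcases A.zero_or_succ d with rfl | ⟨d, rfl⟩
    · simp at h
    · exact (A.le_def _ _).2 ⟨d, by ring⟩
  · intro h
    exact lt_of_lt_of_le (lt_add_of_pos_right _ zero_lt_one) h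

theorem lt_succ (a b : A.M) : a < b + 1 ↔ a ≤ b := by
  rw [lt_iff, add_le_add_iff_right]

end Mdl

end ModalArith

namespace ModalArith

open Formula

def fr (s : Finset ℕ) : ℕ := s.sup id + 1

theorem lt_fr {s : Finset ℕ} {z : ℕ} (h : z ∈ s) : z < fr s :=
  Nat.lt_succ_of_le (Finset.le_sup (f := id) h)

namespace Mdl
variable {T : Set Formula} (A : Mdl T)

variable [hT : Fact (Extends T PAK)]

theorem Sat_falsum (v : ℕ → A.M) : A.Sat falsum v ↔ False := Iff.rfl
theorem Sat_eq (t u : Term) (v : ℕ → A.M) : A.Sat (eq t u) v ↔ A.ev t v = A.ev u v := Iff.rfl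
theorem Sat_le (t u : Term) (v : ℕ → A.M) : A.Sat (le t u) v ↔ A.ev t v ≤ A.ev u v := Iff.rfl
theorem Sat_and (φ ψ : Formula) (v : ℕ → A.M) : A.Sat (φ.and ψ) v ↔ A.Sat φ v ∧ A.Sat ψ v := Iff.rfl
theorem Sat_or (φ ψ : Formula) (v : ℕ → A.M) : A.Sat (φ.or ψ) v ↔ A.Sat φ v ∨ A.Sat ψ v := Iff.rfl
theorem Sat_imp (φ ψ : Formula) (v : ℕ → A.M) : A.Sat (φ.imp ψ) v ↔ (A.Sat φ v → A.Sat ψ v) := Iff.rfl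
theorem Sat_neg (φ : Formula) (v : ℕ → A.M) : A.Sat φ.neg v ↔ ¬ A.Sat φ v := Iff.rfl
theorem Sat_all (x : ℕ) (φ : Formula) (v : ℕ → A.M) :
    A.Sat (all x φ) v ↔ ∀ a, A.Sat φ (Function.update v x a) := Iff.rfl
theorem Sat_ex (x : ℕ) (φ : Formula) (v : ℕ → A.M) :
    A.Sat (ex x φ) v ↔ ∃ a, A.Sat φ (Function.update v x a) := Iff.rfl
theorem Sat_lt (t u : Term) (v : ℕ → A.M) : A.Sat (lt t u) v ↔ A.ev t v < A.ev u v := by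
  rw [lt, Sat_le, ev_succ, lt_iff]
theorem Sat_iff (φ ψ : Formula) (v : ℕ → A.M) : A.Sat (φ.iff ψ) v ↔ (A.Sat φ v ↔ A.Sat ψ v) := by
  rw [Formula.iff, Sat_and, Sat_imp, Sat_imp]; exact ⟨fun h => ⟨h.1, h.2⟩, fun h => ⟨h.1, h.2⟩⟩

theorem ev_update {t : Term} {x : ℕ} (h : x ∉ t.fv) (v : ℕ → A.M) (a : A.M) :
    A.ev t (Function.update v x a) = A.ev t v := by
  apply A.ev_congr
  intro z hz
  have : z ≠ x := by rintro rfl; exact h hz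
  simp [this]

theorem Sat_ball {x : ℕ} {t : Term} (h : x ∉ t.fv) (φ : Formula) (v : ℕ → A.M) :
    A.Sat (ball x t φ) v ↔ ∀ a < A.ev t v, A.Sat φ (Function.update v x a) := by
  rw [ball, Sat_all]
  simp only [Sat_imp, Sat_lt, ev_var, Function.update_self, A.ev_update h]
theorem Sat_bex {x : ℕ} {t : Term} (h : x ∉ t.fv) (φ : Formula) (v : ℕ → A.M) :
    A.Sat (bex x t φ) v ↔ ∃ a < A.ev t v, A.Sat φ (Function.update v x a) := by
  rw [bex, Sat_ex]
  simp only [Sat_and, Sat_lt, ev_var, Function.update_self, A.ev_update h]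

/-- Strong form: least number principle. -/
theorem lnp (φ : Formula) (x : ℕ) (v : ℕ → A.M) {a : A.M} (h : A.Sat φ (Function.update v x a)) :
    ∃ b, A.Sat φ (Function.update v x b) ∧ ∀ c < b, ¬ A.Sat φ (Function.update v x c) := by
  by_contra hc
  push Not at hc
  set k := fr (insert x φ.fv) with hk
  have hx : x < k := lt_fr (by simp)
  have hf : k ∉ φ.fv := fun h => absurd (lt_fr (s := insert x φ.fv) (z := k) (by simp [h])) (by omega)
  have hxk : x ≠ k := hx.ne
  have e : ∀ N, A.Sat (ball x (.var k) φ.neg) (Function.update v k N) ↔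
      ∀ a < N, ¬ A.Sat φ (Function.update v x a) := by
    intro N
    rw [A.Sat_ball (by simpa [Term.fv] using hxk)]
    simp only [ev_var, Function.update_self, Sat_neg]
    simp only [Function.update_comm hxk.symm, A.Sat_update hf]
  have := A.induct (ball x (.var k) φ.neg) k v (by rw [e]; intro a ha; exact absurd ha not_lt_zero) (by
    intro N
    rw [e, e]
    intro h a ha hs
    rcases lt_or_eq_of_le ((A.lt_succ _ _).1 ha) with h1 | rfl
    · exact h a h1 hs
    · obtain ⟨c, h2, h3⟩ := hc a hs
      exact h c h2 h3) (a + 1)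
  rw [e] at this
  exact this a ((A.lt_succ _ _).2 le_rfl) h

theorem exists_lcm (N : A.M) : ∃ u, u ≠ 0 ∧ ∀ d, d ≠ 0 → d ≤ N → d ∣ u := by
  have := A.induct (ex 1 ((neg (eq (.var 1) .zero)).and (all 2 ((neg (eq (.var 2) .zero)).imp
    ((le (.var 2) (.var 0)).imp (ex 3 (eq (.var 1) (.mul (.var 2) (.var 3))))))))) 0 (fun _ => 0)
    (by
      simp [Sat_ex, Sat_and, Sat_neg, Sat_all, Sat_imp, Sat_eq, Sat_le]
      exact ⟨1, one_ne_zero, fun a h h' => absurd h' h⟩) (by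
      intro N h
      simp [Sat_ex, Sat_and, Sat_neg, Sat_all, Sat_imp, Sat_eq, Sat_le] at h ⊢
      obtain ⟨u, h0, h⟩ := h
      refine ⟨u * (N + 1), mul_ne_zero h0 (A.succ_ne _), ?_⟩
      intro d hd hdN
      rcases lt_or_eq_of_le hdN with h1 | rfl
      · obtain ⟨e, rfl⟩ := h d hd ((A.lt_succ _ _).1 h1)
        exact ⟨e * (N + 1), by ring⟩
      · exact ⟨u, by ring⟩) N
  simpa [Sat_ex, Sat_and, Sat_neg, Sat_all, Sat_imp, Sat_eq, Sat_le, dvd_def] using this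

theorem dvd_of_add {p a b : A.M} (h1 : p ∣ a + b) (h2 : p ∣ b) : p ∣ a := by
  obtain ⟨d, hd⟩ := h1
  obtain ⟨e, rfl⟩ := h2
  by_cases hp : p = 0
  · subst hp
    simp at hd; simp [hd]
  have hle : e ≤ d := by
    by_contra hc
    push Not at hc
    have := A.p_mul_lt (pos_iff_ne_zero.2 hp) hc
    rw [← hd] at this
    exact absurd this (not_lt.2 (le_add_self))
  obtain ⟨f, rfl⟩ := (A.le_def _ _).1 hle
  refine ⟨f, A.p_add_cancel (p * e) ?_⟩
  rw [hd]; ring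

theorem dvd_cop {X u s : A.M} (h : 1 + s * u ∣ X * u) : 1 + s * u ∣ X := by
  apply A.dvd_of_add (b := s * (X * u))
  · exact ⟨X, by ring⟩
  · exact h.mul_left s

theorem dvd_key {q u a d : A.M} (hd : d ∣ u) (h : 1 + (a + 1) * u ∣ q * (d * u)) : 1 + (a + 1) * u ∣ q := by
  obtain ⟨e, he⟩ := hd
  apply A.dvd_cop
  apply A.dvd_cop
  refine dvd_trans h ⟨e, ?_⟩
  nth_rewrite 1 [he]
  ring

theorem dvd_key2 {q u a n N : A.M} (hu : ∀ d, d ≠ 0 → d ≤ N → d ∣ u) (ha : a < N) (hn : n < N) (hne : a ≠ n)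
    (h : 1 + (a + 1) * u ∣ q * (1 + (n + 1) * u)) : 1 + (a + 1) * u ∣ q := by
  rcases lt_or_gt_of_ne hne with h1 | h1
  · obtain ⟨d, rfl⟩ := (A.le_def _ _).1 h1.le
    have hd : d ∣ u := hu d (by rintro rfl; simp at h1) (le_trans le_add_self hn.le)
    apply A.dvd_key hd
    apply A.dvd_of_add (b := q * (1 + (a + 1) * u))
    · convert h using 1; ring
    · exact Dvd.intro_left q rfl
  · obtain ⟨d, rfl⟩ := (A.le_def _ _).1 h1.le
    have hd : d ∣ u := hu d (by rintro rfl; simp at h1) (le_trans le_add_self ha.le)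
    apply A.dvd_key hd
    apply A.dvd_of_add (b := q * (1 + (n + 1) * u))
    · exact ⟨q, by ring⟩
    · exact h

theorem comprehension (φ : Formula) (c : ℕ) (v : ℕ → A.M) (N : A.M) :
    ∃ u q : A.M, ∀ a < N, (1 + (a + 1) * u ∣ q ↔ A.Sat φ (Function.update v c a)) := by
  obtain ⟨u, hu0, hu⟩ := A.exists_lcm N
  set k := fr (insert c φ.fv) with hk
  have hx : c < k := lt_fr (by simp)
  have hf : ∀ z ∈ φ.fv, z < k := fun z h => lt_fr (s := insert c φ.fv) (by simp [h])
  have hx0 : c ≠ k := by omega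
  have hx1 : c ≠ k + 1 := by omega
  have hx2 : c ≠ k + 2 := by omega
  have hx3 : c ≠ k + 3 := by omega
  have hx4 : c ≠ k + 4 := by omega
  let Φ := ex (k+1) (all c ((lt (.var c) (.var (k+2))).imp (Formula.iff
    (ex (k+4) (eq (.var (k+1)) (.mul (.add (.succ .zero) (.mul (.succ (.var c)) (.var (k+3)))) (.var (k+4)))))
    ((lt (.var c) (.var k)).and φ))))
  have e : ∀ n, A.Sat Φ (Function.update (Function.update (Function.update v (k+2) N) (k+3) u) k n) ↔
      ∃ q, ∀ a < N, (1 + (a + 1) * u ∣ q ↔ (a < n ∧ A.Sat φ (Function.update v c a))) := by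
    intro n
    have : ∀ q a, A.Sat φ (Function.update (Function.update (Function.update (Function.update (Function.update v (k+2) N) (k+3) u) k n) (k+1) q) c a) ↔ A.Sat φ (Function.update v c a) := by
      intro q a
      apply A.Sat_congr
      intro z hz
      have := hf z hz
      by_cases h : z = c
      · subst h; simp
      · simp [h, this.ne, show z ≠ k+1 by omega, show z ≠ k+2 by omega, show z ≠ k+3 by omega]
    simp only [Φ, Sat_ex, Sat_all, Sat_imp, Sat_iff, Sat_lt, Sat_eq, Sat_and, this]
    simp [hx0, hx1, hx2, hx3, hx4, hx0.symm, hx1.symm, hx2.symm, hx3.symm, hx4.symm, dvd_def]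
  have := A.induct Φ k (Function.update (Function.update v (k+2) N) (k+3) u) (by
    rw [e]
    refine ⟨1, fun a _ => ?_⟩
    simp only [not_lt_zero, false_and, iff_false]
    rintro ⟨d, hd⟩
    have hd0 : d ≠ 0 := by rintro rfl; simp at hd
    have h1 : 1 < 1 + (a + 1) * u := lt_add_of_pos_right _ (pos_iff_ne_zero.2 (mul_ne_zero (A.succ_ne _) hu0))
    have h2 : 1 ≤ d := by
      have := (A.lt_iff 0 d).1 (pos_iff_ne_zero.2 hd0)
      rwa [zero_add] at this
    have := lt_of_lt_of_le h1 (le_mul_of_one_le_right (zero_le) h2)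
    rw [← hd] at this
    exact lt_irrefl _ this) (by
    intro n
    rw [e, e]
    rintro ⟨q, hq⟩
    by_cases hn : n < N ∧ A.Sat φ (Function.update v c n)
    · refine ⟨q * (1 + (n + 1) * u), fun a ha => ?_⟩
      by_cases hne : a = n
      · subst hne
        simp [hn.2, lt_succ]
      · rw [lt_succ, le_iff_lt_or_eq]
        simp only [hne, or_false]
        rw [← hq a ha]
        exact ⟨A.dvd_key2 hu ha hn.1 hne, fun h => Dvd.dvd.mul_right h _⟩
    · refine ⟨q, fun a ha => ?_⟩
      rw [hq a ha, lt_succ, le_iff_lt_or_eq]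
      constructor
      · rintro ⟨h1, h2⟩; exact ⟨Or.inl h1, h2⟩
      · rintro ⟨h1 | rfl, h2⟩
        · exact ⟨h1, h2⟩
        · exact absurd ⟨ha, h2⟩ hn) N
  rw [e] at this
  obtain ⟨q, hq⟩ := this
  refine ⟨u, q, fun a ha => ?_⟩
  rw [hq a ha]
  simp [ha]

theorem collection (φ : Formula) (x w : ℕ) (hxw : x ≠ w) (v : ℕ → A.M) (N : A.M)
    (h : ∀ a < N, ∃ b, A.Sat φ (Function.update (Function.update v x a) w b)) :
    ∃ B : A.M, ∀ a < N, ∃ b < B, A.Sat φ (Function.update (Function.update v x a) w b) := by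
  set k := fr (insert x (insert w φ.fv)) with hk
  have hx : x < k := lt_fr (by simp)
  have hw : w < k := lt_fr (by simp)
  have hf : ∀ z ∈ φ.fv, z < k := fun z h => lt_fr (s := insert x (insert w φ.fv)) (by simp [h])
  have hx0 : x ≠ k := by omega
  have hx1 : x ≠ k + 1 := by omega
  have hw0 : w ≠ k := by omega
  have hw1 : w ≠ k + 1 := by omega
  let Φ := ex (k+1) (all x ((lt (.var x) (.var k)).imp ((ex w φ).imp (ex w ((lt (.var w) (.var (k+1))).and φ)))))
  have e : ∀ n, A.Sat Φ (Function.update v k n) ↔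
      ∃ B, ∀ a < n, (∃ b, A.Sat φ (Function.update (Function.update v x a) w b)) →
        ∃ b < B, A.Sat φ (Function.update (Function.update v x a) w b) := by
    intro n
    have : ∀ q a b, A.Sat φ (Function.update (Function.update (Function.update (Function.update v k n) (k+1) q) x a) w b) ↔ A.Sat φ (Function.update (Function.update v x a) w b) := by
      intro q a b
      apply A.Sat_congr
      intro z hz
      have := hf z hz
      by_cases h : z = w
      · subst h; simp
      by_cases h' : z = x
      · rw [h']; simp [hxw]
      · simp [h, h', this.ne, show z ≠ k+1 by omega]
    simp only [Φ, Sat_ex, Sat_all, Sat_imp, Sat_lt, Sat_and, this]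
    simp [hx0, hx1, hw0, hw1, hx0.symm, hx1.symm, hw0.symm, hw1.symm]
  have := A.induct Φ k v (by
    rw [e]
    exact ⟨0, fun a ha => absurd ha not_lt_zero⟩) (by
    intro n
    rw [e, e]
    rintro ⟨B, hB⟩
    by_cases hn : ∃ b, A.Sat φ (Function.update (Function.update v x n) w b)
    · obtain ⟨b, hb⟩ := hn
      refine ⟨B + (b + 1), fun a ha hs => ?_⟩
      rcases lt_or_eq_of_le ((A.lt_succ _ _).1 ha) with h1 | rfl
      · obtain ⟨b', h1, h2⟩ := hB a h1 hs
        exact ⟨b', lt_of_lt_of_le h1 le_self_add, h2⟩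
      · exact ⟨b, lt_of_lt_of_le ((A.lt_succ _ _).2 le_rfl) le_add_self, hb⟩
    · refine ⟨B, fun a ha hs => ?_⟩
      rcases lt_or_eq_of_le ((A.lt_succ _ _).1 ha) with h1 | rfl
      · exact hB a h1 hs
      · exact absurd hs hn) N
  rw [e] at this
  obtain ⟨B, hB⟩ := this
  exact ⟨B, fun a ha => hB a ha (h a ha)⟩

end Mdl

end ModalArith

namespace ModalArith

open Formula
open Function (update)

theorem Term.val_congr {t : Term} {v v' : ℕ → ℕ} (h : ∀ z ∈ t.fv, v z = v' z) : t.val v = t.val v' := by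
  induction t with
  | var x => exact h x (by simp [Term.fv])
  | zero => rfl
  | succ t ih => simp only [Term.val]; rw [ih h]
  | add t u h1 h2 | mul t u h1 h2 =>
    simp only [Term.val]
    rw [h1 fun z hz => h z (by simp [Term.fv, hz]), h2 fun z hz => h z (by simp [Term.fv, hz])]

theorem Formula.val_congr {φ : Formula} {v v' : ℕ → ℕ} (h : ∀ z ∈ φ.fv, v z = v' z) :
    φ.val v ↔ φ.val v' := by
  induction φ generalizing v v' with
  | falsum => rfl
  | box φ h1 => rfl
  | eq t u | le t u =>
    simp only [Formula.val]
    rw [Term.val_congr fun z hz => h z (by simp [fv, hz]), Term.val_congr (t := u) fun z hz => h z (by simp [fv, hz])]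
  | and φ ψ h1 h2 | or φ ψ h1 h2 | imp φ ψ h1 h2 =>
    simp only [Formula.val]
    rw [h1 fun z hz => h z (by simp [fv, hz]), h2 fun z hz => h z (by simp [fv, hz])]
  | neg φ h1 => simp only [Formula.val]; rw [h1 h]
  | all x φ h1 | ex x φ h1 =>
    simp only [Formula.val]
    have : ∀ a, φ.val (update v x a) ↔ φ.val (update v' x a) := by
      intro a
      apply h1
      intro z hz
      by_cases e : z = x
      · subst e; simp
      · simp only [Function.update_of_ne e]
        exact h z (by simp [fv, e, hz])
    simp only [this]

theorem Term.val_update {t : Term} {x : ℕ} (h : x ∉ t.fv) (v : ℕ → ℕ) (a : ℕ) :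
    t.val (update v x a) = t.val v := by
  apply Term.val_congr
  intro z hz
  have : z ≠ x := by rintro rfl; exact h hz
  simp [this]

theorem Formula.val_update {φ : Formula} {x : ℕ} (h : x ∉ φ.fv) (v : ℕ → ℕ) (a : ℕ) :
    φ.val (update v x a) ↔ φ.val v := by
  apply Formula.val_congr
  intro z hz
  have : z ≠ x := by rintro rfl; exact h hz
  simp [this]

theorem val_ball {x : ℕ} {t : Term} (h : x ∉ t.fv) (φ : Formula) (v : ℕ → ℕ) :
    (ball x t φ).val v ↔ ∀ n < t.val v, φ.val (update v x n) := by
  simp [ball, Formula.val, lt, Term.val, Term.val_update h, Nat.succ_le_iff]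
theorem val_bex {x : ℕ} {t : Term} (h : x ∉ t.fv) (φ : Formula) (v : ℕ → ℕ) :
    (bex x t φ).val v ↔ ∃ n < t.val v, φ.val (update v x n) := by
  simp [bex, Formula.val, lt, Term.val, Term.val_update h, Nat.succ_le_iff]

theorem fv_numeral (n : ℕ) : (Term.numeral n).fv = ∅ := by
  induction n with
  | zero => rfl
  | succ n ih => exact ih

theorem val_numeral (n : ℕ) (v : ℕ → ℕ) : (Term.numeral n).val v = n := by
  induction n with
  | zero => rfl
  | succ n ih => simp [Term.numeral, Term.val, ih]

theorem ok_closed (φ : Formula) : ∀ τ : ℕ → Term, (∀ z, (τ z).fv = ∅ ∨ τ z = .var z) → φ.ok id τ := by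
  induction φ with
  | falsum | eq | le => intros; trivial
  | and φ ψ h1 h2 | or φ ψ h1 h2 | imp φ ψ h1 h2 => intro τ h; exact ⟨h1 τ h, h2 τ h⟩
  | neg φ h1 | box φ h1 => exact h1
  | all y φ h1 | ex y φ h1 =>
    intro τ h
    refine ⟨?_, h1 _ ?_⟩
    · intro z _ hz
      rcases h z with h | h
      · simp [h]
      · simp [h, Term.fv, hz.symm]
    · intro z
      by_cases e : z = y
      · subst e; simp
      · simpa [e] using h z

namespace Mdl
variable {T : Set Formula} (A : Mdl T)

variable [hT : Fact (Extends T PAK)]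

/-- Standard valuations. -/
def cst (u : ℕ → ℕ) : ℕ → A.M := fun z => (u z : A.M)

theorem cst_update (u : ℕ → ℕ) (x n : ℕ) : A.cst (update u x n) = update (A.cst u) x (n : A.M) := by
  funext z
  by_cases e : z = x
  · subst e; simp [cst]
  · simp [cst, e]

theorem ev_cst (t : Term) (u : ℕ → ℕ) : A.ev t (A.cst u) = (t.val u : A.M) := by
  induction t with
  | var x => rfl
  | zero => simp [Term.val]
  | succ t ih => simp [Term.val, ih]
  | add t u h1 h2 => simp [Term.val, h1, h2]
  | mul t u h1 h2 => simp [Term.val, h1, h2]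

theorem std_lt {n : ℕ} {a : A.M} (h : a < (n : A.M)) : ∃ k < n, a = (k : A.M) := by
  induction n with
  | zero => simp at h
  | succ n ih =>
    rw [Nat.cast_succ, lt_succ] at h
    rcases lt_or_eq_of_le h with h | h
    · obtain ⟨k, h1, h2⟩ := ih h
      exact ⟨k, by omega, h2⟩
    · exact ⟨n, by omega, h⟩

theorem delta0_abs {δ : Formula} (h : IsDelta0 δ) (u : ℕ → ℕ) : A.Sat δ (A.cst u) ↔ δ.val u := by
  induction h generalizing u with
  | falsum => rfl
  | eq t s => rw [Sat_eq, ev_cst, ev_cst, Nat.cast_inj]; rfl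
  | le t s => rw [Sat_le, ev_cst, ev_cst, Nat.cast_le]; rfl
  | and _ _ h1 h2 => rw [Sat_and, h1, h2]; rfl
  | or _ _ h1 h2 => rw [Sat_or, h1, h2]; rfl
  | imp _ _ h1 h2 => rw [Sat_imp, h1, h2]; rfl
  | neg _ h1 => rw [Sat_neg, h1]; rfl
  | ball hx _ h1 =>
    rw [A.Sat_ball hx, val_ball hx, ev_cst]
    constructor
    · intro h n hn
      rw [← h1, cst_update]
      exact h _ (Nat.cast_lt.2 hn)
    · intro h a ha
      obtain ⟨k, hk, rfl⟩ := A.std_lt ha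
      rw [← cst_update, h1]
      exact h k hk
  | bex hx _ h1 =>
    rw [A.Sat_bex hx, val_bex hx, ev_cst]
    constructor
    · rintro ⟨a, ha, h⟩
      obtain ⟨k, hk, rfl⟩ := A.std_lt ha
      rw [← cst_update, h1] at h
      exact ⟨k, hk, h⟩
    · rintro ⟨n, hn, h⟩
      refine ⟨n, Nat.cast_lt.2 hn, ?_⟩
      rw [← cst_update, h1]; exact h

theorem box_top {φ : Formula} (h : ∀ (B : Mdl T) v, B.Sat φ v) (v : ℕ → A.M) : A.Sat (box φ) v :=
  A.sound _ (Provable.nec (completeness hT.out h)) v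

theorem box_K {φ ψ : Formula} {v : ℕ → A.M} (h : A.Sat (box (φ.imp ψ)) v) (h' : A.Sat (box φ) v) :
    A.Sat (box ψ) v :=
  A.sound _ (hT.out _ (Or.inr ⟨φ, ψ, rfl⟩)) v h h'

theorem box_imp {φ ψ : Formula} (h : ∀ (B : Mdl T) v, B.Sat φ v → B.Sat ψ v) {v : ℕ → A.M}
    (h' : A.Sat (box φ) v) : A.Sat (box ψ) v :=
  A.box_K (A.box_top (φ := φ.imp ψ) h v) h'

theorem box_imp2 {φ ψ χ : Formula} (h : ∀ (B : Mdl T) v, B.Sat φ v → B.Sat ψ v → B.Sat χ v) {v : ℕ → A.M}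
    (h1 : A.Sat (box φ) v) (h2 : A.Sat (box ψ) v) : A.Sat (box χ) v :=
  A.box_K (A.box_K (A.box_top (φ := φ.imp (ψ.imp χ)) h v) h1) h2

theorem Sat_std (φ : Formula) (u : ℕ → ℕ) (v : ℕ → A.M) :
    A.Sat (φ.substAll (numeralSubst u)) v ↔ A.Sat φ (A.cst u) := by
  rw [A.Sat_substAll (ok_closed φ (numeralSubst u) fun z => Or.inl (fv_numeral _))]
  simp only [numeralSubst, ev_numeral]
  rfl

theorem box_std {φ ψ : Formula} {u u' : ℕ → ℕ} (h : ∀ B : Mdl T, B.Sat φ (B.cst u) → B.Sat ψ (B.cst u'))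
    (h' : A.Sat (box φ) (A.cst u)) : A.Sat (box ψ) (A.cst u') := by
  have e := A.Sat_std (box φ) u (A.cst u)
  have e' := A.Sat_std (box ψ) u' (A.cst u)
  rw [← e']
  rw [← e] at h'
  refine A.box_imp ?_ h'
  intro B v
  rw [Sat_std, Sat_std]
  exact h B

theorem box_eq {t u : Term} {v : ℕ → A.M} (h : A.ev t v = A.ev u v) : A.Sat (box (eq t u)) v := by
  let w : ℕ → A.M := fun _ => A.ev t v
  have h1 : A.bx (eq (.var 0) (.var 0)) w := A.box_top (φ := eq (.var 0) (.var 0)) (fun _ _ => rfl) w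
  have h2 := (A.bx_subst (eq (.var 0) (.var 1)) (fun _ => .var 0) trivial w).1 h1
  refine (A.bx_subst (eq (.var 0) (.var 1)) (fun n => if n = 0 then t else u) trivial v).2 ?_
  refine A.bx_congr _ _ _ ?_ h2
  intro z hz
  simp [fv, Term.fv] at hz
  rcases hz with rfl | rfl
  · rfl
  · exact h

theorem box_le {t u : Term} {v : ℕ → A.M} (h : A.ev t v ≤ A.ev u v) : A.Sat (box (le t u)) v := by
  obtain ⟨c, hc⟩ := (A.le_def _ _).1 h
  set k := fr (t.fv ∪ u.fv) with hk
  have ht : k ∉ t.fv := fun h => absurd (lt_fr (s := t.fv ∪ u.fv) (z := k) (by simp [h])) (by omega)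
  have hu : k ∉ u.fv := fun h => absurd (lt_fr (s := t.fv ∪ u.fv) (z := k) (by simp [h])) (by omega)
  have h1 : A.Sat (box (eq (.add t (.var k)) u)) (update v k c) := by
    apply A.box_eq
    simp [A.ev_update ht, A.ev_update hu, hc]
  have h2 : A.Sat (box (le t u)) (update v k c) := by
    refine A.box_imp ?_ h1
    intro B v h
    rw [Sat_eq] at h
    rw [Sat_le, ← h]
    exact le_self_add
  rwa [Sat_update] at h2
  simp [fv, ht, hu]

theorem box_lt {t u : Term} {v : ℕ → A.M} (h : A.ev t v < A.ev u v) : A.Sat (box (lt t u)) v :=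
  A.box_le (by rw [ev_succ]; exact (A.lt_iff _ _).1 h)

theorem box_ball {φ : Formula} {x : ℕ} {t : Term} (hx : x ∉ t.fv) {v : ℕ → A.M}
    (h : ∀ a < A.ev t v, A.Sat (box φ) (update v x a)) : A.Sat (box (ball x t φ)) v := by
  set k := fr (insert x (t.fv ∪ φ.fv)) with hk
  have hxk : x ≠ k := (lt_fr (by simp)).ne
  have ht : k ∉ t.fv := fun h => absurd (lt_fr (s := insert x (t.fv ∪ φ.fv)) (z := k) (by simp [h])) (by omega)
  have hf : k ∉ φ.fv := fun h => absurd (lt_fr (s := insert x (t.fv ∪ φ.fv)) (z := k) (by simp [h])) (by omega)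
  have hxk' : x ∉ (Term.var k).fv := by simpa [Term.fv] using hxk
  have e : ∀ N, A.Sat (.imp (ball x (.var k) (box φ)) (box (ball x (.var k) φ))) (update v k N) ↔
      ((∀ a < N, A.Sat (box φ) (update v x a)) → A.Sat (box (ball x (.var k) φ)) (update v k N)) := by
    intro N
    rw [Sat_imp, A.Sat_ball hxk']
    simp only [ev_var, Function.update_self, Function.update_comm hxk.symm]
    simp only [A.Sat_update (φ := box φ) hf]
  have := A.induct (.imp (ball x (.var k) (box φ)) (box (ball x (.var k) φ))) k v (by
    rw [e]
    intro _
    have h1 : A.Sat (box (eq (.var k) .zero)) (update v k 0) := A.box_eq (by simp)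
    refine A.box_imp ?_ h1
    intro B v' h0
    rw [Sat_eq] at h0
    rw [B.Sat_ball hxk', h0]
    intro a ha
    exact absurd ha (by simp)) (by
    intro N
    rw [e, e]
    intro h1 h2
    have h3 := h1 (fun a ha => h2 a (lt_of_lt_of_le ha le_self_add))
    have h4 := h2 N ((A.lt_succ _ _).2 le_rfl)
    have h5 : A.Sat (box (all x ((eq (.var x) (.var k)).imp φ))) (update v k N) := by
      have : A.Sat (box (all x ((eq (.var x) (.var k)).imp φ))) (update (update v k N) x N) := by
        have h6 : A.Sat (box (eq (.var x) (.var k))) (update (update v k N) x N) := by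
          apply A.box_eq
          simp [hxk.symm]
        have h7 : A.Sat (box φ) (update (update v k N) x N) := by
          rw [Function.update_comm hxk.symm, A.Sat_update (φ := box φ) hf]; exact h4
        refine A.box_imp2 ?_ h6 h7
        intro B v' h8 h9 a h10
        rw [Sat_eq] at h8 h10
        simp [hxk.symm] at h8 h10
        rw [h10, ← h8, Function.update_eq_self]
        exact h9
      rwa [Sat_update] at this
      simp [fv]
    have h8 : A.Sat (box (ball x (.succ (.var k)) φ)) (update v k N) := by
      refine A.box_imp2 ?_ h3 h5
      intro B v' h6 h7
      rw [B.Sat_ball hxk'] at h6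
      rw [B.Sat_ball (by simpa [Term.fv] using hxk)]
      intro a ha
      rw [ev_succ, lt_succ] at ha
      rcases lt_or_eq_of_le ha with h | h
      · exact h6 a h
      · refine h7 a ?_
        rw [Sat_eq]
        simpa [hxk.symm] using h
    have h9 : A.Sat (box (eq (.var k) (.succ (.var (k+1))))) (update (update v (k+1) N) k (N+1)) := by
      apply A.box_eq
      simp
    have h10 : A.Sat (box (all k ((eq (.var k) (.var (k+1))).imp (ball x (.succ (.var k)) φ)))) (update (update v (k+1) N) k (N + 1)) := by
      have : A.Sat (box (all k ((eq (.var k) (.var (k+1))).imp (ball x (.succ (.var k)) φ)))) (update (update v (k+1) N) k N) := by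
        have h6 : A.Sat (box (eq (.var k) (.var (k+1)))) (update (update v (k+1) N) k N) := by
          apply A.box_eq
          simp
        have h7 : A.Sat (box (ball x (.succ (.var k)) φ)) (update (update v (k+1) N) k N) := by
          rw [Function.update_comm (by simp), A.Sat_update]; exact h8
          have : k+1 ∉ φ.fv := fun h => absurd (lt_fr (s := insert x (t.fv ∪ φ.fv)) (z := k + 1) (by simp [h])) (by omega)
          simp [fv, ball, lt, Term.fv, this]
        refine A.box_imp2 ?_ h6 h7
        intro B v' h8 h9 a h10
        rw [Sat_eq] at h8 h10
        simp at h8 h10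
        rw [h10, ← h8, Function.update_eq_self]
        exact h9
      rw [Sat_update] at this ⊢
      · exact this
      · simp [fv]
      · simp [fv]
    have : A.Sat (box (ball x (.var k) φ)) (update (update v (k+1) N) k (N + 1)) := by
      refine A.box_imp2 ?_ h9 h10
      intro B v' h6 h7
      rw [Sat_eq] at h6
      have h8 := h7 (v' (k+1)) (by rw [Sat_eq]; simp)
      rw [B.Sat_ball (by simpa [Term.fv] using hxk)] at h8
      rw [B.Sat_ball hxk']
      intro a ha
      have := h8 a (by simp at h6 ha ⊢; rwa [← h6])
      rw [Function.update_comm hxk.symm, Sat_update _ hf] at this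
      exact this
    rw [Function.update_comm (by simp), A.Sat_update] at this
    · exact this
    · have : k+1 ∉ φ.fv := fun h => absurd (lt_fr (s := insert x (t.fv ∪ φ.fv)) (z := k + 1) (by simp [h])) (by omega)
      simp [fv, ball, lt, Term.fv, this]) (A.ev t v)
  rw [e] at this
  have h1 := this h
  have h2 : A.Sat (box (eq (.var k) t)) (update v k (A.ev t v)) := A.box_eq (by simp [A.ev_update ht])
  have h3 : A.Sat (box (ball x t φ)) (update v k (A.ev t v)) := by
    refine A.box_imp2 ?_ h1 h2
    intro B v' h4 h5
    rw [Sat_eq] at h5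
    rw [B.Sat_ball hx, ← h5]
    rwa [B.Sat_ball hxk'] at h4
  rwa [Sat_update] at h3
  simp [fv, ball, lt, Term.fv, ht, hf]

theorem delta0_complete {δ : Formula} (h : IsDelta0 δ) (v : ℕ → A.M) :
    (A.Sat δ v → A.Sat (box δ) v) ∧ (¬ A.Sat δ v → A.Sat (box δ.neg) v) := by
  induction h generalizing v with
  | falsum => exact ⟨fun h => h.elim, fun _ => A.box_top (φ := neg falsum) (fun _ _ h => h) v⟩
  | eq t s =>
    refine ⟨fun h => A.box_eq h, fun h => ?_⟩
    rcases lt_or_gt_of_ne h with h | h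
    · refine A.box_imp ?_ (A.box_lt h)
      intro B w h
      rw [Sat_lt] at h
      exact h.ne
    · refine A.box_imp ?_ (A.box_lt h)
      intro B w h
      rw [Sat_lt] at h
      exact h.ne'
  | le t s =>
    refine ⟨fun h => A.box_le h, fun h => ?_⟩
    rw [Sat_le, not_le] at h
    refine A.box_imp ?_ (A.box_lt h)
    intro B w h
    rw [Sat_lt] at h
    rw [Sat_neg, Sat_le]
    exact not_le.2 h
  | and _ _ h1 h2 =>
    refine ⟨fun h => A.box_imp2 (by exact fun B w h h' => ⟨h, h'⟩) ((h1 v).1 h.1) ((h2 v).1 h.2), fun h => ?_⟩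
    rw [Sat_and, not_and_or] at h
    rcases h with h | h
    · exact A.box_imp (by exact fun B w h h' => h h'.1) ((h1 v).2 h)
    · exact A.box_imp (by exact fun B w h h' => h h'.2) ((h2 v).2 h)
  | or _ _ h1 h2 =>
    refine ⟨fun h => ?_, fun h => ?_⟩
    · rcases h with h | h
      · exact A.box_imp (by exact fun B w h => Or.inl h) ((h1 v).1 h)
      · exact A.box_imp (by exact fun B w h => Or.inr h) ((h2 v).1 h)
    · rw [Sat_or, not_or] at h
      exact A.box_imp2 (by exact fun B w h h' h'' => h''.elim h h') ((h1 v).2 h.1) ((h2 v).2 h.2)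
  | @imp φ ψ _ _ h1 h2 =>
    refine ⟨fun h => ?_, fun h => ?_⟩
    · by_cases h3 : A.Sat φ v
      · exact A.box_imp (by exact fun B w h _ => h) ((h2 v).1 (h h3))
      · exact A.box_imp (by exact fun B w h h' => absurd h' h) ((h1 v).2 h3)
    · rw [Sat_imp, Classical.not_imp] at h
      exact A.box_imp2 (by exact fun B w h h' h'' => h' (h'' h)) ((h1 v).1 h.1) ((h2 v).2 h.2)
  | neg _ h1 =>
    exact ⟨fun h => (h1 v).2 h, fun h => A.box_imp (by exact fun B w h h' => h' h) ((h1 v).1 (not_not.1 h))⟩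
  | @ball x t φ hx _ h1 =>
    refine ⟨fun h => ?_, fun h => ?_⟩
    · rw [A.Sat_ball hx] at h
      exact A.box_ball hx fun a ha => (h1 _).1 (h a ha)
    · rw [A.Sat_ball hx] at h
      push Not at h
      obtain ⟨a, ha, h⟩ := h
      have h2 : A.Sat (box (lt (.var x) t)) (update v x a) := A.box_lt (by simpa [A.ev_update hx] using ha)
      have := A.box_imp2 (χ := (ball x t φ).neg) (fun B w h h' h'' => by
        have := h'' (w x)
        rw [Function.update_eq_self] at this
        exact h' (this h)) h2 ((h1 _).2 h)
      rwa [Sat_update] at this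
      simp [fv, ball]
  | @bex x t φ hx _ h1 =>
    refine ⟨fun h => ?_, fun h => ?_⟩
    · rw [A.Sat_bex hx] at h
      obtain ⟨a, ha, h⟩ := h
      have h2 : A.Sat (box (lt (.var x) t)) (update v x a) := A.box_lt (by simpa [A.ev_update hx] using ha)
      have := A.box_imp2 (χ := (bex x t φ)) (fun B w h h' => by
        refine ⟨w x, ?_⟩
        rw [Function.update_eq_self]
        exact ⟨h, h'⟩) h2 ((h1 _).1 h)
      rwa [Sat_update] at this
      simp [fv, bex]
    · rw [A.Sat_bex hx] at h
      push Not at h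
      have := A.box_ball hx fun a ha => (h1 _).2 (h a ha)
      refine A.box_imp ?_ this
      intro B w h
      rw [B.Sat_ball hx] at h
      rw [Sat_neg, B.Sat_bex hx]
      push Not
      exact h

end Mdl

end ModalArith

namespace ModalArith

open Formula
open Function (update)

/-- `w = (x+y)² + x`. -/
def pairF (w x y : ℕ) : Formula :=
  eq (.var w) (.add (.mul (.add (.var x) (.var y)) (.add (.var x) (.var y))) (.var x))

def mergeF (w x y : ℕ) (ψ : Formula) : Formula := ex x (ex y ((pairF w x y).and ψ))

theorem pair_inj_aux {a b c d : ℕ} (h : (a + b) * (a + b) + a = (c + d) * (c + d) + c) : a = c ∧ b = d := by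
  have h1 : a + b = c + d := by
    rcases lt_trichotomy (a + b) (c + d) with h1 | h1 | h1
    · nlinarith
    · exact h1
    · nlinarith
  rw [h1] at h
  omega

section
variable {T : Set Formula} [hT : Fact (Extends T PAK)]

theorem Mdl.pair_le (A : Mdl T) (a b : A.M) : a ≤ (a + b) * (a + b) + a ∧ b ≤ (a + b) * (a + b) + a := by
  refine ⟨le_add_self, ?_⟩
  rcases A.zero_or_succ b with rfl | ⟨c, rfl⟩
  · exact zero_le
  · exact (A.le_def _ _).2 ⟨a * a + 2 * a * (c + 1) + (c + 1) * c + a, by ring⟩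

theorem merge1 (A : Mdl T) {w x y : ℕ} {ψ : Formula} (hxy : x ≠ y) (hxw : x ≠ w) (hyw : y ≠ w) (hw : w ∉ ψ.fv)
    (v : ℕ → A.M) (a b : A.M) (h : A.Sat (box ψ) (update (update v x a) y b)) :
    ∃ c, A.Sat (box (mergeF w x y ψ)) (update v w c) := by
  refine ⟨(a + b) * (a + b) + a, ?_⟩
  set c := (a + b) * (a + b) + a with hc
  have h1 : A.Sat (box ψ) (update (update (update v w c) x a) y b) := by
    rw [Function.update_comm hxw.symm, Function.update_comm hyw.symm, A.Sat_update (φ := box ψ) hw]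
    exact h
  have h2 : A.Sat (box (pairF w x y)) (update (update (update v w c) x a) y b) := by
    apply A.box_eq
    simp [hxw.symm, hyw.symm, hxy, hc]
  have h3 : A.Sat (box (mergeF w x y ψ)) (update (update (update v w c) x a) y b) := by
    refine A.box_imp2 ?_ h2 h1
    intro B u h4 h5
    refine ⟨u x, u y, ?_⟩
    rw [Function.update_eq_self, Function.update_eq_self]
    exact ⟨h4, h5⟩
  rw [Mdl.Sat_update, Mdl.Sat_update] at h3
  · exact h3
  · simp [mergeF, fv]
  · simp [mergeF, fv]

variable (nb : ¬ Provable T (box falsum))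
include nb

theorem box_false_std {φ : Formula} {u : ℕ → ℕ} (h : ∀ A : Mdl T, A.Sat (box φ) (A.cst u))
    (h' : ∀ A : Mdl T, ¬ A.Sat φ (A.cst u)) : False := by
  apply nb
  apply completeness hT.out
  intro A v
  have : A.Sat (box falsum) (A.cst u) := A.box_std (fun B hB => (h' B hB).elim) (h A)
  exact (A.Sat_congr (by simp [fv])).1 this

theorem merge2 {w x y : ℕ} {ψ : Formula} (hxy : x ≠ y) (hxw : x ≠ w) (hyw : y ≠ w) (hw : w ∉ ψ.fv)
    (u : ℕ → ℕ) (n : ℕ) (h : ∀ A : Mdl T, A.Sat (box (mergeF w x y ψ)) (A.cst (update u w n))) :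
    ∃ k l, ∀ A : Mdl T, A.Sat (box ψ) (A.cst (update (update u x k) y l)) := by
  have key : ∀ B : Mdl T, B.Sat (mergeF w x y ψ) (B.cst (update u w n)) →
      ∃ k l : ℕ, n = (k + l) * (k + l) + k ∧ B.Sat ψ (B.cst (update (update u x k) y l)) := by
    rintro B ⟨a, b, h1, h2⟩
    simp only [pairF, Mdl.Sat_eq] at h1
    simp [hxw.symm, hyw.symm, hxy, Mdl.cst] at h1
    obtain ⟨ha, hb⟩ := B.pair_le a b
    rw [← h1, ← Mdl.lt_succ, ← Nat.cast_succ] at ha hb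
    obtain ⟨k, _, rfl⟩ := B.std_lt ha
    obtain ⟨l, _, rfl⟩ := B.std_lt hb
    refine ⟨k, l, by exact_mod_cast h1, ?_⟩
    rw [← Mdl.cst_update, ← Mdl.cst_update, Function.update_comm hxw.symm, Function.update_comm hyw.symm,
      Mdl.cst_update, Mdl.Sat_update _ hw] at h2
    exact h2
  by_cases hn : ∃ k l : ℕ, n = (k + l) * (k + l) + k
  · obtain ⟨k, l, hkl⟩ := hn
    refine ⟨k, l, fun A => A.box_std ?_ (h A)⟩
    intro B hB
    obtain ⟨k', l', h1, h2⟩ := key B hB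
    obtain ⟨rfl, rfl⟩ := pair_inj_aux (hkl.symm.trans h1)
    exact h2
  · exfalso
    refine box_false_std nb h ?_
    intro A hA
    obtain ⟨k, l, h1, _⟩ := key A hA
    exact hn ⟨k, l, h1⟩

end

/-- The translation property. -/
def Tr (T : Set Formula) [Fact (Extends T PAK)] (φ : Formula) : Prop :=
  ∃ b : ℕ, ∀ w ≥ b, ∃ φ' : Formula, φ'.fv ⊆ insert w φ.fv ∧
    (∀ (A : Mdl T) v, A.Sat φ v → ∃ a, A.Sat (box φ') (update v w a)) ∧
    (∀ (u : ℕ → ℕ) n, (∀ A : Mdl T, A.Sat (box φ') (A.cst (update u w n))) → ∀ A : Mdl T, A.Sat φ (A.cst u))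

section
variable {T : Set Formula} [hT : Fact (Extends T PAK)] (nb : ¬ Provable T (box falsum))

theorem not_mem_of_ge {s : Finset ℕ} {w : ℕ} (h : fr s ≤ w) : w ∉ s := fun hw => absurd (lt_fr hw) (by omega)

theorem tr_box (ψ : Formula) : Tr T (box ψ) := by
  refine ⟨fr ψ.fv, fun w hw => ⟨ψ, by simp [fv], ?_, ?_⟩⟩
  · intro A v h
    exact ⟨0, by rwa [A.Sat_update (φ := .box ψ) (not_mem_of_ge hw)]⟩
  · intro u n h A
    have := h A
    rwa [Mdl.cst_update, A.Sat_update (φ := .box ψ) (not_mem_of_ge hw)] at this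

include nb

theorem tr_delta0 {δ : Formula} (hδ : IsDelta0 δ) : Tr T δ := by
  refine ⟨fr δ.fv, fun w hw => ⟨δ, by simp, ?_, ?_⟩⟩
  · intro A v h
    exact ⟨0, by rw [A.Sat_update (φ := .box δ) (not_mem_of_ge hw)]; exact (A.delta0_complete hδ v).1 h⟩
  · intro u n h A
    rw [A.delta0_abs hδ]
    by_contra hc
    refine box_false_std nb h ?_
    intro A
    rw [A.delta0_abs hδ, Formula.val_update (not_mem_of_ge hw)]
    exact hc

theorem tr_ex {φ : Formula} {x : ℕ} (h : Tr T φ) : Tr T (ex x φ) := by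
  obtain ⟨b, h⟩ := h
  refine ⟨b + fr (insert x φ.fv), fun w hw => ?_⟩
  obtain ⟨φ', h1, h2, h3⟩ := h (w + 1) (by omega)
  have hw' : w ∉ φ'.fv := fun h => not_mem_of_ge (s := insert x φ.fv) (w := w) (by omega) (by
    have := h1 h; simp at this; simp [this])
  have hx : x < w := lt_of_lt_of_le (lt_fr (s := insert x φ.fv) (by simp)) (by omega)
  have hwf : w ∉ φ.fv := fun h => not_mem_of_ge (s := insert x φ.fv) (w := w) (by omega) (by simp [h])
  refine ⟨mergeF w x (w+1) φ', ?_, ?_, ?_⟩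
  · intro z hz
    simp [mergeF, pairF, fv, Term.fv] at hz
    have h1z : z ∈ φ'.fv → _ := fun h => h1 h
    simp at h1z
    simp [fv]
    tauto
  · rintro A v ⟨a, ha⟩
    obtain ⟨c, hc⟩ := h2 A _ ha
    exact merge1 A (by omega) (by omega) (by omega) hw' v a c hc
  · intro u n hn A
    obtain ⟨k, l, hkl⟩ := merge2 nb (by omega) (by omega) (by omega) hw' u n hn
    refine ⟨k, ?_⟩
    rw [← Mdl.cst_update]
    exact h3 _ _ hkl A

theorem tr_and {φ ψ : Formula} (hφ : Tr T φ) (hψ : Tr T ψ) : Tr T (φ.and ψ) := by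
  obtain ⟨b, h⟩ := hφ
  obtain ⟨c, g⟩ := hψ
  refine ⟨b + c + fr (φ.fv ∪ ψ.fv), fun w hw => ?_⟩
  obtain ⟨φ', h1, h2, h3⟩ := h (w + 1) (by omega)
  obtain ⟨ψ', g1, g2, g3⟩ := g (w + 2) (by omega)
  have hf : ∀ i, w + i ∉ φ.fv := fun i h => not_mem_of_ge (s := φ.fv ∪ ψ.fv) (w := w + i) (by omega) (by simp [h])
  have hg : ∀ i, w + i ∉ ψ.fv := fun i h => not_mem_of_ge (s := φ.fv ∪ ψ.fv) (w := w + i) (by omega) (by simp [h])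
  have hf0 := hf 0
  have hg0 := hg 0
  have e1 : w ∉ φ'.fv := fun h => by have := h1 h; simp at this; exact hf 0 this
  have e2 : w ∉ ψ'.fv := fun h => by have := g1 h; simp at this; exact hg 0 this
  have e3 : w + 2 ∉ φ'.fv := fun h => by have := h1 h; simp at this; exact hf 2 this
  have e4 : w + 1 ∉ ψ'.fv := fun h => by have := g1 h; simp at this; exact hg 1 this
  refine ⟨mergeF w (w+1) (w+2) (φ'.and ψ'), ?_, ?_, ?_⟩
  · intro z hz
    simp [mergeF, pairF, fv, Term.fv] at hz
    have h1z : z ∈ φ'.fv → _ := fun h => h1 h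
    have g1z : z ∈ ψ'.fv → _ := fun h => g1 h
    simp at h1z g1z
    simp [fv]
    tauto
  · rintro A v ⟨ha, hb⟩
    obtain ⟨k, hk⟩ := h2 A _ ha
    obtain ⟨l, hl⟩ := g2 A _ hb
    refine merge1 A (by omega) (by omega) (by omega) (by simp [fv, e1, e2]) v k l ?_
    refine A.box_imp2 (by exact fun B w h h' => ⟨h, h'⟩) (φ := φ') (ψ := ψ') ?_ ?_
    · rw [A.Sat_update (φ := .box φ') e3]; exact hk
    · rw [Function.update_comm (by omega), A.Sat_update (φ := .box ψ') e4]; exact hl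
  · intro u n hn A
    obtain ⟨k, l, hkl⟩ := merge2 nb (by omega) (by omega) (by omega) (by simp [fv, e1, e2]) u n hn
    refine ⟨h3 u k (fun A => ?_) A, g3 u l (fun A => ?_) A⟩
    · have := A.box_imp (φ := φ'.and ψ') (ψ := φ') (by exact fun B w h => h.1) (hkl A)
      rwa [Mdl.cst_update, A.Sat_update (φ := .box φ') e3] at this
    · have := A.box_imp (φ := φ'.and ψ') (ψ := ψ') (by exact fun B w h => h.2) (hkl A)
      rwa [Function.update_comm (by omega), Mdl.cst_update, A.Sat_update (φ := .box ψ') e4] at this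

theorem tr_or {φ ψ : Formula} (hφ : Tr T φ) (hψ : Tr T ψ) : Tr T (φ.or ψ) := by
  obtain ⟨b, h⟩ := hφ
  obtain ⟨c, g⟩ := hψ
  refine ⟨b + c + fr (φ.fv ∪ ψ.fv), fun w hw => ?_⟩
  obtain ⟨φ', h1, h2, h3⟩ := h (w + 1) (by omega)
  obtain ⟨ψ', g1, g2, g3⟩ := g (w + 1) (by omega)
  have hf : ∀ i, w + i ∉ φ.fv := fun i h => not_mem_of_ge (s := φ.fv ∪ ψ.fv) (w := w + i) (by omega) (by simp [h])
  have hg : ∀ i, w + i ∉ ψ.fv := fun i h => not_mem_of_ge (s := φ.fv ∪ ψ.fv) (w := w + i) (by omega) (by simp [h])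
  have e1 : w ∉ φ'.fv := fun h => by have := h1 h; simp at this; exact hf 0 this
  have e2 : w ∉ ψ'.fv := fun h => by have := g1 h; simp at this; exact hg 0 this
  have e3 : w + 2 ∉ φ'.fv := fun h => by have := h1 h; simp at this; exact hf 2 this
  have e4 : w + 2 ∉ ψ'.fv := fun h => by have := g1 h; simp at this; exact hg 2 this
  let χ := ((eq (.var (w+2)) .zero).and φ').or ((neg (eq (.var (w+2)) .zero)).and ψ')
  have eχ : w ∉ χ.fv := by simp [χ, fv, e1, e2, Term.fv]
  refine ⟨mergeF w (w+1) (w+2) χ, ?_, ?_, ?_⟩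
  · intro z hz
    simp [mergeF, pairF, fv, Term.fv, χ] at hz
    have h1z : z ∈ φ'.fv → _ := fun h => h1 h
    have g1z : z ∈ ψ'.fv → _ := fun h => g1 h
    simp at h1z g1z
    simp [fv]
    tauto
  · rintro A v (ha | hb)
    · obtain ⟨k, hk⟩ := h2 A _ ha
      refine merge1 A (by omega) (by omega) (by omega) eχ v k 0 ?_
      refine A.box_imp2 (by exact fun B w h h' => Or.inl ⟨h, h'⟩) (φ := eq (.var (w+2)) .zero) (ψ := φ') ?_ ?_
      · apply A.box_eq; simp
      · rw [A.Sat_update (φ := .box φ') e3]; exact hk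
    · obtain ⟨k, hk⟩ := g2 A _ hb
      refine merge1 A (by omega) (by omega) (by omega) eχ v k 1 ?_
      refine A.box_imp2 ?_ (φ := eq (.var (w+2)) (.succ .zero)) (ψ := ψ') ?_ ?_
      · intro B z h h'
        refine Or.inr ⟨?_, h'⟩
        rw [Mdl.Sat_eq] at h
        rw [Mdl.Sat_neg, Mdl.Sat_eq, h]
        simp
      · apply A.box_eq; simp
      · rw [A.Sat_update (φ := .box ψ') e4]; exact hk
  · intro u n hn A
    obtain ⟨k, l, hkl⟩ := merge2 nb (by omega) (by omega) (by omega) eχ u n hn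
    by_cases hl : l = 0
    · left
      refine h3 u k (fun A => A.box_std ?_ (hkl A)) A
      rintro B (hB | hB)
      · have := hB.2
        rwa [Mdl.cst_update, Mdl.Sat_update _ e3] at this
      · exact absurd (by simp [Mdl.Sat_eq, Mdl.cst, hl]) hB.1
    · right
      refine g3 u k (fun A => A.box_std ?_ (hkl A)) A
      rintro B (hB | hB)
      · have := hB.1
        simp [Mdl.Sat_eq, Mdl.cst, hl] at this
      · have := hB.2
        rwa [Mdl.cst_update, Mdl.Sat_update _ e4] at this

end

end ModalArith

namespace ModalArith

open Formula
open Function (update)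

/-- `1 + (x * B + y + 1) * U` divides `Q`. -/
def lookD (x w y : ℕ) : Formula :=
  bex (w+6) (.succ (.var (w+3))) (eq (.var (w+3)) (.mul (.var (w+6)) (.add (.succ .zero)
    (.mul (.succ (.add (.mul (.var x) (.var (w+4))) (.var y))) (.var (w+2))))))

def lookE (x w : ℕ) : Formula :=
  (lt (.var (w+1)) (.var (w+4))).and ((lookD x w (w+1)).and
    (ball (w+5) (.var (w+1)) (lookD x w (w+5)).neg))

theorem lookD_delta0 (x w y : ℕ) : IsDelta0 (lookD x w y) := .bex (by simp [Term.fv]) (.eq _ _)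

theorem lookE_delta0 (x w : ℕ) : IsDelta0 (lookE x w) :=
  .and (.le _ _) (.and (lookD_delta0 _ _ _) (.ball (by simp [Term.fv]) (.neg (lookD_delta0 _ _ _))))

theorem lookE_fv {x w z : ℕ} (h : z ∈ (lookE x w).fv) : z = x ∨ z = w+1 ∨ z = w+2 ∨ z = w+3 ∨ z = w+4 := by
  simp [lookE, lookD, fv, bex, ball, lt, Term.fv] at h
  grind

section
variable {T : Set Formula} [hT : Fact (Extends T PAK)]

theorem Sat_lookD (A : Mdl T) {x w y : ℕ} (hx : x < w) (hy : y < w + 6) (v : ℕ → A.M) :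
    A.Sat (lookD x w y) v ↔ 1 + (v x * v (w+4) + v y + 1) * v (w+2) ∣ v (w+3) := by
  have e1 : x ≠ w + 6 := by omega
  have e2 : y ≠ w + 6 := by omega
  rw [lookD, A.Sat_bex (by simp [Term.fv])]
  simp only [Mdl.Sat_eq]
  simp [e1, e2]
  constructor
  · rintro ⟨a, _, h⟩
    exact ⟨a, by rw [h, mul_comm]⟩
  · rintro ⟨a, h⟩
    refine ⟨a, ?_, by rw [h, mul_comm]⟩
    rw [A.lt_succ, h, add_mul, one_mul]
    exact le_self_add

theorem Sat_lookE (A : Mdl T) {x w : ℕ} (hx : x < w) (v : ℕ → A.M) :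
    A.Sat (lookE x w) v ↔ v (w+1) < v (w+4) ∧ 1 + (v x * v (w+4) + v (w+1) + 1) * v (w+2) ∣ v (w+3) ∧
      ∀ a < v (w+1), ¬ 1 + (v x * v (w+4) + a + 1) * v (w+2) ∣ v (w+3) := by
  have e1 : x ≠ w + 5 := by omega
  rw [lookE, Mdl.Sat_and, Mdl.Sat_and, Mdl.Sat_lt, A.Sat_ball (by simp [Term.fv]),
    Sat_lookD A hx (by omega)]
  simp only [Mdl.Sat_neg]
  simp only [Sat_lookD A hx (y := w+5) (by omega)]
  simp [e1]

theorem Mdl.div_unique (A : Mdl T) {a a' b b' B : A.M} (hb : b < B) (hb' : b' < B) (h : a * B + b = a' * B + b') :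
    a = a' ∧ b = b' := by
  have key : ∀ {a a' b b' : A.M}, b < B → a * B + b = a' * B + b' → ¬ a < a' := by
    intro a a' b b' hb h h1
    have h2 : (a + 1) * B ≤ a' * B := by
      have := (A.lt_iff _ _).1 h1
      gcongr
    have h3 : a * B + b < (a + 1) * B := by
      rw [add_mul, one_mul]
      gcongr
    have h4 : a' * B ≤ a' * B + b' := le_self_add
    exact absurd (h3.trans_le (h2.trans h4)) (by rw [h]; exact lt_irrefl _)
  have h1 : a = a' := le_antisymm (not_lt.1 (key hb' h.symm)) (not_lt.1 (key hb h))
  subst h1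
  exact ⟨rfl, add_left_cancel h⟩

theorem Sat_numeral {A : Mdl T} {φ : Formula} {x n : ℕ} (v : ℕ → A.M) :
    A.Sat (φ.subst x (Term.numeral n)) v ↔ A.Sat φ (update v x (n : A.M)) := by
  rw [A.Sat_subst (freeFor_self x φ (by simp [fv_numeral])), Mdl.ev_numeral]

variable (nb : ¬ Provable T (box falsum))
include nb

set_option maxHeartbeats 2000000 in
theorem tr_ball {φ : Formula} {x : ℕ} {t : Term} (hx : x ∉ t.fv) (hφ : Tr T φ) : Tr T (ball x t φ) := by
  obtain ⟨b, h⟩ := hφ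
  refine ⟨b + fr (insert x (t.fv ∪ φ.fv)), fun w hw => ?_⟩
  obtain ⟨φ', h1, h2, h3⟩ := h (w + 1) (by omega)
  have hxw : x < w := lt_of_lt_of_le (lt_fr (s := insert x (t.fv ∪ φ.fv)) (by simp)) (by omega)
  have ht : ∀ z ∈ t.fv, z < w := fun z hz =>
    lt_of_lt_of_le (lt_fr (s := insert x (t.fv ∪ φ.fv)) (by simp [hz])) (by omega)
  have hf : ∀ z ∈ φ'.fv, z < w ∨ z = w + 1 := by
    intro z hz
    have := h1 hz
    simp at this
    rcases this with h | h
    · exact Or.inr h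
    · exact Or.inl (lt_of_lt_of_le (lt_fr (s := insert x (t.fv ∪ φ.fv)) (by simp [h])) (by omega))
  let F : Formula := ex (w+1) ((lookE x w).and φ')
  let Θ := ball x t F
  have hF : ∀ z ∈ F.fv, z = w+2 ∨ z = w+3 ∨ z = w+4 ∨ z = x ∨ z ∈ φ.fv := by
    intro z hz
    simp only [F, fv, Finset.mem_erase, Finset.mem_union] at hz
    obtain ⟨hz0, hz | hz⟩ := hz
    · have := lookE_fv hz
      tauto
    · have := h1 hz
      simp at this
      tauto
  have hΘ : ∀ z ∈ Θ.fv, z = w+2 ∨ z = w+3 ∨ z = w+4 ∨ z ∈ (ball x t φ).fv := by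
    intro z hz
    simp only [Θ, ball, lt, Term.fv, fv, Finset.mem_erase, Finset.mem_union] at hz ⊢
    have := hF z
    tauto
  have hΘw : ∀ z ∈ Θ.fv, z = w+2 ∨ z = w+3 ∨ z = w+4 ∨ z < w := by
    intro z hz
    rcases hΘ z hz with h | h | h | h
    · tauto
    · tauto
    · tauto
    · simp only [ball, lt, Term.fv, fv, Finset.mem_erase, Finset.mem_union] at h
      right; right; right
      refine lt_of_lt_of_le (lt_fr (s := insert x (t.fv ∪ φ.fv)) ?_) (by omega)
      simp at h ⊢
      tauto
  have hM1 : w + 7 ∉ Θ.fv := fun h => by have := hΘw _ h; omega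
  have hM2 : w ∉ (mergeF (w+7) (w+3) (w+4) Θ).fv := by
    intro h
    simp [mergeF, pairF, fv, Term.fv] at h
    have := hΘw _ h; omega
  refine ⟨mergeF w (w+2) (w+7) (mergeF (w+7) (w+3) (w+4) Θ), ?_, ?_, ?_⟩
  · intro z hz
    simp [mergeF, pairF, fv, Term.fv] at hz
    have := hΘ z
    simp
    tauto
  · intro A v hv
    rw [A.Sat_ball hx] at hv
    obtain ⟨Bd, hBd⟩ := A.collection (box φ') x (w+1) (by omega) v (A.ev t v) (fun a ha => h2 A _ (hv a ha))
    let Ψ : Formula := ex x (ex (w+1) ((eq (.var (w+2)) (.add (.mul (.var x) (.var (w+4))) (.var (w+1)))).and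
      ((lt (.var (w+1)) (.var (w+4))).and (box φ'))))
    have hfv : ∀ (f g : ℕ → A.M), (∀ z < w, f z = g z) → f (w+1) = g (w+1) →
        (A.Sat (box φ') f ↔ A.Sat (box φ') g) := by
      intro f g e1 e2
      apply A.Sat_congr
      intro z hz
      rcases hf z hz with h | h
      · exact e1 z h
      · rw [h]; exact e2
    have hΨ : ∀ a b, b < Bd → (A.Sat Ψ (update (update v (w+4) Bd) (w+2) (a * Bd + b)) ↔
        A.Sat (box φ') (update (update v x a) (w+1) b)) := by
      intro a b hb
      have e0 : x ≠ w+1 := by omega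
      have e1 : w + 2 ≠ x := by omega
      have e2 : w + 4 ≠ x := by omega
      constructor
      · rintro ⟨a', b', c1, c2, c3⟩
        rw [Mdl.Sat_eq] at c1
        rw [Mdl.Sat_lt] at c2
        simp [e0, e1, e2] at c1 c2
        obtain ⟨rfl, rfl⟩ := A.div_unique hb c2 c1
        refine (hfv _ _ ?_ ?_).1 c3
        · intro z hz
          simp [Function.update_apply, show z ≠ w+1 by omega, show z ≠ w+2 by omega, show z ≠ w+4 by omega]
        · simp
      · intro c3
        refine ⟨a, b, ?_, ?_, ?_⟩
        · rw [Mdl.Sat_eq]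
          simp [e0, e1, e2]
        · change A.Sat (lt _ _) _
          rw [Mdl.Sat_lt]
          simpa [e2] using hb
        · refine (hfv _ _ ?_ ?_).1 c3
          · intro z hz
            simp [Function.update_apply, show z ≠ w+1 by omega, show z ≠ w+2 by omega, show z ≠ w+4 by omega]
          · simp
    obtain ⟨U, Q, hUQ⟩ := A.comprehension Ψ (w+2) (update v (w+4) Bd) (A.ev t v * Bd)
    have hbd : ∀ a < A.ev t v, ∀ b < Bd, a * Bd + b < A.ev t v * Bd := by
      intro a ha b hb
      calc a * Bd + b < (a + 1) * Bd := by
            rw [add_mul, one_mul]; gcongr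
        _ ≤ _ := by
            have := (A.lt_iff _ _).1 ha
            gcongr
    have main : A.Sat (box Θ) (update (update (update v (w+2) U) (w+3) Q) (w+4) Bd) := by
      have et : A.ev t (update (update (update v (w+2) U) (w+3) Q) (w+4) Bd) = A.ev t v := by
        rw [A.ev_update, A.ev_update, A.ev_update]
        all_goals exact fun h => by have := ht _ h; omega
      apply A.box_ball hx
      rw [et]
      intro a ha
      obtain ⟨b', hb', hb2⟩ := hBd a ha
      obtain ⟨b, hb, hbl⟩ := A.lnp (box φ') (w+1) _ hb2
      have hbB : b < Bd := by
        refine lt_of_le_of_lt ?_ hb'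
        by_contra hc
        exact hbl b' (not_le.1 hc) hb2
      have c1 : A.Sat (lookE x w) (update (update (update (update (update v (w+2) U) (w+3) Q) (w+4) Bd) x a) (w+1) b) := by
        rw [Sat_lookE A hxw]
        have e0 : x ≠ w+1 := by omega
        have e1 : w + 2 ≠ x := by omega
        have e2 : w + 4 ≠ x := by omega
        have e3 : w + 3 ≠ x := by omega
        simp [e0, e1, e2, e3]
        refine ⟨hbB, ?_, ?_⟩
        · rw [hUQ _ (hbd a ha b hbB), hΨ _ _ hbB]
          exact hb
        · intro c hc
          rw [hUQ _ (hbd a ha c (hc.trans hbB)), hΨ _ _ (hc.trans hbB)]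
          exact hbl c hc
      have c2 : A.Sat (box φ') (update (update (update (update (update v (w+2) U) (w+3) Q) (w+4) Bd) x a) (w+1) b) := by
        refine (hfv _ _ ?_ ?_).1 hb
        · intro z hz
          simp [Function.update_apply, show z ≠ w+1 by omega, show z ≠ w+2 by omega, show z ≠ w+3 by omega, show z ≠ w+4 by omega]
        · simp
      have c3 := A.box_imp2 (χ := F) (by
        intro B z h h'
        refine ⟨z (w+1), ?_⟩
        rw [Function.update_eq_self]
        exact ⟨h, h'⟩) ((A.delta0_complete (lookE_delta0 x w) _).1 c1) c2
      rwa [A.Sat_update] at c3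
      simp [fv, F]
    obtain ⟨c, hc⟩ := merge1 A (by omega) (by omega) (by omega) hM1 _ _ _ main
    exact merge1 A (by omega) (by omega) (by omega) hM2 _ _ _ hc
  · intro u n hn A
    obtain ⟨U, n', hn'⟩ := merge2 nb (by omega) (by omega) (by omega) hM2 u n hn
    obtain ⟨Q, Bd, hm⟩ := merge2 nb (by omega) (by omega) (by omega) hM1 _ _ hn'
    rw [A.Sat_ball hx, A.ev_cst]
    intro a ha
    obtain ⟨i, hi, rfl⟩ := A.std_lt ha
    rw [← A.cst_update]
    have et : t.val (update (update (update u (w+2) U) (w+3) Q) (w+4) Bd) = t.val u := by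
      rw [Term.val_update, Term.val_update, Term.val_update]
      all_goals exact fun h => by have := ht _ h; omega
    have hFi : ∀ A : Mdl T, A.Sat (box F) (A.cst (update (update (update (update u (w+2) U) (w+3) Q) (w+4) Bd) x i)) := by
      intro A
      refine A.box_std ?_ (hm A)
      intro B hB
      rw [B.Sat_ball hx, B.ev_cst, et] at hB
      rw [B.cst_update]
      exact hB _ (by exact_mod_cast hi)
    set u' := update (update (update (update u (w+2) U) (w+3) Q) (w+4) Bd) x i with hu'
    have hB' : u' (w+4) = Bd := by
      simp [hu', show w + 4 ≠ x by omega]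
    have hex : ∃ j : ℕ, (lookE x w).val (update u' (w+1) j) := by
      by_contra hc
      refine box_false_std nb hFi ?_
      rintro B ⟨c, hc1, hc2⟩
      have hc3 := (Sat_lookE B hxw _).1 hc1
      have : c < (Bd : B.M) := by
        have := hc3.1
        simpa [Mdl.cst, hB'] using this
      obtain ⟨j, _, rfl⟩ := B.std_lt this
      rw [← B.cst_update, B.delta0_abs (lookE_delta0 x w)] at hc1
      exact hc ⟨j, hc1⟩
    obtain ⟨j, hj⟩ := hex
    refine h3 _ j (fun A => A.box_std ?_ (hFi A)) A
    rintro B ⟨c, hc1, hc2⟩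
    have hcj : c = (j : B.M) := by
      have hj' := hj
      rw [← B.delta0_abs (lookE_delta0 x w), B.cst_update, Sat_lookE B hxw] at hj'
      rw [Sat_lookE B hxw] at hc1
      have e0 : x ≠ w+1 := by omega
      simp [e0] at hj' hc1
      rcases lt_trichotomy c (j : B.M) with h | h | h
      · exact absurd hc1.2.1 (hj'.2.2 _ h)
      · exact h
      · exact absurd hj'.2.1 (hc1.2.2 _ h)
    subst hcj
    rw [← B.cst_update] at hc2
    refine (B.Sat_congr ?_).1 hc2
    intro z hz
    rcases hf z hz with h | h
    · simp [Mdl.cst, hu', Function.update_apply, show z ≠ w+1 by omega, show z ≠ w+2 by omega, show z ≠ w+3 by omega, show z ≠ w+4 by omega]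
    · subst h; simp [Mdl.cst]

theorem tr_sigma1 {φ : Formula} (h : IsSigma1 φ) : Tr T φ := by
  induction h with
  | delta0 h => exact tr_delta0 nb h
  | and _ _ h1 h2 => exact tr_and nb h1 h2
  | or _ _ h1 h2 => exact tr_or nb h1 h2
  | ex _ h => exact tr_ex nb h
  | ball hx _ h => exact tr_ball nb hx h

theorem tr_sigmaB {φ : Formula} (h : IsSigmaB φ) : Tr T φ := by
  induction h with
  | sigma1 h => exact tr_sigma1 nb h
  | b ψ => exact tr_box ψ
  | and _ _ h1 h2 => exact tr_and nb h1 h2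
  | or _ _ h1 h2 => exact tr_or nb h1 h2
  | ex _ h => exact tr_ex nb h
  | ball hx _ h => exact tr_ball nb hx h

theorem ep_of_bep (hep : HasEP T IsB) : HasEP T IsSigmaB := by
  intro x φ hφ hfv hp
  obtain ⟨b, h⟩ := tr_sigmaB nb hφ
  obtain ⟨w, hw⟩ : ∃ w, w = b + fr (insert x φ.fv) := ⟨_, rfl⟩
  obtain ⟨φ', h1, h2, h3⟩ := h (w + 1) (by omega)
  have hw' : w ∉ φ'.fv := fun h => not_mem_of_ge (s := insert x φ.fv) (w := w) (by omega) (by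
    have := h1 h; simp at this; simp [this])
  have hx : x < w := lt_of_lt_of_le (lt_fr (s := insert x φ.fv) (by simp)) (by omega)
  have hm : (mergeF w x (w+1) φ').fv ⊆ {w} := by
    intro z hz
    simp [mergeF, pairF, fv, Term.fv] at hz
    have h1z : z ∈ φ'.fv → _ := fun h => h1 h
    have hz2 : z ∈ φ.fv → _ := fun h => hfv h
    simp at h1z hz2 ⊢
    tauto
  have hex : Provable T (ex w (box (mergeF w x (w+1) φ'))) := by
    apply completeness hT.out
    intro A v
    obtain ⟨a, ha⟩ := A.sound _ hp v
    obtain ⟨c, hc⟩ := h2 A _ ha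
    exact merge1 A (by omega) (by omega) (by omega) hw' v a c hc
  obtain ⟨n, hn⟩ := hep w (box (mergeF w x (w+1) φ')) ⟨_, rfl⟩ hm hex
  have hn' : ∀ A : Mdl T, A.Sat (box (mergeF w x (w+1) φ')) (A.cst (update (fun _ => 0) w n)) := by
    intro A
    have := A.sound _ hn (A.cst (fun _ => 0))
    rw [Sat_numeral] at this
    rwa [A.cst_update]
  obtain ⟨k, l, hkl⟩ := merge2 nb (by omega) (by omega) (by omega) hw' _ n hn'
  refine ⟨k, completeness hT.out fun A v => ?_⟩
  rw [Sat_numeral]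
  refine (A.Sat_congr ?_).1 (h3 _ _ hkl A)
  intro z hz
  have := hfv hz
  simp at this
  subst this
  simp [Mdl.cst]

end

end ModalArith

namespace ModalArith

open Formula
open Function (update)

/-- Semantic `Σ₁`-definability in the standard model. -/
def Sg (X : (ℕ → ℕ) → Prop) : Prop := ∃ φ : Formula, IsSigma1 φ ∧ ∀ v, φ.val v ↔ X v

namespace Sg

theorem of_iff {X Y : (ℕ → ℕ) → Prop} (h : Sg X) (e : ∀ v, X v ↔ Y v) : Sg Y := by
  obtain ⟨φ, h1, h2⟩ := h
  exact ⟨φ, h1, fun v => (h2 v).trans (e v)⟩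

theorem and {X Y : (ℕ → ℕ) → Prop} (h : Sg X) (h' : Sg Y) : Sg fun v => X v ∧ Y v := by
  obtain ⟨φ, h1, h2⟩ := h
  obtain ⟨ψ, h3, h4⟩ := h'
  exact ⟨φ.and ψ, .and h1 h3, fun v => and_congr (h2 v) (h4 v)⟩

theorem or {X Y : (ℕ → ℕ) → Prop} (h : Sg X) (h' : Sg Y) : Sg fun v => X v ∨ Y v := by
  obtain ⟨φ, h1, h2⟩ := h
  obtain ⟨ψ, h3, h4⟩ := h'
  exact ⟨φ.or ψ, .or h1 h3, fun v => or_congr (h2 v) (h4 v)⟩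

theorem ex {X : (ℕ → ℕ) → ℕ → Prop} (k : ℕ) (hX : ∀ v m n, X (update v k m) n ↔ X v n)
    (h : Sg fun v => X v (v k)) : Sg fun v => ∃ n, X v n := by
  obtain ⟨φ, h1, h2⟩ := h
  refine ⟨.ex k φ, .ex h1, fun v => ?_⟩
  simp only [Formula.val, h2, hX, Function.update_self]

theorem ball {X : (ℕ → ℕ) → ℕ → Prop} (k : ℕ) (t : Term) (hk : k ∉ t.fv) (hX : ∀ v m n, X (update v k m) n ↔ X v n)
    (h : Sg fun v => X v (v k)) : Sg fun v => ∀ n < t.val v, X v n := by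
  obtain ⟨φ, h1, h2⟩ := h
  refine ⟨.ball k t φ, .ball hk h1, fun v => ?_⟩
  simp only [val_ball hk, h2, hX, Function.update_self]

theorem eq (s t : Term) : Sg fun v => s.val v = t.val v := ⟨.eq s t, .delta0 (.eq _ _), fun _ => Iff.rfl⟩
theorem le (s t : Term) : Sg fun v => s.val v ≤ t.val v := ⟨.le s t, .delta0 (.le _ _), fun _ => Iff.rfl⟩
theorem lt (s t : Term) : Sg fun v => s.val v < t.val v := ⟨.lt s t, .delta0 (.le _ _), fun _ => Iff.rfl⟩

theorem pair (s t u : Term) : Sg fun v => u.val v = Nat.pair (s.val v) (t.val v) := by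
  refine (((lt s t).and (eq u (.add (.mul t t) s))).or
    ((le t s).and (eq u (.add (.add (.mul s s) s) t)))).of_iff fun v => ?_
  unfold Nat.pair
  simp only [Term.val]
  split_ifs with h
  · constructor
    · rintro (⟨_, h⟩ | ⟨h, _⟩)
      · exact h
      · omega
    · intro h'; exact Or.inl ⟨h, h'⟩
  · constructor
    · rintro (⟨_, _⟩ | ⟨_, h⟩)
      · omega
      · exact h
    · intro h'; exact Or.inr ⟨by omega, h'⟩

end Sg

/-- fresh variables for terms -/
theorem fresh_val {s : Term} {k : ℕ} (h : fr s.fv ≤ k) (v : ℕ → ℕ) (m : ℕ) : s.val (update v k m) = s.val v :=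
  Term.val_update (not_mem_of_ge h) v m

def SgR (f : ℕ →. ℕ) : Prop := ∀ s t : Term, Sg fun v => t.val v ∈ f (s.val v)

theorem Sg.beta (s i t : Term) : Sg fun v => t.val v = Nat.beta (s.val v) (i.val v) := by
  obtain ⟨k, hk⟩ : ∃ k, k = fr s.fv + fr i.fv + fr t.fv := ⟨_, rfl⟩
  have h1 : ∀ j v m, s.val (update v (k+j) m) = s.val v := fun j v m => fresh_val (by omega) v m
  have h2 : ∀ j v m, i.val (update v (k+j) m) = i.val v := fun j v m => fresh_val (by omega) v m
  have h3 : ∀ j v m, t.val (update v (k+j) m) = t.val v := fun j v m => fresh_val (by omega) v m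
  have := Sg.ex (k+1) (X := fun v a => ∃ b, s.val v = Nat.pair a b ∧ ∃ d,
      a = d * ((i.val v + 1) * b + 1) + t.val v ∧ t.val v < (i.val v + 1) * b + 1) (by simp [h1, h2, h3])
    (Sg.ex (k+2) (X := fun v b => s.val v = Nat.pair (v (k+1)) b ∧ ∃ d,
      v (k+1) = d * ((i.val v + 1) * b + 1) + t.val v ∧ t.val v < (i.val v + 1) * b + 1) (by simp [h1, h2, h3])
    (Sg.and (Sg.pair (.var (k+1)) (.var (k+2)) s)
    (Sg.ex (k+3) (X := fun v d => v (k+1) = d * ((i.val v + 1) * (v (k+2)) + 1) + t.val v ∧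
        t.val v < (i.val v + 1) * (v (k+2)) + 1) (by simp [h1, h2, h3])
      (Sg.and (Sg.eq (.var (k+1)) (.add (.mul (.var (k+3)) (.succ (.mul (.succ i) (.var (k+2))))) t))
       (Sg.lt t (.succ (.mul (.succ i) (.var (k+2)))))))))
  refine this.of_iff fun v => ?_
  unfold Nat.beta
  constructor
  · rintro ⟨a, b, h, d, rfl, h'⟩
    rw [h]
    simp only [Nat.unpair_pair]
    rw [Nat.add_mod, Nat.mul_mod_left, zero_add, Nat.mod_mod, Nat.mod_eq_of_lt h']
  · intro h
    refine ⟨_, _, (Nat.pair_unpair _).symm, (s.val v).unpair.1 / ((i.val v + 1) * (s.val v).unpair.2 + 1), ?_, ?_⟩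
    · rw [h, mul_comm, Nat.div_add_mod]
    · rw [h]; exact Nat.mod_lt _ (by omega)

def SF (F : (ℕ → ℕ) → ℕ) : Prop := (∃ b, ∀ k ≥ b, ∀ v m, F (update v k m) = F v) ∧ ∀ t : Term, Sg fun v => t.val v = F v

theorem SF.term (s : Term) : SF s.val := ⟨⟨fr s.fv, fun _ hk v m => fresh_val hk v m⟩, fun t => Sg.eq t s⟩

theorem Sg.comp3 {R : ℕ → ℕ → ℕ → Prop} (hR : ∀ s t u : Term, Sg fun v => R (s.val v) (t.val v) (u.val v))
    {F G H : (ℕ → ℕ) → ℕ} (hF : SF F) (hG : SF G) (hH : SF H) : Sg fun v => R (F v) (G v) (H v) := by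
  obtain ⟨⟨a, ha⟩, hF⟩ := hF
  obtain ⟨⟨b, hb⟩, hG⟩ := hG
  obtain ⟨⟨c, hc⟩, hH⟩ := hH
  obtain ⟨k, hk⟩ : ∃ k, k = a + b + c := ⟨_, rfl⟩
  have h1 : ∀ j v m, F (update v (k+j) m) = F v := fun j v m => ha _ (by omega) v m
  have h2 : ∀ j v m, G (update v (k+j) m) = G v := fun j v m => hb _ (by omega) v m
  have h3 : ∀ j v m, H (update v (k+j) m) = H v := fun j v m => hc _ (by omega) v m
  refine (Sg.ex (k+1) (X := fun v x => ∃ y, ∃ z, x = F v ∧ y = G v ∧ z = H v ∧ R x y z) (by simp [h1, h2, h3])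
    (Sg.ex (k+2) (X := fun v y => ∃ z, v (k+1) = F v ∧ y = G v ∧ z = H v ∧ R (v (k+1)) y z) (by simp [h1, h2, h3])
    (Sg.ex (k+3) (X := fun v z => v (k+1) = F v ∧ v (k+2) = G v ∧ z = H v ∧ R (v (k+1)) (v (k+2)) z) (by simp [h1, h2, h3])
    ((hF (.var (k+1))).and ((hG (.var (k+2))).and ((hH (.var (k+3))).and (hR (.var (k+1)) (.var (k+2)) (.var (k+3))))))))).of_iff fun v => ?_
  simp

theorem SF.pair {F G : (ℕ → ℕ) → ℕ} (hF : SF F) (hG : SF G) : SF fun v => Nat.pair (F v) (G v) := by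
  refine ⟨?_, fun t => Sg.comp3 (R := fun a b c => c = Nat.pair a b) Sg.pair hF hG (SF.term t)⟩
  obtain ⟨⟨a, ha⟩, hF⟩ := hF
  obtain ⟨⟨b, hb⟩, hG⟩ := hG
  exact ⟨a + b, fun k hk v m => by simp only; rw [ha _ (by omega), hb _ (by omega)]⟩

theorem SF.beta {F G : (ℕ → ℕ) → ℕ} (hF : SF F) (hG : SF G) : SF fun v => Nat.beta (F v) (G v) := by
  refine ⟨?_, fun t => Sg.comp3 (R := fun a b c => c = Nat.beta a b) Sg.beta hF hG (SF.term t)⟩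
  obtain ⟨⟨a, ha⟩, hF⟩ := hF
  obtain ⟨⟨b, hb⟩, hG⟩ := hG
  exact ⟨a + b, fun k hk v m => by simp only; rw [ha _ (by omega), hb _ (by omega)]⟩

theorem SgR.mem {f : ℕ →. ℕ} (hf : SgR f) {F G : (ℕ → ℕ) → ℕ} (hF : SF F) (hG : SF G) : Sg fun v => G v ∈ f (F v) :=
  Sg.comp3 (R := fun a b _ => b ∈ f a) (fun s t _ => hf s t) hF hG hG

theorem rec_iff (f g : ℕ →. ℕ) (a n z : ℕ) :
    z ∈ (Nat.rec (f a) (fun y IH => IH.bind fun i => g (Nat.pair a (Nat.pair y i))) n : Part ℕ) ↔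
    ∃ s, Nat.beta s 0 ∈ f a ∧ (∀ y < n, Nat.beta s (y+1) ∈ g (Nat.pair a (Nat.pair y (Nat.beta s y)))) ∧
      z = Nat.beta s n := by
  constructor
  · intro h
    have : ∃ c : ℕ → ℕ, c 0 ∈ f a ∧ (∀ y < n, c (y+1) ∈ g (Nat.pair a (Nat.pair y (c y)))) ∧ z = c n := by
      induction n generalizing z with
      | zero => exact ⟨fun _ => z, h, by simp, rfl⟩
      | succ n ih =>
        simp only [Part.mem_bind_iff] at h
        obtain ⟨i, hi, hz⟩ := h
        obtain ⟨c, h1, h2, h3⟩ := ih i hi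
        refine ⟨update c (n+1) z, by simpa using h1, ?_, by simp⟩
        intro y hy
        rcases Nat.lt_succ_iff_lt_or_eq.1 hy with h | h
        · simp [show y ≠ n + 1 by omega, show y ≠ n by omega, h2 y h]
        · subst h; simp [← h3, hz]
    obtain ⟨c, h1, h2, h3⟩ := this
    have hb : ∀ i ≤ n, Nat.beta (Nat.unbeta ((List.range (n+1)).map c)) i = c i := by
      intro i hi
      have := Nat.beta_unbeta_coe ((List.range (n+1)).map c) ⟨i, by simp; omega⟩
      simpa using this
    refine ⟨Nat.unbeta ((List.range (n+1)).map c), ?_, ?_, ?_⟩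
    · rw [hb _ (by omega)]; exact h1
    · intro y hy
      rw [hb _ (by omega), hb _ (by omega)]; exact h2 y hy
    · rw [hb _ le_rfl]; exact h3
  · rintro ⟨s, h1, h2, rfl⟩
    induction n with
    | zero => exact h1
    | succ n ih =>
      simp only [Part.mem_bind_iff]
      exact ⟨_, ih fun y hy => h2 y (by omega), h2 n (by omega)⟩

theorem sgR_of_partrec {f : ℕ →. ℕ} (hf : Nat.Partrec f) : SgR f := by
  induction hf with
  | zero => 
    intro s t
    refine (Sg.eq t .zero).of_iff fun v => ?_
    simp [Term.val, pure, PFun.pure]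
  | succ =>
    intro s t
    refine (Sg.eq t (.succ s)).of_iff fun v => ?_
    simp [Term.val]
  | left =>
    intro s t
    obtain ⟨k, hk⟩ : ∃ k, k = fr s.fv + fr t.fv := ⟨_, rfl⟩
    refine (Sg.ex k (X := fun v b => s.val v = Nat.pair (t.val v) b) ?_ (Sg.pair t (.var k) s)).of_iff fun v => ?_
    · intro v m n; rw [fresh_val (by omega), fresh_val (by omega)]
    · simp
      constructor
      · rintro ⟨b, h⟩; rw [h]; simp
      · intro h; exact ⟨(s.val v).unpair.2, by rw [h]; simp⟩
  | right =>
    intro s t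
    obtain ⟨k, hk⟩ : ∃ k, k = fr s.fv + fr t.fv := ⟨_, rfl⟩
    refine (Sg.ex k (X := fun v b => s.val v = Nat.pair b (t.val v)) ?_ (Sg.pair (.var k) t s)).of_iff fun v => ?_
    · intro v m n; rw [fresh_val (by omega), fresh_val (by omega)]
    · simp
      constructor
      · rintro ⟨b, h⟩; rw [h]; simp
      · intro h; exact ⟨(s.val v).unpair.1, by rw [h]; simp⟩
  | @pair f g _ _ hf hg =>
    intro s t
    obtain ⟨k, hk⟩ : ∃ k, k = fr s.fv + fr t.fv := ⟨_, rfl⟩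
    have h1 : ∀ j v m, s.val (update v (k+j) m) = s.val v := fun j v m => fresh_val (by omega) v m
    have h3 : ∀ j v m, t.val (update v (k+j) m) = t.val v := fun j v m => fresh_val (by omega) v m
    refine (Sg.ex (k+1) (X := fun v a => ∃ b, a ∈ f (s.val v) ∧ b ∈ g (s.val v) ∧ t.val v = Nat.pair a b)
      (by simp [h1, h3])
      (Sg.ex (k+2) (X := fun v b => v (k+1) ∈ f (s.val v) ∧ b ∈ g (s.val v) ∧ t.val v = Nat.pair (v (k+1)) b)
      (by simp [h1, h3]) ((hf s (.var (k+1))).and ((hg s (.var (k+2))).and (Sg.pair (.var (k+1)) (.var (k+2)) t))))).of_iff fun v => ?_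
    simp [Seq.seq, eq_comm]
  | @comp f g _ _ hf hg =>
    intro s t
    obtain ⟨k, hk⟩ : ∃ k, k = fr s.fv + fr t.fv := ⟨_, rfl⟩
    have h1 : ∀ j v m, s.val (update v (k+j) m) = s.val v := fun j v m => fresh_val (by omega) v m
    have h3 : ∀ j v m, t.val (update v (k+j) m) = t.val v := fun j v m => fresh_val (by omega) v m
    refine (Sg.ex (k+1) (X := fun v a => a ∈ g (s.val v) ∧ t.val v ∈ f a) (by simp [h1, h3])
      ((hg s (.var (k+1))).and (hf (.var (k+1)) t))).of_iff fun v => ?_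
    exact Part.mem_bind_iff.symm
  | @prec f g _ _ hf hg =>
    intro s t
    obtain ⟨k, hk⟩ : ∃ k, k = fr s.fv + fr t.fv := ⟨_, rfl⟩
    have h1 : ∀ j v m, s.val (update v (k+j) m) = s.val v := fun j v m => fresh_val (by omega) v m
    have h3 : ∀ j v m, t.val (update v (k+j) m) = t.val v := fun j v m => fresh_val (by omega) v m
    have V : ∀ j, SF fun v => v j := fun j => SF.term (.var j)
    have W : ∀ j, SF fun v => v j + 1 := fun j => SF.term (.succ (.var j))
    have a1 := hf.mem (V (k+1)) (SF.beta (V (k+3)) (SF.term .zero))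
    have a2 := Sg.ball (k+4) (.var (k+2)) (by simp [Term.fv])
      (X := fun v y => Nat.beta (v (k+3)) (y+1) ∈ g (Nat.pair (v (k+1)) (Nat.pair y (Nat.beta (v (k+3)) y))))
      (by simp)
      (hg.mem ((V (k+1)).pair ((V (k+4)).pair ((V (k+3)).beta (V (k+4))))) ((V (k+3)).beta (W (k+4))))
    have a3 := ((V (k+3)).beta (V (k+2))).2 t
    refine (Sg.ex (k+1) (X := fun v a => ∃ n, s.val v = Nat.pair a n ∧ ∃ c, Nat.beta c 0 ∈ f a ∧
        (∀ y < n, Nat.beta c (y+1) ∈ g (Nat.pair a (Nat.pair y (Nat.beta c y)))) ∧ t.val v = Nat.beta c n) (by simp [h1, h3])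
      (Sg.ex (k+2) (X := fun v n => s.val v = Nat.pair (v (k+1)) n ∧ ∃ c, Nat.beta c 0 ∈ f (v (k+1)) ∧
        (∀ y < n, Nat.beta c (y+1) ∈ g (Nat.pair (v (k+1)) (Nat.pair y (Nat.beta c y)))) ∧ t.val v = Nat.beta c n) (by simp [h1, h3])
      ((Sg.pair (.var (k+1)) (.var (k+2)) s).and
       (Sg.ex (k+3) (X := fun v c => Nat.beta c 0 ∈ f (v (k+1)) ∧
        (∀ y < v (k+2), Nat.beta c (y+1) ∈ g (Nat.pair (v (k+1)) (Nat.pair y (Nat.beta c y)))) ∧ t.val v = Nat.beta c (v (k+2))) (by simp [h1, h3])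
        (a1.and (a2.and a3)))))).of_iff fun v => ?_
    simp only [← rec_iff]
    constructor
    · rintro ⟨a, n, h, h'⟩
      rw [h]
      simpa [Nat.unpaired] using h'
    · intro h
      exact ⟨_, _, (Nat.pair_unpair _).symm, by simpa [Nat.unpaired] using h⟩
  | @rfind f _ hf =>
    intro s t
    obtain ⟨k, hk⟩ : ∃ k, k = fr s.fv + fr t.fv := ⟨_, rfl⟩
    have h1 : ∀ j v m, s.val (update v (k+j) m) = s.val v := fun j v m => fresh_val (by omega) v m
    have h3 : ∀ j v m, t.val (update v (k+j) m) = t.val v := fun j v m => fresh_val (by omega) v m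
    have a1 := Sg.ex (k+1) (X := fun v p => p = Nat.pair (s.val v) (t.val v) ∧ 0 ∈ f p) (by simp [h1, h3])
      ((Sg.pair s t (.var (k+1))).and (hf (.var (k+1)) .zero))
    have a2 := Sg.ball (k+2) t (not_mem_of_ge (by omega)) (X := fun v m => ∃ p, p = Nat.pair (s.val v) m ∧ ∃ j, j + 1 ∈ f p)
      (by simp [h1, h3])
      (Sg.ex (k+1) (X := fun v p => p = Nat.pair (s.val v) (v (k+2)) ∧ ∃ j, j + 1 ∈ f p) (by simp [h1, h3])
        ((Sg.pair s (.var (k+2)) (.var (k+1))).and (Sg.ex (k+3) (X := fun v j => j + 1 ∈ f (v (k+1))) (by simp)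
          (hf (.var (k+1)) (.succ (.var (k+3)))))))
    refine (a1.and a2).of_iff fun v => ?_
    have e1 : true ∈ (Part.map (fun m => decide (m = 0)) (f (Nat.pair (s.val v) (t.val v)))) ↔ 0 ∈ f (Nat.pair (s.val v) (t.val v)) := by
      simp
    have e2 : ∀ m, false ∈ (Part.map (fun m => decide (m = 0)) (f (Nat.pair (s.val v) m))) ↔ ∃ j, j + 1 ∈ f (Nat.pair (s.val v) m) := by
      intro m
      simp only [Part.mem_map_iff, decide_eq_false_iff_not]
      constructor
      · rintro ⟨a, h, h'⟩
        exact ⟨a - 1, by rwa [Nat.sub_add_cancel (by omega)]⟩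
      · rintro ⟨j, h⟩; exact ⟨_, h, by omega⟩
    refine Iff.trans ?_ Nat.mem_rfind.symm
    simp only [exists_eq_left]
    exact and_congr e1.symm (forall_congr' fun m => imp_congr_right fun _ => (e2 m).symm)

end ModalArith

namespace ModalArith

open Formula
open Function (update)

/-- Normal form for `Σ₁` formulas in the standard model. -/
theorem sigma1_nf {φ : Formula} (h : IsSigma1 φ) : ∃ b, ∀ w ≥ b, ∃ δ : Formula, IsDelta0 δ ∧
    (∀ v, φ.val v ↔ ∃ n, δ.val (update v w n)) ∧
    (∀ v n m, n ≤ m → δ.val (update v w n) → δ.val (update v w m)) := by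
  induction h with
  | @delta0 φ h =>
    refine ⟨fr φ.fv, fun w hw => ⟨φ, h, fun v => ?_, fun v n m _ => ?_⟩⟩
    · simp [Formula.val_update (not_mem_of_ge hw)]
    · simp [Formula.val_update (not_mem_of_ge hw)]
  | @and φ ψ _ _ ih1 ih2 =>
    obtain ⟨b1, ih1⟩ := ih1
    obtain ⟨b2, ih2⟩ := ih2
    refine ⟨b1 + b2, fun w hw => ?_⟩
    obtain ⟨δ1, d1, e1, m1⟩ := ih1 w (by omega)
    obtain ⟨δ2, d2, e2, m2⟩ := ih2 w (by omega)
    refine ⟨_, .and d1 d2, fun v => ?_, fun v n m h h' => ⟨m1 v n m h h'.1, m2 v n m h h'.2⟩⟩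
    simp only [Formula.val, e1, e2]
    constructor
    · rintro ⟨⟨n, h⟩, ⟨m, h'⟩⟩
      exact ⟨max n m, m1 v _ _ (le_max_left _ _) h, m2 v _ _ (le_max_right _ _) h'⟩
    · rintro ⟨n, h, h'⟩; exact ⟨⟨n, h⟩, ⟨n, h'⟩⟩
  | @or φ ψ _ _ ih1 ih2 =>
    obtain ⟨b1, ih1⟩ := ih1
    obtain ⟨b2, ih2⟩ := ih2
    refine ⟨b1 + b2, fun w hw => ?_⟩
    obtain ⟨δ1, d1, e1, m1⟩ := ih1 w (by omega)
    obtain ⟨δ2, d2, e2, m2⟩ := ih2 w (by omega)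
    refine ⟨_, .or d1 d2, fun v => ?_, fun v n m h h' => h'.imp (m1 v n m h) (m2 v n m h)⟩
    simp only [Formula.val, e1, e2, exists_or]
  | @ex x φ _ ih =>
    obtain ⟨b, ih⟩ := ih
    refine ⟨b + x + 1, fun w hw => ?_⟩
    obtain ⟨δ, d, e, mo⟩ := ih w (by omega)
    have hxw : x ≠ w := by omega
    have hx : x ∉ (Term.var w).fv := by simp [Term.fv, hxw]
    refine ⟨_, .bex hx d, fun v => ?_, fun v n m h => ?_⟩
    · simp only [val_bex hx, Formula.val, e, Term.val, Function.update_self]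
      constructor
      · rintro ⟨a, n, h⟩
        refine ⟨max (a + 1) n, a, by omega, ?_⟩
        rw [Function.update_comm hxw.symm]
        exact mo _ _ _ (le_max_right _ _) h
      · rintro ⟨n, a, _, h⟩
        rw [Function.update_comm hxw.symm] at h
        exact ⟨a, n, h⟩
    · simp only [val_bex hx, Term.val, Function.update_self]
      rintro ⟨a, h1, h2⟩
      rw [Function.update_comm hxw.symm] at h2
      refine ⟨a, by omega, ?_⟩
      rw [Function.update_comm hxw.symm]
      exact mo _ _ _ h h2
  | @ball x t φ hx _ ih =>
    obtain ⟨b, ih⟩ := ih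
    refine ⟨b + x + 1 + fr t.fv, fun w hw => ?_⟩
    obtain ⟨δ, d, e, mo⟩ := ih w (by omega)
    have hxw : x ≠ w := by omega
    have ht : ∀ v n, t.val (update v w n) = t.val v := fun v n => fresh_val (by omega) v n
    refine ⟨_, .ball hx d, fun v => ?_, fun v n m h => ?_⟩
    · simp only [val_ball hx, e, ht]
      constructor
      · intro h
        choose! g hg using h
        refine ⟨(Finset.range (t.val v)).sup g, fun a ha => ?_⟩
        rw [Function.update_comm hxw.symm]
        exact mo _ _ _ (Finset.le_sup (f := g) (Finset.mem_range.2 ha)) (hg a ha)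
      · rintro ⟨n, h⟩ a ha
        refine ⟨n, ?_⟩
        rw [Function.update_comm hxw]
        exact h a ha
    · simp only [val_ball hx, ht]
      intro h2 a ha
      have := h2 a ha
      rw [Function.update_comm hxw.symm] at this ⊢
      exact mo _ _ _ h this

theorem close_off (s : Finset ℕ) : ∀ {δ : Formula}, IsDelta0 δ → ∃ δ' : Formula, IsDelta0 δ' ∧ δ'.fv ⊆ δ.fv \ s ∧
    ∀ v, δ'.val v ↔ δ.val (fun z => if z ∈ s then 0 else v z) := by
  induction s using Finset.induction_on with
  | empty => intro δ h; exact ⟨δ, h, by simp, by simp⟩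
  | insert a s ha ih =>
    intro δ h
    obtain ⟨δ', h1, h2, h3⟩ := ih h
    have hx : a ∉ (Term.succ Term.zero).fv := by simp [Term.fv]
    refine ⟨_, .bex (x := a) (t := .succ .zero) hx h1, ?_, ?_⟩
    · intro z hz
      simp [bex, Formula.fv, Term.fv, Formula.lt] at hz
      have := h2 hz.2
      simp_all
    · intro v
      simp only [val_bex hx, Term.val, h3]
      have : ∀ v : ℕ → ℕ, (fun z => if z ∈ s then 0 else update v a 0 z) = (fun z => if z ∈ insert a s then 0 else v z) := by
        intro v; funext z
        by_cases hz : z = a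
        · subst hz; simp [ha]
        · simp [hz]
      simp [this]

theorem Sg.delta0 {X : ℕ → Prop} {p y : ℕ} (hpy : p ≠ y) (h : Sg fun v => X (v p)) :
    ∃ δ : Formula, IsDelta0 δ ∧ δ.fv ⊆ {p, y} ∧ ∀ v, X (v p) ↔ ∃ n, δ.val (update v y n) := by
  obtain ⟨φ, hφ, hX⟩ := h
  obtain ⟨b, hb⟩ := sigma1_nf hφ
  obtain ⟨w, hw⟩ : ∃ w, w = b + p + y + 1 := ⟨_, rfl⟩
  obtain ⟨δ, d, e, _⟩ := hb w (by omega)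
  obtain ⟨δ', d', f', e'⟩ := close_off (δ.fv \ {p, w}) d
  have hx : w ∉ (Term.succ (.var y)).fv := by simp [Term.fv]; omega
  have fv' : δ'.fv ⊆ {p, w} := by
    intro z hz
    have := f' hz
    simp at this ⊢; tauto
  refine ⟨_, .bex hx d', ?_, fun v => ?_⟩
  · intro z hz
    simp [bex, Formula.fv, Term.fv, Formula.lt] at hz ⊢
    rcases hz with ⟨h1, h2⟩
    rcases h2 with h2 | h2
    · exact Or.inr h2
    · have := fv' h2; simp at this; tauto
  · have key : X (v p) ↔ ∃ m, δ'.val (update v w m) := by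
      have := (hX fun z => if z ∈ δ.fv \ {p, w} then 0 else v z).symm.trans (e _)
      simp only [e']
      simp only [Finset.mem_sdiff, Finset.mem_insert, true_or, not_true, and_false, if_false] at this ⊢
      rw [this]
      refine exists_congr fun m => ?_
      have : ∀ u u' : ℕ → ℕ, u = u' → (δ.val u ↔ δ.val u') := by rintro u _ rfl; rfl
      apply this
      funext z
      by_cases hz : z = w
      · subst hz; simp
      · simp [hz]
    rw [key]
    simp only [val_bex hx, Term.val, Function.update_self]
    have c : ∀ n m, δ'.val (update (update v y n) w m) ↔ δ'.val (update v w m) := by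
      intro n m
      apply Formula.val_congr
      intro z hz
      have := fv' hz
      simp at this
      rcases this with rfl | rfl
      · simp [show z ≠ w by omega, hpy]
      · simp
    simp only [c]
    constructor
    · rintro ⟨m, h⟩; exact ⟨m, m, by omega, h⟩
    · rintro ⟨n, m, _, h⟩; exact ⟨m, h⟩

end ModalArith

namespace ModalArith

open Formula
open Function (update)

/-! ### Decoding -/

theorem unpair_snd_lt {n : ℕ} (h : n.unpair.1 ≠ 0) : n.unpair.2 < n := by
  conv_rhs => rw [← Nat.pair_unpair n]
  have := Nat.add_le_pair n.unpair.1 n.unpair.2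
  omega

/-- Total decoder for terms. -/
def decT (n : ℕ) : Term :=
  if h0 : n.unpair.1 = 0 then .var n.unpair.2
  else if n.unpair.1 = 2 then .succ (decT n.unpair.2)
  else if n.unpair.1 = 3 then .add (decT n.unpair.2.unpair.1) (decT n.unpair.2.unpair.2)
  else if n.unpair.1 = 4 then .mul (decT n.unpair.2.unpair.1) (decT n.unpair.2.unpair.2)
  else .zero
termination_by n
decreasing_by
  all_goals
    have := unpair_snd_lt h0
    have := Nat.unpair_left_le n.unpair.2
    have := Nat.unpair_right_le n.unpair.2
    omega

/-- Total decoder for formulas. -/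
def dec (n : ℕ) : Formula :=
  if h0 : n.unpair.1 = 0 then .falsum
  else if n.unpair.1 = 1 then .eq (decT n.unpair.2.unpair.1) (decT n.unpair.2.unpair.2)
  else if n.unpair.1 = 2 then .le (decT n.unpair.2.unpair.1) (decT n.unpair.2.unpair.2)
  else if n.unpair.1 = 3 then .and (dec n.unpair.2.unpair.1) (dec n.unpair.2.unpair.2)
  else if n.unpair.1 = 4 then .or (dec n.unpair.2.unpair.1) (dec n.unpair.2.unpair.2)
  else if n.unpair.1 = 5 then .imp (dec n.unpair.2.unpair.1) (dec n.unpair.2.unpair.2)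
  else if n.unpair.1 = 6 then .neg (dec n.unpair.2)
  else if n.unpair.1 = 7 then .all n.unpair.2.unpair.1 (dec n.unpair.2.unpair.2)
  else if n.unpair.1 = 8 then .ex n.unpair.2.unpair.1 (dec n.unpair.2.unpair.2)
  else .box (dec n.unpair.2)
termination_by n
decreasing_by
  all_goals
    have := unpair_snd_lt h0
    have := Nat.unpair_left_le n.unpair.2
    have := Nat.unpair_right_le n.unpair.2
    omega

theorem decT_var (x : ℕ) : decT (Nat.pair 0 x) = .var x := by rw [decT]; simp
theorem decT_zero (x : ℕ) : decT (Nat.pair 1 x) = .zero := by rw [decT]; simp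
theorem decT_succ (x : ℕ) : decT (Nat.pair 2 x) = .succ (decT x) := by rw [decT]; simp
theorem decT_add (x y : ℕ) : decT (Nat.pair 3 (Nat.pair x y)) = .add (decT x) (decT y) := by rw [decT]; simp
theorem decT_mul (x y : ℕ) : decT (Nat.pair 4 (Nat.pair x y)) = .mul (decT x) (decT y) := by rw [decT]; simp
theorem dec_falsum (x : ℕ) : dec (Nat.pair 0 x) = .falsum := by rw [dec]; simp
theorem dec_eq (x y : ℕ) : dec (Nat.pair 1 (Nat.pair x y)) = .eq (decT x) (decT y) := by rw [dec]; simp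
theorem dec_le (x y : ℕ) : dec (Nat.pair 2 (Nat.pair x y)) = .le (decT x) (decT y) := by rw [dec]; simp
theorem dec_and (x y : ℕ) : dec (Nat.pair 3 (Nat.pair x y)) = .and (dec x) (dec y) := by rw [dec]; simp
theorem dec_or (x y : ℕ) : dec (Nat.pair 4 (Nat.pair x y)) = .or (dec x) (dec y) := by rw [dec]; simp
theorem dec_imp (x y : ℕ) : dec (Nat.pair 5 (Nat.pair x y)) = .imp (dec x) (dec y) := by rw [dec]; simp
theorem dec_neg (x : ℕ) : dec (Nat.pair 6 x) = .neg (dec x) := by rw [dec]; simp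
theorem dec_all (x y : ℕ) : dec (Nat.pair 7 (Nat.pair x y)) = .all x (dec y) := by rw [dec]; simp
theorem dec_ex (x y : ℕ) : dec (Nat.pair 8 (Nat.pair x y)) = .ex x (dec y) := by rw [dec]; simp
theorem dec_box (x : ℕ) : dec (Nat.pair 9 x) = .box (dec x) := by rw [dec]; simp

theorem decT_code (t : Term) : decT t.code = t := by
  induction t <;> simp_all [Term.code, decT_var, decT_zero, decT_succ, decT_add, decT_mul]

theorem dec_code (φ : Formula) : dec φ.code = φ := by
  induction φ <;> simp_all [Formula.code, dec_falsum, dec_eq, dec_le, dec_and, dec_or, dec_imp, dec_neg, dec_all,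
    dec_ex, dec_box, decT_code]

/-! ### Patterns -/

inductive Ex : Type
  | arg : Fin 4 → Ex
  | const : ℕ → Ex
  | pair : Ex → Ex → Ex
  | add : Ex → Ex → Ex

namespace Ex

def eval (a : Fin 4 → ℕ) : Ex → ℕ
  | arg i => a i
  | const n => n
  | pair e f => Nat.pair (e.eval a) (f.eval a)
  | add e f => e.eval a + f.eval a

def bin (k : ℕ) (e f : Ex) : Ex := pair (const k) (pair e f)
def un (k : ℕ) (e : Ex) : Ex := pair (const k) e

def x0 : Ex := arg 0
def x1 : Ex := arg 1
def x2 : Ex := arg 2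
def x3 : Ex := arg 3
def dm : Ex := bin 1 (const 0) (un 0 (const 0))
/-- theorem -/
def th (e : Ex) : Ex := un 0 e
/-- variable not free in formula -/
def nf (x e : Ex) : Ex := bin 1 x e
/-- variable not in term -/
def nt (x e : Ex) : Ex := bin 2 x e
/-- numeral code -/
def nu (x e : Ex) : Ex := bin 3 x e
def sub1 (e f : Ex) : Ex := add (add e f) (const 1)
def eqE (e f : Ex) : Ex := bin 1 e f
def impE (e f : Ex) : Ex := bin 5 e f

def schemes : List (Ex × Ex × Ex) := [
  -- 0
  (dm, dm, nt x0 (un 0 (sub1 x0 x1))),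
  (dm, dm, nt (sub1 x0 x1) (un 0 x0)),
  (dm, dm, nt x0 (un 1 (const 0))),
  (nt x0 x1, dm, nt x0 (un 2 x1)),
  (nt x0 x1, nt x0 x2, nt x0 (bin 3 x1 x2)),
  (nt x0 x1, nt x0 x2, nt x0 (bin 4 x1 x2)),
  -- 6
  (dm, dm, nf x0 (un 0 (const 0))),
  (nt x0 x1, nt x0 x2, nf x0 (bin 1 x1 x2)),
  (nt x0 x1, nt x0 x2, nf x0 (bin 2 x1 x2)),
  (nf x0 x1, nf x0 x2, nf x0 (bin 3 x1 x2)),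
  (nf x0 x1, nf x0 x2, nf x0 (bin 4 x1 x2)),
  (nf x0 x1, nf x0 x2, nf x0 (bin 5 x1 x2)),
  (nf x0 x1, dm, nf x0 (un 6 x1)),
  (nf x0 x1, dm, nf x0 (un 9 x1)),
  (dm, dm, nf x0 (bin 7 x0 x1)),
  (dm, dm, nf x0 (bin 8 x0 x1)),
  (nf x0 x1, dm, nf x0 (bin 7 x2 x1)),
  (nf x0 x1, dm, nf x0 (bin 8 x2 x1)),
  -- 18
  (dm, dm, nu (const 0) (un 1 (const 0))),
  (nu x0 x1, dm, nu (add x0 (const 1)) (un 2 x1)),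
  -- 20: propositional axioms
  (dm, dm, th (impE x0 (impE x1 x0))),
  (dm, dm, th (impE (impE x0 (impE x1 x2)) (impE (impE x0 x1) (impE x0 x2)))),
  (dm, dm, th (impE (un 6 (un 6 x0)) x0)),
  (dm, dm, th (impE (impE x0 x1) (impE (impE x0 (un 6 x1)) (un 6 x0)))),
  (dm, dm, th (impE (un 6 x0) (impE x0 x1))),
  (dm, dm, th (impE (un 0 (const 0)) x0)),
  (dm, dm, th (impE x0 (impE x1 (bin 3 x0 x1)))),
  (dm, dm, th (impE (bin 3 x0 x1) x0)),
  (dm, dm, th (impE (bin 3 x0 x1) x1)),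
  (dm, dm, th (impE x0 (bin 4 x0 x1))),
  (dm, dm, th (impE x1 (bin 4 x0 x1))),
  (dm, dm, th (impE (impE x0 x2) (impE (impE x1 x2) (impE (bin 4 x0 x1) x2)))),
  -- 32: rules
  (th (impE x0 x1), th x0, th x1),
  (th x1, dm, th (bin 7 x0 x1)),
  (th x0, dm, th (un 9 x0)),
  -- 35
  (dm, dm, th (impE (un 9 (impE x0 x1)) (impE (un 9 x0) (un 9 x1)))),
  (dm, dm, th (impE (bin 7 x0 x1) x1)),
  (nf x0 x1, dm, th (impE (bin 7 x0 (impE x1 x2)) (impE x1 (bin 7 x0 x2)))),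
  (dm, dm, th (impE x1 (bin 8 x0 x1))),
  (nf x0 x2, dm, th (impE (bin 7 x0 (impE x1 x2)) (impE (bin 8 x0 x1) x2))),
  (nt x0 x1, dm, th (bin 8 x0 (eqE (un 0 x0) x1))),
  -- 41
  (dm, dm, th (eqE x0 x0)),
  (dm, dm, th (impE (eqE x0 x1) (eqE x1 x0))),
  (dm, dm, th (impE (eqE x0 x1) (impE (eqE x1 x2) (eqE x0 x2)))),
  (dm, dm, th (impE (eqE x0 x1) (eqE (un 2 x0) (un 2 x1)))),
  (dm, dm, th (impE (eqE x0 x1) (impE (eqE x2 x3) (eqE (bin 3 x0 x2) (bin 3 x1 x3))))),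
  (dm, dm, th (impE (eqE x0 x1) (impE (eqE x2 x3) (eqE (bin 4 x0 x2) (bin 4 x1 x3))))),
  (dm, dm, th (impE (eqE x0 x1) (impE (eqE x2 x3) (impE (bin 2 x0 x2) (bin 2 x1 x3))))),
  (dm, dm, th (impE (eqE x0 x1) (un 9 (eqE x0 x1))))]

end Ex

open Ex in
inductive S (T : Set Formula) : ℕ → Prop
  | start : S T (Nat.pair 1 (Nat.pair 0 (Nat.pair 0 0)))
  | rule {s : Ex × Ex × Ex} (hs : s ∈ schemes) (a : Fin 4 → ℕ) :
      S T (s.1.eval a) → S T (s.2.1.eval a) → S T (s.2.2.eval a)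
  | ax {φ : Formula} : φ ∈ T → S T (Nat.pair 0 φ.code)

/-- Intended meaning of the items. -/
def Mean (T : Set Formula) (c : ℕ) : Prop :=
  (c.unpair.1 = 0 → Provable T (dec c.unpair.2)) ∧
  (c.unpair.1 = 1 → c.unpair.2.unpair.1 ∉ (dec c.unpair.2.unpair.2).fv) ∧
  (c.unpair.1 = 2 → c.unpair.2.unpair.1 ∉ (decT c.unpair.2.unpair.2).fv) ∧
  (c.unpair.1 = 3 → c.unpair.2.unpair.2 = (Term.numeral c.unpair.2.unpair.1).code)

theorem Mean_th (T : Set Formula) (c : ℕ) : Mean T (Nat.pair 0 c) ↔ Provable T (dec c) := by simp [Mean]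
theorem Mean_nf (T : Set Formula) (x c : ℕ) : Mean T (Nat.pair 1 (Nat.pair x c)) ↔ x ∉ (dec c).fv := by simp [Mean]
theorem Mean_nt (T : Set Formula) (x c : ℕ) : Mean T (Nat.pair 2 (Nat.pair x c)) ↔ x ∉ (decT c).fv := by simp [Mean]
theorem Mean_nu (T : Set Formula) (x c : ℕ) : Mean T (Nat.pair 3 (Nat.pair x c)) ↔ c = (Term.numeral x).code := by simp [Mean]

section
variable {T : Set Formula}

open Ex in
theorem schemes_sound (hP : Lg (Provable T)) : ∀ s ∈ schemes, ∀ a, Mean T (s.1.eval a) → Mean T (s.2.1.eval a) →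
    Mean T (s.2.2.eval a) := by
  simp only [schemes, List.forall_mem_cons, eval, bin, un, dm, th, nf, nt, nu, sub1,
    eqE, impE, x0, x1, x2, x3, Mean_th, Mean_nf, Mean_nt, Mean_nu, decT_var, decT_zero, decT_succ, decT_add, decT_mul,
    dec_falsum, dec_eq, dec_le, dec_and, dec_or, dec_imp, dec_neg, dec_all, dec_ex, dec_box]
  refine ⟨?_, ?_, ?_, ?_, ?_, ?_, ?_, ?_, ?_, ?_, ?_, ?_, ?_, ?_, ?_, ?_, ?_, ?_, ?_, ?_, ?_, ?_, ?_, ?_, ?_, ?_, ?_,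
    ?_, ?_, ?_, ?_, ?_, fun _ => hP.mp _ _, fun _ h _ => hP.gen _ _ h, fun _ h _ => hP.nec _ h, 
    fun _ _ _ => hP.K _ _, fun _ _ _ => hP.allSelf _ _, fun _ h _ => hP.allImp _ _ _ h, fun _ _ _ => hP.exSelf _ _,
    fun _ h _ => hP.exE _ _ _ h, fun _ h _ => hP.exEq _ _ h,
    fun _ _ _ => hP.eqRefl _, fun _ _ _ => hP.eqSymm _ _, fun _ _ _ => hP.eqTrans _ _ _, fun _ _ _ => hP.eqSucc _ _,
    fun _ _ _ => hP.eqAdd _ _ _ _, fun _ _ _ => hP.eqMul _ _ _ _, fun _ _ _ => hP.eqLe _ _ _ _, fun _ _ _ => hP.eqBox _ _, by simp⟩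
  · intro a _ _; simp [Term.fv]; omega
  · intro a _ _; simp [Term.fv]; omega
  · intro a _ _; simp [Term.fv]
  · intro a h _; simpa [Term.fv] using h
  · intro a h h'; simp [Term.fv, h, h']
  · intro a h h'; simp [Term.fv, h, h']
  · intro a _ _; simp [Formula.fv]
  · intro a h h'; simp [Formula.fv, h, h']
  · intro a h h'; simp [Formula.fv, h, h']
  · intro a h h'; simp [Formula.fv, h, h']
  · intro a h h'; simp [Formula.fv, h, h']
  · intro a h h'; simp [Formula.fv, h, h']
  · intro a h h'; simpa [Formula.fv] using h
  · intro a h h'; simpa [Formula.fv] using h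
  · intro a h h'; simp [Formula.fv]
  · intro a h h'; simp [Formula.fv]
  · intro a h h'; simp [Formula.fv, h]
  · intro a h h'; simp [Formula.fv, h]
  · intro a _ _; rfl
  · intro a h _; rw [h]; rfl
  · intro a _ _; exact hP.prop _ (.imp1 _ _)
  · intro a _ _; exact hP.prop _ (.imp2 _ _ _)
  · intro a _ _; exact hP.prop _ (.dne _)
  · intro a _ _; exact hP.prop _ (.negI _ _)
  · intro a _ _; exact hP.prop _ (.negE _ _)
  · intro a _ _; exact hP.prop _ (.falsumE _)
  · intro a _ _; exact hP.prop _ (.andI _ _)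
  · intro a _ _; exact hP.prop _ (.andE1 _ _)
  · intro a _ _; exact hP.prop _ (.andE2 _ _)
  · intro a _ _; exact hP.prop _ (.orI1 _ _)
  · intro a _ _; exact hP.prop _ (.orI2 _ _)
  · intro a _ _; exact hP.prop _ (.orE _ _ _)

theorem S.mean (hP : Lg (Provable T)) {c : ℕ} (h : S T c) : Mean T c := by
  induction h with
  | start => rw [Mean_nf]; simp [dec_falsum, Formula.fv]
  | rule hs a _ _ h1 h2 => exact schemes_sound hP _ hs a h1 h2
  | ax h => rw [Mean_th, dec_code]; exact .ax h

def ar (x y z w : ℕ) : Fin 4 → ℕ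
  | 0 => x
  | 1 => y
  | 2 => z
  | 3 => w

open Ex in
theorem S.app (i : ℕ) {p q r : Ex} (h : schemes[i]? = some (p, q, r)) (x y z w : ℕ) (h1 : S T (p.eval (ar x y z w)))
    (h2 : S T (q.eval (ar x y z w))) : S T (r.eval (ar x y z w)) :=
  S.rule (s := (p, q, r)) (List.mem_of_getElem? h) (ar x y z w) h1 h2

theorem S.notMemT {x : ℕ} {t : Term} (h : x ∉ t.fv) : S T (Nat.pair 2 (Nat.pair x t.code)) := by
  induction t with
  | var y =>
    simp [Term.fv] at h
    rcases Nat.lt_or_gt_of_ne h with h | h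
    · obtain ⟨k, rfl⟩ := Nat.exists_eq_add_of_lt h
      exact S.app 0 rfl x k 0 0 .start .start
    · obtain ⟨k, rfl⟩ := Nat.exists_eq_add_of_lt h
      exact S.app 1 rfl y k 0 0 .start .start
  | zero => exact S.app 2 rfl x 0 0 0 .start .start
  | succ t ih => exact S.app 3 rfl x t.code 0 0 (ih h) .start
  | add t u ih ih' =>
    simp [Term.fv] at h
    exact S.app 4 rfl x t.code u.code 0 (ih h.1) (ih' h.2)
  | mul t u ih ih' =>
    simp [Term.fv] at h
    exact S.app 5 rfl x t.code u.code 0 (ih h.1) (ih' h.2)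

theorem S.notMem {x : ℕ} {φ : Formula} (h : x ∉ φ.fv) : S T (Nat.pair 1 (Nat.pair x φ.code)) := by
  induction φ with
  | falsum => exact S.app 6 rfl x 0 0 0 .start .start
  | eq t u =>
    simp [Formula.fv] at h
    exact S.app 7 rfl x t.code u.code 0 (S.notMemT h.1) (S.notMemT h.2)
  | le t u =>
    simp [Formula.fv] at h
    exact S.app 8 rfl x t.code u.code 0 (S.notMemT h.1) (S.notMemT h.2)
  | and t u ih ih' =>
    simp [Formula.fv] at h
    exact S.app 9 rfl x t.code u.code 0 (ih h.1) (ih' h.2)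
  | or t u ih ih' =>
    simp [Formula.fv] at h
    exact S.app 10 rfl x t.code u.code 0 (ih h.1) (ih' h.2)
  | imp t u ih ih' =>
    simp [Formula.fv] at h
    exact S.app 11 rfl x t.code u.code 0 (ih h.1) (ih' h.2)
  | neg t ih => exact S.app 12 rfl x t.code 0 0 (ih h) .start
  | box t ih => exact S.app 13 rfl x t.code 0 0 (ih h) .start
  | all y t ih =>
    by_cases hx : x = y
    · subst hx; exact S.app 14 rfl x t.code 0 0 .start .start
    · exact S.app 16 rfl x t.code y 0 (ih (by simpa [Formula.fv, hx] using h)) .start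
  | ex y t ih =>
    by_cases hx : x = y
    · subst hx; exact S.app 15 rfl x t.code 0 0 .start .start
    · exact S.app 17 rfl x t.code y 0 (ih (by simpa [Formula.fv, hx] using h)) .start

theorem S.num (n : ℕ) : S T (Nat.pair 3 (Nat.pair n (Term.numeral n).code)) := by
  induction n with
  | zero => exact S.app 18 rfl 0 0 0 0 .start .start
  | succ n ih => exact S.app 19 rfl n _ 0 0 ih .start

theorem S.lg : Lg (fun φ => S T (Nat.pair 0 φ.code)) where
  prop φ h := by
    cases h with
    | imp1 φ ψ => exact S.app 20 rfl φ.code ψ.code 0 0 .start .start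
    | imp2 φ ψ χ => exact S.app 21 rfl φ.code ψ.code χ.code 0 .start .start
    | dne φ => exact S.app 22 rfl φ.code 0 0 0 .start .start
    | negI φ ψ => exact S.app 23 rfl φ.code ψ.code 0 0 .start .start
    | negE φ ψ => exact S.app 24 rfl φ.code ψ.code 0 0 .start .start
    | falsumE φ => exact S.app 25 rfl φ.code 0 0 0 .start .start
    | andI φ ψ => exact S.app 26 rfl φ.code ψ.code 0 0 .start .start
    | andE1 φ ψ => exact S.app 27 rfl φ.code ψ.code 0 0 .start .start
    | andE2 φ ψ => exact S.app 28 rfl φ.code ψ.code 0 0 .start .start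
    | orI1 φ ψ => exact S.app 29 rfl φ.code ψ.code 0 0 .start .start
    | orI2 φ ψ => exact S.app 30 rfl φ.code ψ.code 0 0 .start .start
    | orE φ ψ χ => exact S.app 31 rfl φ.code ψ.code χ.code 0 .start .start
  mp φ ψ h h' := S.app 32 rfl φ.code ψ.code 0 0 h h'
  gen x φ h := S.app 33 rfl x φ.code 0 0 h .start
  nec φ h := S.app 34 rfl φ.code 0 0 0 h .start
  K φ ψ := S.app 35 rfl φ.code ψ.code 0 0 .start .start
  allSelf x φ := S.app 36 rfl x φ.code 0 0 .start .start
  allImp x φ ψ h := S.app 37 rfl x φ.code ψ.code 0 (S.notMem h) .start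
  exSelf x φ := S.app 38 rfl x φ.code 0 0 .start .start
  exE x φ ψ h := S.app 39 rfl x φ.code ψ.code 0 (S.notMem h) .start
  exEq x t h := S.app 40 rfl x t.code 0 0 (S.notMemT h) .start
  eqRefl t := S.app 41 rfl t.code 0 0 0 .start .start
  eqSymm t u := S.app 42 rfl t.code u.code 0 0 .start .start
  eqTrans t u w := S.app 43 rfl t.code u.code w.code 0 .start .start
  eqSucc t u := S.app 44 rfl t.code u.code 0 0 .start .start
  eqAdd t u t' u' := S.app 45 rfl t.code u.code t'.code u'.code .start .start
  eqMul t u t' u' := S.app 46 rfl t.code u.code t'.code u'.code .start .start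
  eqLe t u t' u' := S.app 47 rfl t.code u.code t'.code u'.code .start .start
  eqBox t u := S.app 48 rfl t.code u.code 0 0 .start .start

theorem S.complete {φ : Formula} (h : Provable T φ) : S T (Nat.pair 0 φ.code) := by
  have hP := S.lg (T := T)
  induction h with
  | ax h => exact .ax h
  | mp _ _ h1 h2 => exact hP.mp _ _ h1 h2
  | gen x _ h => exact hP.gen _ _ h
  | nec _ h => exact hP.nec _ h
  | @logic φ h =>
    cases h with
    | imp1 φ ψ => exact hP.prop _ (.imp1 _ _)
    | imp2 φ ψ χ => exact hP.prop _ (.imp2 _ _ _)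
    | dne φ => exact hP.prop _ (.dne _)
    | negI φ ψ => exact hP.prop _ (.negI _ _)
    | negE φ ψ => exact hP.prop _ (.negE _ _)
    | falsumE φ => exact hP.prop _ (.falsumE _)
    | negIntro φ => exact hP.taut fun w h => by rw [h.imp, h.imp, h.neg, h.falsum]; tauto
    | negElimFalsum φ => exact hP.taut fun w h => by rw [h.imp, h.imp, h.neg, h.falsum]; tauto
    | andI φ ψ => exact hP.prop _ (.andI _ _)
    | andE1 φ ψ => exact hP.prop _ (.andE1 _ _)
    | andE2 φ ψ => exact hP.prop _ (.andE2 _ _)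
    | orI1 φ ψ => exact hP.prop _ (.orI1 _ _)
    | orI2 φ ψ => exact hP.prop _ (.orI2 _ _)
    | orE φ ψ χ => exact hP.prop _ (.orE _ _ _)
    | allE x t φ h => exact hP.allE h
    | exI x t φ h => exact hP.exI h
    | allImp x φ ψ h => exact hP.allImp _ _ _ h
    | exE x φ ψ h => exact hP.exE _ _ _ h
    | eqRefl t => exact hP.eqRefl _
    | eqSymm t u => exact hP.eqSymm _ _
    | eqTrans t u w => exact hP.eqTrans _ _ _
    | eqSucc t u => exact hP.eqSucc _ _
    | eqAdd => exact hP.eqAdd _ _ _ _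
    | eqMul => exact hP.eqMul _ _ _ _
    | eqLe => exact hP.eqLe _ _ _ _

theorem S_iff (hT : Extends T PAK) (φ : Formula) : S T (Nat.pair 0 φ.code) ↔ Provable T φ := by
  refine ⟨fun h => ?_, S.complete⟩
  have := S.mean (Provable.lg hT) h
  rwa [Mean_th, dec_code] at this

theorem S_num (hT : Extends T PAK) (n c : ℕ) : S T (Nat.pair 3 (Nat.pair n c)) ↔ c = (Term.numeral n).code := by
  constructor
  · intro h
    have := S.mean (Provable.lg hT) h
    rwa [Mean_nu] at this
  · rintro rfl; exact S.num n

end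

end ModalArith

namespace ModalArith

open Formula
open Function (update)

/-! ### The set `S` is `Σ₁` in the standard model -/

section
variable {T : Set Formula}

def St (T : Set Formula) (P : ℕ → Prop) (x : ℕ) : Prop :=
  x = Nat.pair 1 (Nat.pair 0 (Nat.pair 0 0)) ∨
  (∃ p q, P p ∧ P q ∧ ∃ m : ℕ, ∃ s ∈ Ex.schemes, p = s.1.eval (fun i => Nat.beta m i) ∧
    q = s.2.1.eval (fun i => Nat.beta m i) ∧ x = s.2.2.eval (fun i => Nat.beta m i)) ∨
  ∃ d, x = Nat.pair 0 d ∧ ∃ φ ∈ T, φ.code = d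

theorem St.mono {P Q : ℕ → Prop} (h : ∀ n, P n → Q n) {x : ℕ} (hx : St T P x) : St T Q x := by
  rcases hx with h1 | ⟨p, q, h1, h2, h3⟩ | h1
  · exact .inl h1
  · exact .inr (.inl ⟨p, q, h _ h1, h _ h2, h3⟩)
  · exact .inr (.inr h1)

def Dv (T : Set Formula) (g : ℕ → ℕ) (n : ℕ) : Prop := ∀ i < n, St T (fun u => ∃ p < i, g p = u) (g i)

theorem Dv.S {g : ℕ → ℕ} {n : ℕ} (h : Dv T g n) : ∀ i < n, S T (g i) := by
  intro i
  induction i using Nat.strong_induction_on with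
  | _ i ih =>
    intro hi
    rcases h i hi with h1 | ⟨_, _, ⟨p, hp, rfl⟩, ⟨q, hq, rfl⟩, m, s, hs, e1, e2, e3⟩ | ⟨d, h1, φ, h2, rfl⟩
    · rw [h1]; exact .start
    · rw [e3]
      refine S.rule hs _ ?_ ?_
      · rw [← e1]; exact ih p hp (by omega)
      · rw [← e2]; exact ih q hq (by omega)
    · rw [h1]; exact .ax h2

theorem Dv.append {g g' : ℕ → ℕ} {n n' : ℕ} (h : Dv T g n) (h' : Dv T g' n') :
    Dv T (fun i => if i < n then g i else g' (i - n)) (n + n') := by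
  intro i hi
  by_cases hin : i < n
  · simp only [hin, if_true]
    refine (h i hin).mono ?_
    rintro u ⟨p, hp, rfl⟩
    exact ⟨p, hp, by simp [show p < n by omega]⟩
  · simp only [hin, if_false]
    refine (h' (i - n) (by omega)).mono ?_
    rintro u ⟨p, hp, rfl⟩
    exact ⟨p + n, by omega, by simp⟩

theorem Dv.snoc {g : ℕ → ℕ} {n x : ℕ} (h : Dv T g n) (hx : St T (fun u => ∃ p < n, g p = u) x) :
    Dv T (update g n x) (n + 1) := by
  intro i hi
  by_cases hin : i < n
  · rw [Function.update_of_ne (by omega)]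
    refine (h i hin).mono ?_
    rintro u ⟨p, hp, rfl⟩
    exact ⟨p, hp, Function.update_of_ne (by omega) _ _⟩
  · obtain rfl : i = n := by omega
    rw [Function.update_self]
    refine hx.mono ?_
    rintro u ⟨p, hp, rfl⟩
    exact ⟨p, hp, Function.update_of_ne (by omega) _ _⟩

theorem exists_beta (a : Fin 4 → ℕ) : ∃ m, ∀ i : Fin 4, Nat.beta m i = a i := by
  refine ⟨Nat.unbeta (List.ofFn a), fun i => ?_⟩
  have := Nat.beta_unbeta_coe (List.ofFn a) ⟨i, by simp⟩
  refine Eq.trans this ?_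
  exact List.getElem_ofFn (f := a) (i := (i : ℕ)) (by simp)

theorem S.dv {c : ℕ} (h : S T c) : ∃ g n, Dv T g (n+1) ∧ g n = c := by
  induction h with
  | start => exact ⟨fun _ => _, 0, fun i _ => .inl rfl, rfl⟩
  | @ax φ h => exact ⟨fun _ => _, 0, fun i _ => .inr (.inr ⟨_, rfl, _, h, rfl⟩), rfl⟩
  | @rule s hs a _ _ h1 h2 =>
    obtain ⟨g, n, d, e⟩ := h1
    obtain ⟨g', n', d', e'⟩ := h2
    obtain ⟨m, hm⟩ := exists_beta a
    have hm : (fun i : Fin 4 => Nat.beta m i) = a := funext hm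
    refine ⟨_, _, (d.append d').snoc (x := s.2.2.eval a) ?_, Function.update_self _ _ _⟩
    refine .inr (.inl ⟨_, _, ⟨n, by omega, rfl⟩, ⟨n + 1 + n', by omega, rfl⟩, m, s, hs, ?_, ?_, ?_⟩)
    · simp [e, hm]
    · simp [e', hm]; intro; omega
    · simp [hm]

theorem S_iff_beta (c : ℕ) : S T c ↔ ∃ s n, c = Nat.beta s n ∧
    ∀ i < n + 1, St T (fun u => ∃ p < i, Nat.beta s p = u) (Nat.beta s i) := by
  constructor
  · intro h
    obtain ⟨g, n, d, e⟩ := h.dv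
    have hb : ∀ i ≤ n, Nat.beta (Nat.unbeta ((List.range (n+1)).map g)) i = g i := by
      intro i hi
      have := Nat.beta_unbeta_coe ((List.range (n+1)).map g) ⟨i, by simp; omega⟩
      simpa using this
    refine ⟨Nat.unbeta ((List.range (n+1)).map g), n, by rw [hb n le_rfl, e], fun i hi => ?_⟩
    rw [hb i (by omega)]
    refine (d i hi).mono ?_
    rintro u ⟨p, hp, rfl⟩
    exact ⟨p, hp, hb p (by omega)⟩
  · rintro ⟨s, n, rfl, h⟩
    exact Dv.S (g := Nat.beta s) (n := n + 1) h n (by omega)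

theorem SF.add {F G : (ℕ → ℕ) → ℕ} (hF : SF F) (hG : SF G) : SF fun v => F v + G v := by
  refine ⟨?_, fun t => Sg.comp3 (R := fun a b c => c = a + b) (fun s t u => Sg.eq u (.add s t)) hF hG (SF.term t)⟩
  obtain ⟨⟨a, ha⟩, hF⟩ := hF
  obtain ⟨⟨b, hb⟩, hG⟩ := hG
  exact ⟨a + b, fun k hk v m => by simp only; rw [ha _ (by omega), hb _ (by omega)]⟩

theorem SF.const (n : ℕ) : SF fun _ => n :=
  ⟨⟨0, fun _ _ _ _ => rfl⟩, fun t => (Sg.eq t (.numeral n)).of_iff fun v => by rw [val_numeral]⟩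

theorem SF.var (j : ℕ) : SF fun v => v j := SF.term (.var j)

theorem SF.eval {F : Fin 4 → (ℕ → ℕ) → ℕ} (hF : ∀ i, SF (F i)) (e : Ex) : SF fun v => e.eval fun i => F i v := by
  induction e with
  | arg i => exact hF i
  | const n => exact SF.const n
  | pair e f h1 h2 => exact h1.pair h2
  | add e f h1 h2 => exact h1.add h2

theorem Sg.eq2 {F G : (ℕ → ℕ) → ℕ} (hF : SF F) (hG : SF G) : Sg fun v => F v = G v :=
  Sg.comp3 (R := fun a b _ => a = b) (fun s t _ => Sg.eq s t) hF hG hG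

theorem Sg.lt2 {F G : (ℕ → ℕ) → ℕ} (hF : SF F) (hG : SF G) : Sg fun v => F v < G v :=
  Sg.comp3 (R := fun a b _ => a < b) (fun s t _ => Sg.lt s t) hF hG hG

theorem Sg.list {α : Type} {X : α → (ℕ → ℕ) → Prop} (h : ∀ a, Sg (X a)) (L : List α) : Sg fun v => ∃ a ∈ L, X a v := by
  induction L with
  | nil => exact ⟨.falsum, .delta0 .falsum, fun v => by simp [Formula.val]⟩
  | cons a L ih => exact ((h a).or ih).of_iff fun v => by simp

theorem Sg.S (hre : RE T) {F : (ℕ → ℕ) → ℕ} (hF : SF F) : Sg fun v => S T (F v) := by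
  suffices h : ∀ t : Term, Sg fun v => ModalArith.S T (t.val v) from
    Sg.comp3 (R := fun a _ _ => ModalArith.S T a) (fun s _ _ => h s) hF hF hF
  intro t
  have hax : ∀ d, (0 ∈ (Part.assert (∃ φ ∈ T, Formula.code φ = d) fun _ => Part.some 0 : Part ℕ)) ↔ ∃ φ ∈ T, Formula.code φ = d := by
    intro d
    simp [Part.mem_assert_iff]
  have hR : ∀ s : Term, Sg fun v => ∃ φ ∈ T, Formula.code φ = s.val v := fun s =>
    (sgR_of_partrec hre s .zero).of_iff fun v => hax _
  obtain ⟨k, hk⟩ : ∃ k, k = fr t.fv := ⟨_, rfl⟩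
  have h1 : ∀ j v m, t.val (update v (k+j) m) = t.val v := fun j v m => fresh_val (by omega) v m
  have V := SF.var
  -- k+1 = s, k+2 = n, k+3 = i, k+4 = p, k+5 = q, k+6 = m, k+7 = d, k+8 = p', k+9 = q'
  have c1 : Sg fun v => ∃ s ∈ Ex.schemes, v (k+4) = s.1.eval (fun i => Nat.beta (v (k+6)) i) ∧
      v (k+5) = s.2.1.eval (fun i => Nat.beta (v (k+6)) i) ∧ Nat.beta (v (k+1)) (v (k+3)) = s.2.2.eval (fun i => Nat.beta (v (k+6)) i) := by
    refine Sg.list (fun s => ?_) _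
    have hE : ∀ e : Ex, SF fun v => e.eval fun i : Fin 4 => Nat.beta (v (k+6)) i := fun e =>
      SF.eval (F := fun i v => Nat.beta (v (k+6)) i) (fun i => (V _).beta (SF.const _)) e
    exact (Sg.eq2 (V _) (hE _)).and ((Sg.eq2 (V _) (hE _)).and (Sg.eq2 ((V _).beta (V _)) (hE _)))
  have c2 := Sg.ex (k+6) (X := fun v m => ∃ s ∈ Ex.schemes, v (k+4) = s.1.eval (fun i => Nat.beta m i) ∧
      v (k+5) = s.2.1.eval (fun i => Nat.beta m i) ∧ Nat.beta (v (k+1)) (v (k+3)) = s.2.2.eval (fun i => Nat.beta m i))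
      (by simp) c1
  have cp : ∀ j, j = 4 ∨ j = 5 → Sg fun v => ∃ p < v (k+3), Nat.beta (v (k+1)) p = v (k+j) := by
    intro j hj
    refine Sg.ex (k+8) (X := fun v p => p < v (k+3) ∧ Nat.beta (v (k+1)) p = v (k+j)) ?_ ?_
    · rcases hj with rfl | rfl <;> simp
    · exact (Sg.lt2 (V _) (V _)).and (Sg.eq2 ((V _).beta (V _)) (V _))
  have c3 := Sg.ex (k+4) (X := fun v p => ∃ q, (∃ u < v (k+3), Nat.beta (v (k+1)) u = p) ∧ (∃ u < v (k+3), Nat.beta (v (k+1)) u = q) ∧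
     ∃ m, ∃ s ∈ Ex.schemes, p = s.1.eval (fun i => Nat.beta m i) ∧
      q = s.2.1.eval (fun i => Nat.beta m i) ∧ Nat.beta (v (k+1)) (v (k+3)) = s.2.2.eval (fun i => Nat.beta m i)) (by simp)
    (Sg.ex (k+5) (X := fun v q => (∃ u < v (k+3), Nat.beta (v (k+1)) u = v (k+4)) ∧ (∃ u < v (k+3), Nat.beta (v (k+1)) u = q) ∧
     ∃ m, ∃ s ∈ Ex.schemes, v (k+4) = s.1.eval (fun i => Nat.beta m i) ∧
      q = s.2.1.eval (fun i => Nat.beta m i) ∧ Nat.beta (v (k+1)) (v (k+3)) = s.2.2.eval (fun i => Nat.beta m i)) (by simp)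
     ((cp 4 (.inl rfl)).and ((cp 5 (.inr rfl)).and c2)))
  have c4 := Sg.ex (k+7) (X := fun v d => Nat.beta (v (k+1)) (v (k+3)) = Nat.pair 0 d ∧ ∃ φ ∈ T, φ.code = d) (by simp)
    ((Sg.eq2 ((V _).beta (V _)) ((SF.const 0).pair (V _))).and (hR (.var (k+7))))
  have c5 : Sg fun v => St T (fun u => ∃ p < v (k+3), Nat.beta (v (k+1)) p = u) (Nat.beta (v (k+1)) (v (k+3))) :=
    (Sg.eq2 ((V _).beta (V _)) (SF.const _)).or (c3.or c4)
  have c6 := Sg.ball (k+3) (.succ (.var (k+2))) (by simp [Term.fv])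
    (X := fun v i => St T (fun u => ∃ p < i, Nat.beta (v (k+1)) p = u) (Nat.beta (v (k+1)) i)) (by simp) c5
  refine (Sg.ex (k+1) (X := fun v s => ∃ n, t.val v = Nat.beta s n ∧
    ∀ i < n + 1, St T (fun u => ∃ p < i, Nat.beta s p = u) (Nat.beta s i)) (by simp [h1])
    (Sg.ex (k+2) (X := fun v n => t.val v = Nat.beta (v (k+1)) n ∧
    ∀ i < n + 1, St T (fun u => ∃ p < i, Nat.beta (v (k+1)) p = u) (Nat.beta (v (k+1)) i)) (by simp [h1])
     ((((V (k+1)).beta (V (k+2))).2 t).and c6))).of_iff fun v => ?_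
  exact (S_iff_beta _).symm

end

end ModalArith

namespace ModalArith

open Formula
open Function (update)

theorem mem_fv_substAll {φ : Formula} {τ : ℕ → Term} {z : ℕ} (h : z ∈ (φ.substAll τ).fv) :
    ∃ u ∈ φ.fv, z ∈ (τ u).fv := by
  induction φ generalizing τ with
  | falsum => simp [Formula.substAll, Formula.fv] at h
  | eq t u | le t u =>
    simp only [Formula.substAll, Formula.fv, Finset.mem_union, Term.mem_fv_substAll] at h ⊢
    rcases h with ⟨u, h1, h2⟩ | ⟨u, h1, h2⟩
    · exact ⟨u, .inl h1, h2⟩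
    · exact ⟨u, .inr h1, h2⟩
  | and φ ψ h1 h2 | or φ ψ h1 h2 | imp φ ψ h1 h2 =>
    simp only [Formula.substAll, Formula.fv, Finset.mem_union] at h ⊢
    rcases h with h | h
    · obtain ⟨u, a, b⟩ := h1 h; exact ⟨u, .inl a, b⟩
    · obtain ⟨u, a, b⟩ := h2 h; exact ⟨u, .inr a, b⟩
  | neg φ ih | box φ ih => exact ih h
  | all x φ ih | ex x φ ih =>
    simp only [Formula.substAll, Formula.fv, Finset.mem_erase] at h ⊢
    obtain ⟨u, a, b⟩ := ih h.2
    by_cases e : u = x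
    · subst e; simp [Term.fv] at b; exact absurd b h.1
    · rw [Function.update_of_ne e] at b
      exact ⟨u, ⟨e, a⟩, b⟩

theorem subst_numeral_sentence {φ : Formula} {x : ℕ} (h : φ.fv ⊆ {x}) (n : ℕ) : (φ.subst x (Term.numeral n)).fv = ∅ := by
  refine Finset.eq_empty_of_forall_notMem fun z hz => ?_
  obtain ⟨u, a, b⟩ := mem_fv_substAll hz
  have := h a
  simp at this
  subst this
  simp [fv_numeral] at b

section
variable {T : Set Formula}

/-- The sentence `∃ p (p = e ∧ θ)`. -/
def plug (p e : ℕ) (θ : Formula) : Formula := ex p ((eq (.var p) (.numeral e)).and θ)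

theorem prov_delta (hre : RE T) (hT : Extends T PAK) {p y : ℕ} (hpy : p ≠ y) (b : Bool) :
    ∃ δ : Formula, IsDelta0 δ ∧ δ.fv ⊆ {p, y} ∧ ∀ (θ₁ θ₂ : Formula) (v : ℕ → ℕ), v p = (θ₁.and θ₂).code →
      (Provable T (plug p (θ₁.and θ₂).code (bif b then θ₁ else θ₂)) ↔ ∃ n, δ.val (update v y n)) := by
  have key : Sg fun v => (fun e => ∃ c₁ c₂ nc, e = Nat.pair 3 (Nat.pair c₁ c₂) ∧ S T (Nat.pair 3 (Nat.pair e nc)) ∧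
      S T (Nat.pair 0 (Nat.pair 8 (Nat.pair p (Nat.pair 3 (Nat.pair (Nat.pair 1 (Nat.pair (Nat.pair 0 p) nc))
        (bif b then c₁ else c₂))))))) (v p) := by
    have V := SF.var
    have C := SF.const
    refine Sg.ex (p+1) (X := fun v c₁ => ∃ c₂ nc, v p = Nat.pair 3 (Nat.pair c₁ c₂) ∧ S T (Nat.pair 3 (Nat.pair (v p) nc)) ∧
      S T (Nat.pair 0 (Nat.pair 8 (Nat.pair p (Nat.pair 3 (Nat.pair (Nat.pair 1 (Nat.pair (Nat.pair 0 p) nc))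
        (bif b then c₁ else c₂))))))) (by simp) ?_
    refine Sg.ex (p+2) (X := fun v c₂ => ∃ nc, v p = Nat.pair 3 (Nat.pair (v (p+1)) c₂) ∧ S T (Nat.pair 3 (Nat.pair (v p) nc)) ∧
      S T (Nat.pair 0 (Nat.pair 8 (Nat.pair p (Nat.pair 3 (Nat.pair (Nat.pair 1 (Nat.pair (Nat.pair 0 p) nc))
        (bif b then v (p+1) else c₂))))))) (by simp) ?_
    refine Sg.ex (p+3) (X := fun v nc => v p = Nat.pair 3 (Nat.pair (v (p+1)) (v (p+2))) ∧ S T (Nat.pair 3 (Nat.pair (v p) nc)) ∧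
      S T (Nat.pair 0 (Nat.pair 8 (Nat.pair p (Nat.pair 3 (Nat.pair (Nat.pair 1 (Nat.pair (Nat.pair 0 p) nc))
        (bif b then v (p+1) else v (p+2)))))))) (by simp) ?_
    have hb : SF fun v => bif b then v (p+1) else v (p+2) := by cases b <;> exact V _
    exact (Sg.eq2 (V _) ((C _).pair ((V _).pair (V _)))).and ((Sg.S hre ((C _).pair ((V _).pair (V _)))).and
      (Sg.S hre ((C _).pair ((C _).pair ((C _).pair ((C _).pair (((C _).pair (((C _).pair (C _)).pair (V _))).pair hb)))))))
  obtain ⟨δ, d, f, e⟩ := Sg.delta0 (X := fun e => ∃ c₁ c₂ nc, e = Nat.pair 3 (Nat.pair c₁ c₂) ∧ S T (Nat.pair 3 (Nat.pair e nc)) ∧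
      S T (Nat.pair 0 (Nat.pair 8 (Nat.pair p (Nat.pair 3 (Nat.pair (Nat.pair 1 (Nat.pair (Nat.pair 0 p) nc))
        (bif b then c₁ else c₂))))))) hpy key
  refine ⟨δ, d, f, fun θ₁ θ₂ v hv => ?_⟩
  rw [← e v, hv, ← S_iff hT]
  constructor
  · intro h
    refine ⟨θ₁.code, θ₂.code, (Term.numeral (θ₁.and θ₂).code).code, rfl, S.num _, ?_⟩
    cases b <;> exact h
  · rintro ⟨c₁, c₂, nc, h1, h2, h3⟩
    rw [S_num hT] at h2
    subst h2
    simp only [Formula.code, Nat.pair_eq_pair] at h1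
    obtain ⟨_, rfl, rfl⟩ := h1
    cases b <;> exact h3

variable [hT : Fact (Extends T PAK)]

theorem Sat_plug {A : Mdl T} {p e : ℕ} {θ : Formula} {v : ℕ → A.M} :
    A.Sat (plug p e θ) v ↔ A.Sat θ (update v p (e : A.M)) := by
  rw [plug, Mdl.Sat_ex]
  simp [Mdl.Sat_and, Mdl.Sat_eq]

def bigor (x : ℕ) (φ : Formula) : ℕ → Formula
  | 0 => falsum
  | k + 1 => (bigor x φ k).or (box (φ.subst x (.numeral k)))

theorem bigor_deltaB (x : ℕ) (φ : Formula) (k : ℕ) : IsDeltaB (bigor x φ k) := by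
  induction k with
  | zero => exact .delta0 .falsum
  | succ k ih => exact .or ih (.b _)

theorem bigor_sentence {x : ℕ} {φ : Formula} (h : φ.fv ⊆ {x}) (k : ℕ) : Sentence (bigor x φ k) := by
  induction k with
  | zero => rfl
  | succ k ih =>
    unfold Sentence at ih ⊢
    simp only [bigor, Formula.fv, ih, subst_numeral_sentence h, Finset.union_empty]

theorem bigor_dp (hdp : HasDP T IsDeltaB) {x : ℕ} {φ : Formula} (h : φ.fv ⊆ {x}) (k : ℕ) (hp : Provable T (bigor x φ k)) :
    ∃ n : ℕ, Provable T ((box φ).subst x (.numeral n)) := by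
  induction k with
  | zero => exact ⟨0, (Provable.pl T).mp _ _ ((Provable.pl T).prop _ (.falsumE _)) hp⟩
  | succ k ih =>
    rcases hdp _ _ (bigor_deltaB x φ k) (.b _) (bigor_sentence h k) (subst_numeral_sentence h k) hp with h | h
    · exact ih h
    · exact ⟨k, h⟩

theorem Sat_bigor {A : Mdl T} {x : ℕ} {φ : Formula} {v : ℕ → A.M} {j k : ℕ} (hj : j < k)
    (h : A.Sat (box φ) (update v x (j : A.M))) : A.Sat (bigor x φ k) v := by
  induction k with
  | zero => omega
  | succ k ih =>
    rcases Nat.lt_succ_iff_lt_or_eq.1 hj with hj | rfl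
    · exact .inl (ih hj)
    · right
      have := (Sat_numeral (φ := box φ) (x := x) (n := j) v).2 h
      exact this

theorem bep_of_dp (hre : RE T) (hdp : HasDP T IsDeltaB) (hdp2 : HasDP2 T IsSigmaB IsSigma1) : HasEP T IsB := by
  rintro x _ ⟨φ, rfl⟩ hfv hp
  have hfv : φ.fv ⊆ {x} := hfv
  obtain ⟨p, hpx⟩ : ∃ p, p = x + 1 := ⟨_, rfl⟩
  obtain ⟨y, hyx⟩ : ∃ y, y = x + 2 := ⟨_, rfl⟩
  have npx : p ≠ x := by omega
  have npy : p ≠ y := by omega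
  have nxy : x ≠ y := by omega
  obtain ⟨δ₁, d1, f1, e1⟩ := prov_delta hre hT.out npy true
  obtain ⟨δ₂, d2, f2, e2⟩ := prov_delta hre hT.out npx false
  have hy1 : y ∉ (Term.succ (.var x)).fv := by simp [Term.fv, nxy.symm]
  have hx1 : x ∉ (Term.var y).fv := by simp [Term.fv, nxy]
  obtain ⟨θ₁, hθ₁⟩ : ∃ θ, θ = ex x (((box φ).or δ₂).and (ball y (.succ (.var x)) δ₁.neg)) := ⟨_, rfl⟩
  obtain ⟨θ₂, hθ₂⟩ : ∃ θ, θ = ex y (δ₁.and (ball x (.var y) δ₂.neg)) := ⟨_, rfl⟩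
  obtain ⟨e, he⟩ : ∃ e, e = (θ₁.and θ₂).code := ⟨_, rfl⟩
  have e1 := e1 θ₁ θ₂ (update (fun _ => 0) p e) (by simp [he])
  have e2 := e2 θ₁ θ₂ (update (fun _ => 0) p e) (by simp [he])
  rw [← he] at e1 e2
  simp only [cond_true, cond_false] at e1 e2
  have s1 : Sentence (plug p e θ₁) := by
    refine Finset.eq_empty_of_forall_notMem fun z hz => ?_
    have g1 : z ∈ δ₁.fv → _ := fun h => f1 h
    have g2 : z ∈ δ₂.fv → _ := fun h => f2 h
    have g3 : z ∈ φ.fv → _ := fun h => hfv h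
    simp [plug, hθ₁, ball, Formula.lt, Formula.fv, Term.fv, fv_numeral] at hz g1 g2 g3
    grind
  have s2 : Sentence (plug p e θ₂) := by
    refine Finset.eq_empty_of_forall_notMem fun z hz => ?_
    have g1 : z ∈ δ₁.fv → _ := fun h => f1 h
    have g2 : z ∈ δ₂.fv → _ := fun h => f2 h
    simp [plug, hθ₂, ball, Formula.lt, Formula.fv, Term.fv, fv_numeral] at hz g1 g2
    grind
  have c1 : IsSigmaB (plug p e θ₁) := by
    rw [hθ₁]
    exact .ex (.and (.sigma1 (.delta0 (.eq _ _))) (.ex (.and (.or (.b _) (.sigma1 (.delta0 d2)))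
      (.ball hy1 (.sigma1 (.delta0 (.neg d1)))))))
  have c2 : IsSigma1 (plug p e θ₂) := by
    rw [hθ₂]
    exact .ex (.and (.delta0 (.eq _ _)) (.ex (.and (.delta0 d1) (.ball hx1 (.delta0 (.neg d2))))))
  -- semantic description
  have hx1' : x ∉ δ₁.fv := fun h => by have := f1 h; simp at this; omega
  have hy2' : y ∉ δ₂.fv := fun h => by have := f2 h; simp at this; omega
  have S1 : ∀ (A : Mdl T) (v : ℕ → A.M), A.Sat (plug p e θ₁) v ↔ ∃ b,
      (A.Sat (box φ) (update (update v p (e : A.M)) x b) ∨ A.Sat δ₂ (update (update v p (e : A.M)) x b)) ∧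
      ∀ c < b + 1, ¬ A.Sat δ₁ (update (update v p (e : A.M)) y c) := by
    intro A v
    rw [Sat_plug, hθ₁, Mdl.Sat_ex]
    simp only [Mdl.Sat_and, Mdl.Sat_or, A.Sat_ball hy1, Mdl.Sat_neg, Mdl.ev_succ, Mdl.ev_var, Function.update_self,
      Function.update_comm nxy, A.Sat_update hx1']
  have S2 : ∀ (A : Mdl T) (v : ℕ → A.M), A.Sat (plug p e θ₂) v ↔ ∃ c,
      A.Sat δ₁ (update (update v p (e : A.M)) y c) ∧
      ∀ b < c, ¬ A.Sat δ₂ (update (update v p (e : A.M)) x b) := by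
    intro A v
    rw [Sat_plug, hθ₂, Mdl.Sat_ex]
    simp only [Mdl.Sat_and, A.Sat_ball hx1, Mdl.Sat_neg, Mdl.ev_var, Function.update_self,
      Function.update_comm nxy.symm, A.Sat_update hy2']
  have B1 : ∀ (A : Mdl T) (v : ℕ → A.M) (n : ℕ), A.Sat δ₁ (update (update v p (e : A.M)) y (n : A.M)) ↔
      δ₁.val (update (update (fun _ => 0) p e) y n) := by
    intro A v n
    rw [← A.delta0_abs d1]
    apply A.Sat_congr
    intro z hz
    have := f1 hz
    simp at this
    rcases this with rfl | rfl <;> simp [Mdl.cst, npy]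
  have B2 : ∀ (A : Mdl T) (v : ℕ → A.M) (n : ℕ), A.Sat δ₂ (update (update v p (e : A.M)) x (n : A.M)) ↔
      δ₂.val (update (update (fun _ => 0) p e) x n) := by
    intro A v n
    rw [← A.delta0_abs d2]
    apply A.Sat_congr
    intro z hz
    have := f2 hz
    simp at this
    rcases this with rfl | rfl <;> simp [Mdl.cst, npx]
  have Bx : ∀ (A : Mdl T) (v : ℕ → A.M) (a : A.M), A.Sat (box φ) (update (update v p (e : A.M)) x a) ↔
      A.Sat (box φ) (update v x a) := by
    intro A v a
    apply A.Sat_congr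
    intro z hz
    have := hfv hz
    simp at this
    subst this; simp
  have hor : Provable T ((plug p e θ₁).or (plug p e θ₂)) := by
    apply completeness hT.out
    intro A v
    rw [Mdl.Sat_or, S1, S2]
    obtain ⟨a, ha⟩ := A.sound _ hp v
    rw [← Bx] at ha
    obtain ⟨b, hb, hb'⟩ := A.lnp ((box φ).or δ₂) x (update v p (e : A.M)) (a := a) (.inl ha)
    by_cases hc : ∃ c < b + 1, A.Sat δ₁ (update (update v p (e : A.M)) y c)
    · right
      obtain ⟨c, hc, h⟩ := hc
      refine ⟨c, h, fun b' hb'' h' => hb' b' ?_ (.inr h')⟩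
      exact lt_of_lt_of_le hb'' ((A.lt_succ _ _).1 hc)
    · left
      push Not at hc
      exact ⟨b, hb, hc⟩
  have hn : ∃ n, δ₁.val (update (update (fun _ => 0) p e) y n) ∨ δ₂.val (update (update (fun _ => 0) p e) x n) := by
    rcases hdp2 _ _ c1 c2 s1 s2 hor with h | h
    · obtain ⟨n, h⟩ := e1.1 h; exact ⟨n, .inl h⟩
    · obtain ⟨n, h⟩ := e2.1 h; exact ⟨n, .inr h⟩
  classical
  obtain ⟨k, hk, hmin⟩ : ∃ k, (δ₁.val (update (update (fun _ => 0) p e) y k) ∨ δ₂.val (update (update (fun _ => 0) p e) x k)) ∧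
      ∀ m < k, ¬ (δ₁.val (update (update (fun _ => 0) p e) y m) ∨ δ₂.val (update (update (fun _ => 0) p e) x m)) :=
    ⟨Nat.find hn, Nat.find_spec hn, fun m hm => Nat.find_min hn hm⟩
  by_cases h1 : δ₁.val (update (update (fun _ => 0) p e) y k)
  · have hW := e1.2 ⟨k, h1⟩
    refine bigor_dp hdp hfv k (completeness hT.out fun A v => ?_)
    obtain ⟨b, hb, hb'⟩ := (S1 A v).1 (A.sound _ hW v)
    have hbk : b < (k : A.M) := by
      by_contra hc
      exact hb' (k : A.M) ((A.lt_succ _ _).2 (not_lt.1 hc)) ((B1 A v k).2 h1)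
    obtain ⟨j, hj, rfl⟩ := A.std_lt hbk
    rcases hb with hb | hb
    · rw [Bx] at hb
      exact Sat_bigor hj hb
    · exact absurd (.inr ((B2 A v j).1 hb)) (hmin j hj)
  · have h2 := hk.resolve_left h1
    have hW := e2.2 ⟨k, h2⟩
    refine ⟨0, completeness hT.out fun A v => ?_⟩
    exfalso
    obtain ⟨c, hc, hc'⟩ := (S2 A v).1 (A.sound _ hW v)
    have hck : c < ((k + 1 : ℕ) : A.M) := by
      push_cast
      refine (A.lt_succ _ _).2 (not_lt.1 fun h => hc' _ h ((B2 A v k).2 h2))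
    obtain ⟨j, hj, rfl⟩ := A.std_lt hck
    have hj' := (B1 A v j).1 hc
    rcases Nat.lt_succ_iff_lt_or_eq.1 hj with hj | rfl
    · exact hmin j hj (.inl hj')
    · exact h1 hj'

theorem dp_of_ep (hep : HasEP T IsSigmaB) : HasDP T IsSigmaB := by
  intro φ ψ hφ hψ sφ sψ h
  have q1 : ∀ (A : Mdl T) (v : ℕ → A.M) a, A.Sat φ (update v 0 a) ↔ A.Sat φ v := fun A v a =>
    A.Sat_update (by rw [sφ]; simp) a
  have q2 : ∀ (A : Mdl T) (v : ℕ → A.M) a, A.Sat ψ (update v 0 a) ↔ A.Sat ψ v := fun A v a =>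
    A.Sat_update (by rw [sψ]; simp) a
  obtain ⟨n, hn⟩ := hep 0 (((eq (.var 0) .zero).and φ).or ((eq (.var 0) .zero).neg.and ψ))
    (.or (.and (.sigma1 (.delta0 (.eq _ _))) hφ) (.and (.sigma1 (.delta0 (.neg (.eq _ _)))) hψ))
    (by
      have sφ : φ.fv = ∅ := sφ
      have sψ : ψ.fv = ∅ := sψ
      simp [Formula.fv, Term.fv, sφ, sψ])
    (completeness hT.out fun A v => by
      rw [Mdl.Sat_ex]
      rcases A.sound _ h v with h | h
      · exact ⟨0, .inl ⟨by simp [Mdl.Sat_eq], (q1 A v 0).2 h⟩⟩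
      · exact ⟨1, .inr ⟨by simp [Mdl.Sat_neg, Mdl.Sat_eq], (q2 A v 1).2 h⟩⟩)
  cases n with
  | zero =>
    left
    refine completeness hT.out fun A v => ?_
    have := A.sound _ hn v
    rw [Sat_numeral] at this
    rcases this with h | h
    · exact (q1 A v _).1 h.2
    · exact absurd (by simp [Mdl.Sat_eq]) h.1
  | succ n =>
    right
    refine completeness hT.out fun A v => ?_
    have := A.sound _ hn v
    rw [Sat_numeral] at this
    rcases this with h | h
    · exfalso
      have h := h.1
      rw [Mdl.Sat_eq, Mdl.ev_var, Mdl.ev_zero, Function.update_self, Nat.cast_eq_zero] at h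
      omega
    · exact (q2 A v _).1 h.2

end

theorem IsDeltaB.sigmaB {φ : Formula} (h : IsDeltaB φ) : IsSigmaB φ := by
  induction h with
  | delta0 h => exact .sigma1 (.delta0 h)
  | b ψ => exact .b ψ
  | and _ _ h1 h2 => exact .and h1 h2
  | or _ _ h1 h2 => exact .or h1 h2
  | ball hx _ h => exact .ball hx h
  | bex hx _ h => exact .ex (.and (.sigma1 (.delta0 (.le _ _))) h)

theorem statement16_aux (T : Set Formula) (hre : RE T) (hT : Extends T PAK)
    (hbot : ¬ Provable T (Formula.box Formula.falsum)) :
    List.TFAE [HasDP T IsDeltaB ∧ HasDP2 T IsSigmaB IsSigma1,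
      HasEP T IsB, HasEP T IsSigmaB, HasDP T IsSigmaB] := by
  have : Fact (Extends T PAK) := ⟨hT⟩
  tfae_have 1 → 2 := fun h => bep_of_dp hre h.1 h.2
  tfae_have 2 → 3 := fun h => ep_of_bep hbot h
  tfae_have 3 → 4 := fun h => dp_of_ep h
  tfae_have 4 → 1 := fun h => ⟨fun φ ψ a b => h φ ψ a.sigmaB b.sigmaB, fun φ ψ a b => h φ ψ a (.sigma1 b)⟩
  tfae_finish

end ModalArith

namespace ModalArith

/-- For an r.e. extension T of PA(K) with T ⊬ □⊥, the following are pairwise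
equivalent: (1) ΔB-DP together with (ΣB, Σ₁)-DP; (2) B-EP; (3) ΣB-EP; (4) ΣB-DP. -/
theorem statement16 (T : Set Formula) (hre : RE T) (hT : Extends T PAK)
    (hbot : ¬ Provable T (Formula.box Formula.falsum)) :
    List.TFAE [HasDP T IsDeltaB ∧ HasDP2 T IsSigmaB IsSigma1,
      HasEP T IsB, HasEP T IsSigmaB, HasDP T IsSigmaB] := by
  exact statement16_aux T hre hT hbot

end ModalArith
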